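/- Let n ≥ 7 and d be integers, let 𝓔 be a direct sum of three invertible sheaves on ℙ^{n−1} over ℂ, and let X be a very general member of |2D + dF| on ℙ_{ℙ^{n−1}}(𝓔) (D the tautological divisor, F the pullback of a hyperplane) such that the projection π : X → ℙ^{n−1} is a standard conic bundle (X nonsingular and π flat). Let Δ ⊂ ℙ^{n−1} be the discriminant divisor of π. If the complete linear system |2K_{ℙ^{n−1}} + Δ| is nonempty, then X is not stably rational. -/

import Mathlib

section
open MvPolynomial

set_option maxHeartbeats 1600000
set_option synthInstance.maxHeartbeats 400000

namespace ConicBundleFormalization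

noncomputable section

variable (K : Type) [Field K]

abbrev Cox (n m : ℕ) : Type := MvPolynomial (Fin n ⊕ Fin m) K

def IsBihom (n m : ℕ) (w : Fin m → ℤ) (a : Fin m → ℕ) (α : ℤ) (β : ℕ)
    (p : Cox K n m) : Prop :=
  ∀ e ∈ p.support,
    ((∑ i : Fin n, (e (Sum.inl i) : ℤ)) + ∑ j : Fin m, (e (Sum.inr j) : ℤ) * w j = α) ∧
    ((∑ j : Fin m, e (Sum.inr j) * a j) = β)

def IsHomogZ (n : ℕ) (d : ℤ) (p : MvPolynomial (Fin n) K) : Prop :=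
  ∀ e ∈ p.support, (∑ i : Fin n, (e i : ℤ)) = d

def IsWHom (m : ℕ) (a : Fin m → ℕ) (e : ℕ) (q : MvPolynomial (Fin m) K) : Prop :=
  ∀ ex ∈ q.support, (∑ j : Fin m, ex j * a j) = e

def evalCoeff {n m : ℕ} (p : Cox K n m)
    (D : MvPolynomial ((Fin n ⊕ Fin m) →₀ ℕ) K) : K :=
  MvPolynomial.eval (fun e => p.coeff e) D

def GenerallyHolds (n m : ℕ) (w : Fin m → ℤ) (a : Fin m → ℕ) (α : ℤ) (β : ℕ)
    (Pred : Cox K n m → Prop) : Prop :=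
  ∃ D : MvPolynomial ((Fin n ⊕ Fin m) →₀ ℕ) K,
    (∃ p₀, IsBihom K n m w a α β p₀ ∧ evalCoeff K p₀ D ≠ 0) ∧
    ∀ p, IsBihom K n m w a α β p → evalCoeff K p D ≠ 0 → Pred p

def VeryGenerallyHolds (n m : ℕ) (w : Fin m → ℤ) (a : Fin m → ℕ) (α : ℤ) (β : ℕ)
    (Pred : Cox K n m → Prop) : Prop :=
  ∃ D : ℕ → MvPolynomial ((Fin n ⊕ Fin m) →₀ ℕ) K,
    (∀ i, ∃ p₀, IsBihom K n m w a α β p₀ ∧ evalCoeff K p₀ (D i) ≠ 0) ∧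
    ∀ p, IsBihom K n m w a α β p → (∀ i, evalCoeff K p (D i) ≠ 0) → Pred p

def evalCoeff4 {n : ℕ} (abcf : Fin 4 → MvPolynomial (Fin n) K)
    (D : MvPolynomial (Fin 4 × (Fin n →₀ ℕ)) K) : K :=
  MvPolynomial.eval (fun q => (abcf q.1).coeff q.2) D

def GenerallyHolds4 (n : ℕ) (degs : Fin 4 → ℤ)
    (Pred : (Fin 4 → MvPolynomial (Fin n) K) → Prop) : Prop :=
  ∃ D : MvPolynomial (Fin 4 × (Fin n →₀ ℕ)) K,
    (∃ abcf : Fin 4 → MvPolynomial (Fin n) K,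
      (∀ i, IsHomogZ K n (degs i) (abcf i)) ∧ evalCoeff4 K abcf D ≠ 0) ∧
    ∀ abcf : Fin 4 → MvPolynomial (Fin n) K,
      (∀ i, IsHomogZ K n (degs i) (abcf i)) → evalCoeff4 K abcf D ≠ 0 → Pred abcf

abbrev Pt (n m : ℕ) : Type := (Fin n → K) × (Fin m → K)

def evalPt {n m : ℕ} (p : Pt K n m) (f : Cox K n m) : K :=
  MvPolynomial.eval (Sum.elim p.1 p.2) f

def InCone {n m : ℕ} (p : Pt K n m) : Prop := p.1 ≠ 0 ∧ p.2 ≠ 0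

def ToricEq {n m : ℕ} (w : Fin m → ℤ) (a : Fin m → ℕ) (p q : Pt K n m) : Prop :=
  ∃ s t : Kˣ, (∀ i, q.1 i = (s : K) * p.1 i) ∧
    (∀ j, q.2 j = ((s ^ (w j) : Kˣ) : K) * (t : K) ^ (a j) * p.2 j)

def XCone {n m : ℕ} (g : Cox K n m) : Set (Pt K n m) :=
  {p | InCone K p ∧ evalPt K p g = 0}

def JacobiSmoothOn {n m : ℕ} (g : Cox K n m) (S : Set (Pt K n m)) : Prop :=
  ∀ p ∈ S, evalPt K p g = 0 → ∃ v : Fin n ⊕ Fin m, evalPt K p (pderiv v g) ≠ 0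

def IsSmoothModel {n m : ℕ} (g : Cox K n m) : Prop :=
  JacobiSmoothOn K g {p | InCone K p}

abbrev coneRing {n m : ℕ} (g : Cox K n m) : Type :=
  Cox K n m ⧸ Ideal.span {g}

def FracCone {n m : ℕ} (g : Cox K n m) : Type := FractionRing (coneRing K g)

instance {n m : ℕ} (g : Cox K n m) : CommRing (FracCone K g) :=
  inferInstanceAs (CommRing (FractionRing (coneRing K g)))

instance {n m : ℕ} (g : Cox K n m) : Algebra K (FracCone K g) :=
  inferInstanceAs (Algebra K (FractionRing (coneRing K g)))

instance {n m : ℕ} (g : Cox K n m) : Algebra (coneRing K g) (FracCone K g) :=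
  inferInstanceAs (Algebra (coneRing K g) (FractionRing (coneRing K g)))

def toFrac {n m : ℕ} (g : Cox K n m) : Cox K n m →+* FracCone K g :=
  (algebraMap (coneRing K g) (FracCone K g)).comp
    (Ideal.Quotient.mk (Ideal.span {g}))

def ratioSet {n m : ℕ} (w : Fin m → ℤ) (a : Fin m → ℕ) (g : Cox K n m) :
    Set (FracCone K g) :=
  {φ | ∃ (α : ℤ) (β : ℕ) (p q : Cox K n m),
    IsBihom K n m w a α β p ∧ IsBihom K n m w a α β q ∧
    toFrac K g q ≠ 0 ∧ φ * toFrac K g q = toFrac K g p}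

def functionFieldModel {n m : ℕ} (w : Fin m → ℤ) (a : Fin m → ℕ) (g : Cox K n m) :
    Subalgebra K (FracCone K g) :=
  Algebra.adjoin K (ratioSet K w a g)

def IsRationalModel {n m : ℕ} (w : Fin m → ℤ) (a : Fin m → ℕ) (g : Cox K n m) :
    Prop :=
  ∃ N : ℕ, Nonempty
    (functionFieldModel K w a g ≃ₐ[K] FractionRing (MvPolynomial (Fin N) K))

def IsStablyRationalModel {n m : ℕ} (w : Fin m → ℤ) (a : Fin m → ℕ)
    (g : Cox K n m) : Prop :=
  ∃ r s : ℕ, Nonempty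
    ((FractionRing (MvPolynomial (Fin r) (functionFieldModel K w a g)))
      ≃ₐ[K] FractionRing (MvPolynomial (Fin s) K))

def RelevantPrime {n m : ℕ} (P : Ideal (Cox K n m)) : Prop :=
  (∃ i, X (Sum.inl i) ∉ P) ∧ (∃ j, X (Sum.inr j) ∉ P)

def IsNormalModel {n m : ℕ} (g : Cox K n m) : Prop :=
  ∀ P : PrimeSpectrum (coneRing K g),
    ((∃ i, Ideal.Quotient.mk (Ideal.span {g}) (X (Sum.inl i)) ∉ P.asIdeal) ∧
     (∃ j, Ideal.Quotient.mk (Ideal.span {g}) (X (Sum.inr j)) ∉ P.asIdeal)) →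
    IsIntegrallyClosed (Localization.AtPrime P.asIdeal)

def SingularLocusCodimAtLeast {n m : ℕ} (g : Cox K n m) (c : ℕ) : Prop :=
  ∀ P : PrimeSpectrum (Cox K n m), RelevantPrime K P.asIdeal →
    g ∈ P.asIdeal → (∀ v : Fin n ⊕ Fin m, pderiv v g ∈ P.asIdeal) →
    ((c + 1 : ℕ) : WithBot (WithTop ℕ)) ≤ ringKrullDim (Localization.AtPrime P.asIdeal)

def HasOnlyTerminalSingularitiesModel {n m : ℕ} (g : Cox K n m) : Prop :=
  IsNormalModel K g ∧ SingularLocusCodimAtLeast K g 3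

def IsBihomIdeal {n m : ℕ} (w : Fin m → ℤ) (a : Fin m → ℕ)
    (P : Ideal (Cox K n m)) : Prop :=
  P ≤ Ideal.span {f | f ∈ P ∧ ∃ α β, IsBihom K n m w a α β f}

def IsPrimeDivisorOn {n m : ℕ} (w : Fin m → ℤ) (a : Fin m → ℕ) (g : Cox K n m)
    (P : PrimeSpectrum (Cox K n m)) : Prop :=
  g ∈ P.asIdeal ∧ RelevantPrime K P.asIdeal ∧ IsBihomIdeal K w a P.asIdeal ∧
    ringKrullDim (Localization.AtPrime P.asIdeal) = (2 : WithBot (WithTop ℕ))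

def ClassGroupSpannedByFD {n m : ℕ} (w : Fin m → ℤ) (a : Fin m → ℕ)
    (g : Cox K n m) : Prop :=
  ∀ P : PrimeSpectrum (Cox K n m), IsPrimeDivisorOn K w a g P →
    ∃ (α : ℤ) (β : ℕ) (f : Cox K n m),
      f ∉ Ideal.span {g} ∧ IsBihom K n m w a α β f ∧ f ∈ P.asIdeal ∧
      ∀ Q : PrimeSpectrum (Cox K n m), IsPrimeDivisorOn K w a g Q → Q ≠ P →
        f ∉ Q.asIdeal

def PicardRankAtLeastThree {n m : ℕ} (w : Fin m → ℤ) (a : Fin m → ℕ)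
    (g : Cox K n m) : Prop :=
  ¬ ClassGroupSpannedByFD K w a g

def fibreCone {n m : ℕ} (g : Cox K n m) (u : Fin n → K) : Set (Fin m → K) :=
  {v | v ≠ 0 ∧ evalPt K (u, v) g = 0}

def FibresNonemptyAndConnected {n m : ℕ} (a : Fin m → ℕ) (g : Cox K n m) : Prop :=
  ∀ u : Fin n → K, u ≠ 0 →
    (fibreCone K g u).Nonempty ∧
    ∀ A B : Set (MvPolynomial (Fin m) K),
      (∀ q ∈ A ∪ B, ∃ e, IsWHom K m a e q) →
      (∀ v ∈ fibreCone K g u,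
        (∀ q ∈ A, MvPolynomial.eval v q = 0) ∨ (∀ q ∈ B, MvPolynomial.eval v q = 0)) →
      (∀ v ∈ fibreCone K g u,
        ¬ ((∀ q ∈ A, MvPolynomial.eval v q = 0) ∧ (∀ q ∈ B, MvPolynomial.eval v q = 0))) →
      ¬ ((∃ v ∈ fibreCone K g u, ∀ q ∈ A, MvPolynomial.eval v q = 0) ∧
         (∃ v ∈ fibreCone K g u, ∀ q ∈ B, MvPolynomial.eval v q = 0))

def orbitVec₁ {n m : ℕ} (w : Fin m → ℤ) (p : Pt K n m) : (Fin n ⊕ Fin m) → K :=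
  Sum.elim (fun i => p.1 i) (fun j => (w j : K) * p.2 j)

def orbitVec₂ {n m : ℕ} (a : Fin m → ℕ) (p : Pt K n m) : (Fin n ⊕ Fin m) → K :=
  Sum.elim (fun _ => 0) (fun j => (a j : K) * p.2 j)

def BasePointFreeOnX {n m : ℕ} (w : Fin m → ℤ) (a : Fin m → ℕ) (g : Cox K n m)
    (α : ℤ) (β : ℕ) : Prop :=
  ∀ p ∈ XCone K g, ∃ s, IsBihom K n m w a α β s ∧ evalPt K p s ≠ 0

def SeparatesPointsOnX {n m : ℕ} (w : Fin m → ℤ) (a : Fin m → ℕ) (g : Cox K n m)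
    (α : ℤ) (β : ℕ) : Prop :=
  ∀ p ∈ XCone K g, ∀ q ∈ XCone K g, ¬ ToricEq K w a p q →
    ∃ s₁ s₂, IsBihom K n m w a α β s₁ ∧ IsBihom K n m w a α β s₂ ∧
      evalPt K p s₁ * evalPt K q s₂ ≠ evalPt K q s₁ * evalPt K p s₂

def SeparatesTangentsOnX {n m : ℕ} (w : Fin m → ℤ) (a : Fin m → ℕ) (g : Cox K n m)
    (α : ℤ) (β : ℕ) : Prop :=
  ∀ p ∈ XCone K g, ∀ t : (Fin n ⊕ Fin m) → K,
    (∑ v : Fin n ⊕ Fin m, t v * evalPt K p (pderiv v g)) = 0 →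
    t ∉ Submodule.span K {orbitVec₁ K w p, orbitVec₂ K a p} →
    ∃ s, IsBihom K n m w a α β s ∧ evalPt K p s = 0 ∧
      (∑ v : Fin n ⊕ Fin m, t v * evalPt K p (pderiv v s)) ≠ 0

def IsAmpleClassOnX {n m : ℕ} (w : Fin m → ℤ) (a : Fin m → ℕ) (g : Cox K n m)
    (α : ℤ) (β : ℕ) : Prop :=
  ∃ t : ℕ, 0 < t ∧
    BasePointFreeOnX K w a g (t * α) (t * β) ∧
    SeparatesPointsOnX K w a g (t * α) (t * β) ∧
    SeparatesTangentsOnX K w a g (t * α) (t * β)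

def ambientCanonicalClass (n m : ℕ) (w : Fin m → ℤ) : ℤ × ℤ :=
  (-(n : ℤ) - ∑ j : Fin m, w j, -(m : ℤ))

def memberAntiCanonicalClass (n m : ℕ) (w : Fin m → ℤ) (α : ℤ) (β : ℕ) : ℤ × ℤ :=
  (-((ambientCanonicalClass n m w).1 + α), -((ambientCanonicalClass n m w).2 + β))

def AntiCanonicalIsRelativelyAmple {n m : ℕ} (w : Fin m → ℤ) (a : Fin m → ℕ)
    (g : Cox K n m) (α : ℤ) (β : ℕ) : Prop :=
  ∃ N : ℤ,
    IsAmpleClassOnX K w a g ((memberAntiCanonicalClass n m w α β).1 + N)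
      (memberAntiCanonicalClass n m w α β).2.toNat

structure IsConicBundleModel (n : ℕ) (w : Fin 3 → ℤ) (d : ℤ) (g : Cox K n 3) :
    Prop where
  bihom : IsBihom K n 3 w (fun _ => 1) d 2 g
  integral : (Ideal.span {g} : Ideal (Cox K n 3)).IsPrime
  normal : IsNormalModel K g
  terminal : HasOnlyTerminalSingularitiesModel K g
  connectedFibres : FibresNonemptyAndConnected K (fun _ => 1) g
  antiCanonicalRelAmple :
    AntiCanonicalIsRelativelyAmple K w (fun _ => 1) g d 2
  picardRankTwo : ClassGroupSpannedByFD K w (fun _ => 1) g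

def fibreCoeff {n m : ℕ} (g : Cox K n m) (e : Fin m →₀ ℕ) :
    MvPolynomial (Fin n) K :=
  ((MvPolynomial.sumAlgEquiv K (Fin m) (Fin n))
    (MvPolynomial.rename Sum.swap g)).coeff e

def quadraticMatrix {n : ℕ} (g : Cox K n 3) :
    Matrix (Fin 3) (Fin 3) (MvPolynomial (Fin n) K) :=
  fun i j =>
    if i = j then fibreCoeff K g (Finsupp.single i 2)
    else MvPolynomial.C ((2 : K)⁻¹) *
      fibreCoeff K g (Finsupp.single i 1 + Finsupp.single j 1)

def discriminantPoly {n : ℕ} (g : Cox K n 3) : MvPolynomial (Fin n) K :=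
  (quadraticMatrix K g).det

def KMultipleplusDiscriminantEffective {n : ℕ} (g : Cox K n 3) (k : ℕ) : Prop :=
  discriminantPoly K g ≠ 0 ∧
    ∃ h : MvPolynomial (Fin n) K, h ≠ 0 ∧
      IsHomogZ K n (((discriminantPoly K g).totalDegree : ℤ) - k * n) h

def ProjectionIsFlat {n m : ℕ} (g : Cox K n m) : Prop :=
  ∀ u : Fin n → K, u ≠ 0 → ∃ v : Fin m → K, evalPt K (u, v) g ≠ 0

end

end ConicBundleFormalization

namespace ConicBundleFormalization

noncomputable section

variable (K : Type) [Field K]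

def specialMemberX {n : ℕ} (abcf : Fin 4 → MvPolynomial (Fin n) K) : Cox K n 3 :=
  rename Sum.inl (abcf 0) * X (Sum.inr 0) ^ 2 +
  rename Sum.inl (abcf 1) * X (Sum.inr 1) ^ 2 +
  rename Sum.inl (abcf 2) * X (Sum.inr 2) ^ 2 +
  rename Sum.inl (abcf 3) * X (Sum.inr 0) * X (Sum.inr 1)

def specialMemberZ {n : ℕ} (abcf : Fin 4 → MvPolynomial (Fin n) K) : Cox K n 3 :=
  rename Sum.inl (abcf 0) * X (Sum.inr 0) ^ 2 +
  rename Sum.inl (abcf 1) * X (Sum.inr 1) ^ 2 +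
  rename Sum.inl (abcf 2) * X (Sum.inr 2) +
  rename Sum.inl (abcf 3) * X (Sum.inr 0) * X (Sum.inr 1)

def AdmissibleNormalForm {N : ℕ} (F : MvPolynomial (Fin N) K) : Prop :=
  (∀ i, F.coeff (Finsupp.single i 1) = 0) ∧
  (N % 2 = 0 →
    (∀ i, F.coeff (Finsupp.single i 2) = 0) ∧
    (∀ i j : Fin N, (i : ℕ) < (j : ℕ) →
      F.coeff (Finsupp.single i 1 + Finsupp.single j 1) =
        (if (i : ℕ) % 2 = 0 ∧ (j : ℕ) = (i : ℕ) + 1 then 1 else 0))) ∧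
  (N % 2 = 1 →
    (∀ i : Fin N, (i : ℕ) ≠ 0 → F.coeff (Finsupp.single i 2) = 0) ∧
    (∀ i j : Fin N, (i : ℕ) < (j : ℕ) →
      F.coeff (Finsupp.single i 1 + Finsupp.single j 1) =
        (if (i : ℕ) % 2 = 1 ∧ (j : ℕ) = (i : ℕ) + 1 then 1 else 0)) ∧
    (∀ h0 : 0 < N, F.coeff (Finsupp.single (⟨0, h0⟩ : Fin N) 3) ≠ 0))

def AdmissibleLocalFunction {ι : Type} [Fintype ι] (F : MvPolynomial ι K) : Prop :=
  ∃ (N : ℕ) (e : ι ≃ Fin N) (T : Matrix (Fin N) (Fin N) K), IsUnit T.det ∧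
    AdmissibleNormalForm K
      ((aeval (fun i : ι => ∑ j : Fin N, MvPolynomial.C (T (e i) j) * X j)) F)

def chartPolyX {n : ℕ} (abcf : Fin 4 → MvPolynomial (Fin n) K) :
    MvPolynomial (Fin n ⊕ Fin 1) K :=
  rename Sum.inl (abcf 2) *
    (rename Sum.inl (abcf 0) + rename Sum.inl (abcf 1) * X (Sum.inr 0) ^ 2 +
      rename Sum.inl (abcf 3) * X (Sum.inr 0))

def chartPolyY {n : ℕ} (abcf : Fin 4 → MvPolynomial (Fin n) K) :
    MvPolynomial (Fin n ⊕ Fin 1) K :=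
  rename Sum.inl (abcf 2) *
    (rename Sum.inl (abcf 0) * X (Sum.inr 0) ^ 2 + rename Sum.inl (abcf 1) +
      rename Sum.inl (abcf 3) * X (Sum.inr 0))

def localAt {n : ℕ} (i0 : Fin n) (u0 : Fin n → K) (y0 : K)
    (G : MvPolynomial (Fin n ⊕ Fin 1) K) :
    MvPolynomial ({ j : Fin n // j ≠ i0 } ⊕ Fin 1) K :=
  aeval (Sum.elim
    (fun j => if h : j = i0 then 1 else X (Sum.inl ⟨j, h⟩) + MvPolynomial.C (u0 j))
    (fun _ => X (Sum.inr 0) + MvPolynomial.C y0)) G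

def CriticalPointOfZbar {n : ℕ} (gZ : Cox K n 3) (i0 : Fin n) (jfix : Fin 3)
    (p : Pt K n 3) : Prop :=
  ∀ t : (Fin n ⊕ Fin 3) → K, t (Sum.inl i0) = 0 → t (Sum.inr jfix) = 0 →
    (∑ v : Fin n ⊕ Fin 3, t v * evalPt K p (pderiv v gZ)) = 0 →
    t (Sum.inr 2) = 0

def SingularConePoint {n m : ℕ} (g : Cox K n m) (p : Pt K n m) : Prop :=
  p ∈ XCone K g ∧ ∀ v : Fin n ⊕ Fin m, evalPt K p (pderiv v g) = 0

end

end ConicBundleFormalization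

end

set_option linter.unusedSectionVars false

namespace ConicBundleFormalization
open MvPolynomial

section Wronskian
variable {k A : Type*} [CommRing k] [CommRing A] [Algebra k A] {m : ℕ}

def EOp (D : Fin m → Derivation k A A) (r : Fin (m+1)) (y : A) : A :=
  Fin.cases y (fun i => D i y) r

def Wr (D : Fin m → Derivation k A A) (y : Fin (m+1) → A) : A :=
  Matrix.det (Matrix.of fun r j => EOp D r (y j))

@[simp] lemma EOp_zero (D : Fin m → Derivation k A A) (y : A) : EOp D 0 y = y := rfl
@[simp] lemma EOp_succ (D : Fin m → Derivation k A A) (i : Fin m) (y : A) :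
    EOp D i.succ y = D i y := rfl

lemma Wr_smul (D : Fin m → Derivation k A A) (c : A) (y : Fin (m+1) → A) :
    Wr D (fun j => c * y j) = c ^ (m+1) * Wr D y := by
  have h : (Matrix.of fun r j => EOp D r (c * y j)) =
      (Matrix.of fun (r s : Fin (m+1)) => if r = s then c else if s = 0 then EOp D r c else 0) *
      (Matrix.of fun r j => EOp D r (y j)) := by
    ext r j
    rw [Matrix.mul_apply]
    refine Fin.cases ?_ (fun i => ?_) r
    · rw [Finset.sum_eq_single 0]
      · simp
      · intro b _ hb
        simp [hb, Ne.symm hb]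
      · simp
    · rw [Fin.sum_univ_succ, Finset.sum_eq_single i]
      · simp [Derivation.leibniz, Fin.succ_ne_zero]
        ring
      · intro b _ hb
        simp [Ne.symm hb, Fin.succ_ne_zero]
      · simp
  unfold Wr
  rw [h, Matrix.det_mul, Matrix.det_of_isLowerTriangular]
  · simp
  · intro i j hij
    have h1 : i < j := by simpa using hij
    have h2 : j ≠ 0 := by rintro rfl; exact absurd h1 (Fin.not_lt_zero _)
    simp [h1.ne, h2]

lemma Wr_replace (D : Fin m → Derivation k A A) (y : Fin (m+1) → A) (j0 : Fin (m+1))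
    (b : Fin (m+1) → A) (b' z : A)
    (h : ∀ r, ∑ j, b j * EOp D r (y j) = b' * EOp D r z) :
    b j0 * Wr D y = b' * Wr D (Function.update y j0 z) := by
  unfold Wr
  have h1 := Matrix.det_updateCol_sum (Matrix.of fun r j => EOp D r (y j)) j0 b
  simp only [Matrix.of_apply, smul_eq_mul] at h1
  rw [← h1]
  simp only [h]
  have h2 := Matrix.det_updateCol_smul (Matrix.of fun r j => EOp D r (y j)) j0 b'
    (fun r => EOp D r z)
  have h3 : (b' • fun r => EOp D r z) = fun r => b' * EOp D r z := by
    ext r; simp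
  rw [h3] at h2
  rw [h2]
  congr 2
  ext r j
  by_cases hj : j = j0
  · subst hj; simp
  · simp [hj]

lemma Wr_replace' (D : Fin m → Derivation k A A) (y : Fin (m+1) → A) (j0 k0 : Fin (m+1))
    (hk : y k0 = 1) (hjk : j0 ≠ k0)
    (b : Fin (m+1) → A) (b' z : A)
    (h : ∀ i, ∑ j, b j * D i (y j) = b' * D i z) :
    b j0 * Wr D y = b' * Wr D (Function.update y j0 z) := by
  have key := Wr_replace D y j0
    (Function.update b k0 (b' * z - ∑ j ∈ Finset.univ.erase k0, b j * y j)) b' z ?_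
  · simpa [hjk] using key
  · intro r
    rw [← Finset.add_sum_erase _ _ (Finset.mem_univ k0)]
    have e : ∀ r, ∑ x ∈ Finset.univ.erase k0,
        Function.update b k0 (b' * z - ∑ j ∈ Finset.univ.erase k0, b j * y j) x * EOp D r (y x)
        = ∑ x ∈ Finset.univ.erase k0, b x * EOp D r (y x) := by
      intro r
      apply Finset.sum_congr rfl
      intro x hx
      rw [Function.update_of_ne (Finset.ne_of_mem_erase hx)]
    rw [e]
    refine Fin.cases ?_ (fun i => ?_) r
    · simp [hk]
    · have := h i
      rw [← Finset.add_sum_erase _ _ (Finset.mem_univ k0)] at this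
      simp [hk] at this ⊢
      exact this

lemma Wr_log (D : Fin m → Derivation k A A) (y : Fin (m+1) → A) (T : Finset (Fin (m+1)))
    (h : ∀ j ∈ T, ∀ i, y j ∣ D i (y j)) : ∏ j ∈ T, y j ∣ Wr D y := by
  have h1 : ∀ r j, ∃ c, EOp D r (y j) = (if j ∈ T then y j else 1) * c := by
    intro r j
    by_cases hj : j ∈ T
    · simp only [hj, if_true]
      refine Fin.cases ⟨1, by simp⟩ (fun i => ?_) r
      obtain ⟨c, hc⟩ := h j hj i
      exact ⟨c, by simpa using hc⟩
    · exact ⟨_, by simp [hj]; rfl⟩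
  choose B hB using h1
  have : (Matrix.of fun r j => EOp D r (y j)) =
    Matrix.of fun r j => (if j ∈ T then y j else 1) * (Matrix.of B) r j := by
    ext r j; simp [hB r j]
  unfold Wr
  rw [this, Matrix.det_mul_row]
  refine Dvd.dvd.mul_right ?_ _
  rw [Finset.prod_ite_mem, Finset.univ_inter]

lemma dvd_deriv_of_dvr [IsDomain A] [IsDiscreteValuationRing A] (D : Derivation k A A) {p : A}
    (hp : Irreducible p) (h : p ∣ D p) (y : A) : y ∣ D y := by
  by_cases hy : y = 0
  · simp [hy]
  obtain ⟨n, e, rfl⟩ := IsDiscreteValuationRing.eq_unit_mul_pow_irreducible hy hp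
  rw [Derivation.leibniz, Derivation.leibniz_pow]
  have h1 : p ^ n ∣ n • p ^ (n-1) • D p := by
    rcases n with _ | n
    · simp
    · obtain ⟨c, hc⟩ := h
      refine ⟨((n+1 : ℕ) : A) * c, ?_⟩
      rw [hc]; simp; ring
  obtain ⟨c, hc⟩ := h1
  rw [hc]
  refine ⟨c + ↑e⁻¹ * D e, ?_⟩
  simp only [smul_eq_mul]
  have : (e : A) * (↑e⁻¹ : A) = 1 := by simp
  linear_combination (-(p^n * D (e:A))) * this

lemma Wr_reg [IsDomain A] [IsDiscreteValuationRing A] (D : Fin m → Derivation k A A) {p : A}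
    (hp : Irreducible p) (y : Fin (m+1) → A) (T : Finset (Fin (m+1))) :
    ∏ j ∈ T, y j ∣ p * Wr D y := by
  rcases m with _ | m
  · exact (Wr_log D y T (fun j _ i => i.elim0)).mul_left _
  obtain ⟨i1, hi1⟩ := Finite.exists_min (fun i => IsDiscreteValuationRing.addVal A (D i p))
  have hi2 : ∀ i, ∃ c, D i p = D i1 p * c := fun i =>
    (IsDiscreteValuationRing.addVal_le_iff_dvd).1 (hi1 i)
  choose c hc using hi2
  let D' : Fin (m+1) → Derivation k A A := fun i =>
    if i = i1 then p • D i1 else D i - c i • D i1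
  have hD' : ∀ i, p ∣ D' i p := by
    intro i
    by_cases h : i = i1
    · simp [D', h]
    · simp [D', h, hc i, mul_comm]
  have key := Wr_log D' y T (fun j _ i => dvd_deriv_of_dvr (D' i) hp (hD' i) (y j))
  suffices h : Wr D' y = p * Wr D y by rwa [h] at key
  unfold Wr
  have h1 := Matrix.det_updateRow_smul (Matrix.of fun r j => EOp D r (y j)) i1.succ p
    (fun j => EOp D i1.succ (y j))
  have h2 : (Matrix.of fun r j => EOp D r (y j)).updateRow i1.succ (fun j => EOp D i1.succ (y j))
      = (Matrix.of fun r j => EOp D r (y j)) := by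
    ext r j
    by_cases hr : r = i1.succ
    · subst hr; simp
    · simp [hr]
  rw [h2] at h1
  rw [← h1]

  let D1 : Fin (m+1) → Derivation k A A := fun i => if i = i1 then D i1 else D i - c i • D i1
  have h3 : Matrix.det (Matrix.of fun r j => EOp D1 r (y j)) =
      Matrix.det (Matrix.of fun r j => EOp D r (y j)) := by
    refine Matrix.det_eq_of_forall_row_eq_smul_add_const
      (fun r => Fin.cases 0 (fun i => if i = i1 then 0 else - c i) r) i1.succ (by simp) ?_
    intro r j
    refine Fin.cases (by simp) (fun i => ?_) r
    by_cases hi : i = i1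
    · subst hi; simp [D1]
    · simp [D1, hi]; ring
  have h4 := Matrix.det_updateRow_smul (Matrix.of fun r j => EOp D1 r (y j)) i1.succ p
    (fun j => EOp D1 i1.succ (y j))
  have h5 : (Matrix.of fun r j => EOp D1 r (y j)).updateRow i1.succ (fun j => EOp D1 i1.succ (y j))
      = (Matrix.of fun r j => EOp D1 r (y j)) := by
    ext r j
    by_cases hr : r = i1.succ
    · subst hr; simp
    · simp [hr]
  rw [h5, h3] at h4
  rw [h1, ← h4]
  congr 1
  ext r j
  refine Fin.cases (by simp [(Fin.succ_ne_zero _).symm]) (fun i => ?_) r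
  by_cases hi : i = i1
  · subst hi; simp [D', D1]
  · simp [D', D1, hi]

lemma deriv_aeval {σ : Type*} [Fintype σ] (D : Derivation k A A) (u : σ → A)
    (P : MvPolynomial σ k) :
    D (aeval u P) = ∑ j, aeval u (pderiv j P) * D (u j) := by
  classical
  induction P using MvPolynomial.induction_on with
  | C a => simp
  | add p q hp hq => simp [hp, hq, add_mul, Finset.sum_add_distrib]
  | mul_X p i hp =>
    simp only [map_mul, aeval_X, Derivation.leibniz, smul_eq_mul, hp, pderiv_X, map_add]
    simp only [add_mul, Finset.sum_add_distrib]
    congr 1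
    · rw [Finset.sum_eq_single i]
      · simp
      · intro b _ hb; simp [hb]
      · simp
    · rw [Finset.mul_sum]
      exact Finset.sum_congr rfl (fun j _ => by ring)

end Wronskian

end ConicBundleFormalization

namespace ConicBundleFormalization
open MvPolynomial

section SepRel
variable {κ : Type*} [Field κ] [IsAlgClosed κ] [CharP κ 2]

lemma exists_sqrt_poly {σ : Type*} (R : MvPolynomial σ κ) (h : ∀ j, pderiv j R = 0) :
    ∃ S : MvPolynomial σ κ, S ^ 2 = R := by
  classical
  have hs : ∀ a : κ, ∃ b, b ^ 2 = a := fun a => IsAlgClosed.exists_pow_nat_eq a (by norm_num)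
  choose q hq using hs
  have heven : ∀ e ∈ R.support, ∃ e' : σ →₀ ℕ, e = 2 • e' := by
    intro e he
    have h1 : ∀ j, 2 ∣ e j := by
      intro j
      by_contra hodd
      have hpos : 1 ≤ e j := by
        rcases Nat.eq_zero_or_pos (e j) with h0 | h0
        · rw [h0] at hodd; simp at hodd
        · exact h0
      have h2 := congrArg (coeff (e - Finsupp.single j 1)) (h j)
      rw [coeff_pderiv, coeff_zero] at h2
      have h3 : e - Finsupp.single j 1 + Finsupp.single j 1 = e := by
        apply tsub_add_cancel_of_le
        simpa using hpos
      rw [h3] at h2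
      have h4 : ((((e - Finsupp.single j 1 : σ →₀ ℕ) j) : ℕ) : κ) + 1 = ((e j : ℕ) : κ) := by
        have : (e - Finsupp.single j 1 : σ →₀ ℕ) j = e j - 1 := by simp
        rw [this]
        have : e j = (e j - 1) + 1 := by omega
        conv_rhs => rw [this]
        push_cast; rfl
      rw [h4] at h2
      rcases mul_eq_zero.1 h2 with h5 | h5
      · exact (mem_support_iff.1 he) h5
      · exact hodd ((CharP.cast_eq_zero_iff κ 2 (e j)).1 h5)
    refine ⟨e.mapRange (fun a => a / 2) (by simp), ?_⟩
    ext j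
    obtain ⟨c, hc⟩ := h1 j
    simp [hc]
  choose! hf hhf using heven
  refine ⟨∑ e ∈ R.support, monomial (hf e) (q (coeff e R)), ?_⟩
  have : ExpChar (MvPolynomial σ κ) 2 := by
    have : CharP (MvPolynomial σ κ) 2 := inferInstance
    exact ExpChar.prime Nat.prime_two
  rw [sum_pow_char]
  conv_rhs => rw [R.as_sum]
  apply Finset.sum_congr rfl
  intro e he
  rw [monomial_pow, hq, ← hhf e he]

lemma sep_relation {E σ : Type*} [Field E] [Algebra κ E] (v : σ → E)
    (P : MvPolynomial σ κ) (hP : P ≠ 0) (hv : aeval v P = 0) :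
    ∃ R : MvPolynomial σ κ, aeval v R = 0 ∧ ∃ j, aeval v (pderiv j R) ≠ 0 := by
  classical
  let p : ℕ → Prop := fun d => ∃ R : MvPolynomial σ κ, R ≠ 0 ∧ aeval v R = 0 ∧ R.totalDegree = d
  have hp : ∃ d, p d := ⟨_, P, hP, hv, rfl⟩
  obtain ⟨R, hR0, hRv, hRd⟩ := Nat.find_spec hp
  have hmin : ∀ S : MvPolynomial σ κ, aeval v S = 0 → S.totalDegree < R.totalDegree → S = 0 := by
    intro S hS hlt
    by_contra h0
    exact Nat.find_min hp (hRd ▸ hlt) ⟨S, h0, hS, rfl⟩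
  refine ⟨R, hRv, ?_⟩
  by_contra hcon
  push Not at hcon
  have hdpos : 0 < R.totalDegree := by
    rw [Nat.pos_iff_ne_zero]
    intro h0
    have h1 := totalDegree_eq_zero_iff_eq_C.1 h0
    rw [h1] at hRv
    simp at hRv
    apply hR0
    rw [h1, hRv]; simp
  have hz : ∀ j, pderiv j R = 0 := by
    intro j
    by_contra hne
    apply hne
    apply hmin _ (hcon j)
    rw [totalDegree, Finset.sup_lt_iff (by simpa using hdpos)]
    intro e he
    have h1 := mem_support_iff.1 he
    rw [coeff_pderiv] at h1
    have h2 : e + Finsupp.single j 1 ∈ R.support := by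
      rw [mem_support_iff]; intro h; rw [h] at h1; simp at h1
    have h3 := le_totalDegree h2
    have h4 : ((e + Finsupp.single j 1).sum fun _ n => n) = (e.sum fun _ n => n) + 1 := by
      rw [Finsupp.sum_add_index'] <;> simp
    omega
  obtain ⟨S, hS⟩ := exists_sqrt_poly R hz
  have hS0 : S ≠ 0 := by rintro rfl; apply hR0; rw [← hS]; simp
  apply hS0
  apply hmin
  · have : (aeval v S) ^ 2 = 0 := by rw [← map_pow, hS, hRv]
    exact pow_eq_zero_iff (by norm_num) |>.1 this
  · rw [← hS, pow_two, totalDegree_mul_of_isDomain hS0 hS0]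
    rw [← hS, pow_two, totalDegree_mul_of_isDomain hS0 hS0] at hdpos
    omega
end SepRel

section Local
variable {κ : Type*} [Field κ] [IsAlgClosed κ] [CharP κ 2]
variable {A : Type*} [CommRing A] [IsDomain A] [IsDiscreteValuationRing A] [Algebra κ A] {m : ℕ}

noncomputable def FF (κ : Type*) [CommRing κ] (m N : ℕ) : MvPolynomial (Fin (m+1)) κ :=
  (∏ i, X i) * X 0 ^ N

def SelCond (P Q : MvPolynomial (Fin (m+1)) κ) : Prop :=
  ∀ (k : Fin (m+1)) (J : Finset (Fin (m+1))), k ∉ J → J.Nonempty →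
    ∃ j1 j2, j1 ≠ k ∧ j2 ≠ k ∧ (J.card = 1 → j1 ∉ J ∧ j2 ∉ J) ∧
    ∃ p : Fin (m+1) → κ, p k = 1 ∧ (∀ j ∈ J, p j = 0) ∧
      eval p (pderiv j1 P * pderiv j2 Q + pderiv j2 P * pderiv j1 Q) ≠ 0

lemma FF_pderiv_mem (I : Ideal A) (u : Fin (m+1) → A) (N : ℕ) (j j' : Fin (m+1)) (h : j' ≠ j)
    (hj : u j' ∈ I) : aeval u (pderiv j (FF κ m N)) ∈ I := by
  classical
  have : FF κ m N = X j' * ((∏ i ∈ Finset.univ.erase j', X i) * X 0 ^ N) := by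
    unfold FF
    rw [← Finset.mul_prod_erase _ _ (Finset.mem_univ j'), mul_assoc]
  rw [this, Derivation.leibniz, pderiv_X_of_ne h]
  simp only [smul_eq_mul, mul_zero, add_zero, map_mul, aeval_X]
  exact I.mul_mem_right _ hj

lemma local_core (D : Fin m → Derivation κ A A) {π : A} (hπ : Irreducible π)
    (P Q : MvPolynomial (Fin (m+1)) κ) (N : ℕ) (hsel : SelCond P Q)
    (u : Fin (m+1) → A) (x s : A) (k : Fin (m+1)) (hk : u k = 1)
    (heq : x ^ 2 + aeval u P + aeval u (FF κ m N) * s + aeval u Q * s ^ 2 = 0) :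
    (∏ j, u j ∣ Wr D u) ∧
    ((∀ i, π ∣ D i π) → ¬ IsUnit (∏ j, u j) → π * ∏ j, u j ∣ Wr D u) := by
  classical
  have : CharP A 2 := charP_of_injective_algebraMap (algebraMap κ A).injective 2
  have h2 : (2 : A) = 0 := by exact_mod_cast CharP.cast_eq_zero A 2
  have hmem : ∀ a : A, ¬ IsUnit a ↔ π ∣ a := by
    intro a
    rw [← Ideal.mem_span_singleton, ← hπ.maximalIdeal_eq, IsLocalRing.mem_maximalIdeal,
      mem_nonunits_iff]
  let J : Finset (Fin (m+1)) := Finset.univ.filter (fun j => ¬ IsUnit (u j))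
  have hJ : ∀ j, j ∈ J ↔ ¬ IsUnit (u j) := by intro j; simp [J]
  by_cases hJe : J = ∅
  · have hu : IsUnit (∏ j, u j) := by
      rw [IsUnit.prod_univ_iff]
      intro j
      by_contra h
      have := (hJ j).2 h
      rw [hJe] at this; simp at this
    exact ⟨hu.dvd, fun _ h => absurd hu h⟩
  have hJne : J.Nonempty := Finset.nonempty_iff_ne_empty.2 hJe
  have hkJ : k ∉ J := by rw [hJ, hk]; simp
  obtain ⟨j1, j2, hj1k, hj2k, hcard, p, hpk, hpJ, hp⟩ := hsel k J hkJ hJne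

  have hprod : Associated (∏ j ∈ J, u j) (∏ j, u j) := by
    rw [← Finset.prod_mul_prod_compl J u]
    have hu : IsUnit (∏ j ∈ Jᶜ, u j) := by
      rw [IsUnit.prod_iff]
      intro j hj
      rw [Finset.mem_compl, hJ, not_not] at hj
      exact hj
    exact (associated_mul_unit_left _ _ hu).symm
  let G : Fin (m+1) → A := fun j =>
    aeval u (pderiv j P) + aeval u (pderiv j (FF κ m N)) * s + aeval u (pderiv j Q) * s ^ 2
  have hG : ∀ i, ∑ j, G j * D i (u j) = (- aeval u (FF κ m N)) * D i s := by
    intro i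
    have h := congrArg (D i) heq
    simp only [map_add, Derivation.leibniz, Derivation.leibniz_pow, smul_eq_mul, map_zero,
      deriv_aeval (D i) u] at h
    have e1 : ∑ j, G j * D i (u j) = ∑ j, aeval u (pderiv j P) * D i (u j)
        + s * ∑ j, aeval u (pderiv j (FF κ m N)) * D i (u j)
        + s ^ 2 * ∑ j, aeval u (pderiv j Q) * D i (u j) := by
      rw [Finset.mul_sum, Finset.mul_sum, ← Finset.sum_add_distrib, ← Finset.sum_add_distrib]
      apply Finset.sum_congr rfl
      intro j _
      simp only [G]; ring
    rw [e1]
    simp only [nsmul_eq_mul] at h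
    push_cast at h
    linear_combination h - (x * D i x + aeval u Q * (s * D i s)) * h2
  have hFdvd : ∏ j, u j ∣ aeval u (FF κ m N) := by
    unfold FF
    simp only [map_mul, map_prod, aeval_X]
    exact Dvd.intro _ rfl
  have caseA : ∀ j0, j0 ≠ k → (J.card = 1 → j0 ∉ J) → IsUnit (G j0) →
      (∏ j, u j ∣ Wr D u) ∧ ((∀ i, π ∣ D i π) → ¬ IsUnit (∏ j, u j) → π * ∏ j, u j ∣ Wr D u) := by
    intro j0 hj0 hc hu
    have hW := Wr_replace' D u j0 k hk hj0 G _ s hG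
    refine ⟨?_, fun hD _ => ?_⟩
    · rw [← hu.dvd_mul_left, hW]
      exact Dvd.dvd.mul_right ((dvd_neg).2 hFdvd) _
    · rw [← hu.dvd_mul_left, hW, mul_comm π]
      have hj : ∃ j ∈ J, j ≠ j0 := by
        by_contra hcon
        push Not at hcon
        have : J ⊆ {j0} := fun j hj => by simpa using hcon j hj
        rcases Finset.subset_singleton_iff.1 this with h | h
        · exact hJe h
        · exact hc (by rw [h]; simp) (by rw [h]; simp)
      obtain ⟨j, hjJ, hjne⟩ := hj
      refine mul_dvd_mul ((dvd_neg).2 hFdvd) ?_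
      have := Wr_log D (Function.update u j0 s) {j}
        (fun j _ i => dvd_deriv_of_dvr (D i) hπ (hD i) _)
      rw [Finset.prod_singleton, Function.update_of_ne hjne] at this
      exact ((hmem _).1 ((hJ j).1 hjJ)).trans this
  by_cases hu1 : IsUnit (G j1)
  · exact caseA j1 hj1k (fun h => (hcard h).1) hu1
  by_cases hu2 : IsUnit (G j2)
  · exact caseA j2 hj2k (fun h => (hcard h).2) hu2

  let E := IsLocalRing.ResidueField A
  let r : A →ₐ[κ] E := Algebra.ofId A E |>.restrictScalars κ
  have hr : ∀ a, r a = 0 ↔ ¬ IsUnit a := by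
    intro a
    exact IsLocalRing.residue_eq_zero_iff a |>.trans (by simp)
  have hf : ∀ j0, (J.card = 1 → j0 ∉ J) → r (aeval u (pderiv j0 (FF κ m N))) = 0 := by
    intro j0 hc
    have hj : ∃ j ∈ J, j ≠ j0 := by
      by_contra hcon
      push Not at hcon
      have : J ⊆ {j0} := fun j hj => by simpa using hcon j hj
      rcases Finset.subset_singleton_iff.1 this with h | h
      · exact hJe h
      · exact hc (by rw [h]; simp) (by rw [h]; simp)
    obtain ⟨j, hjJ, hjne⟩ := hj
    have := FF_pderiv_mem (κ := κ) (IsLocalRing.maximalIdeal A) u N j0 j hjne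
      ((IsLocalRing.mem_maximalIdeal _).2 ((hJ j).1 hjJ))
    rw [hr]
    exact (IsLocalRing.mem_maximalIdeal _).1 this
  let ι' := {j : Fin (m+1) // j ∉ J ∧ j ≠ k}
  let sub : Fin (m+1) → MvPolynomial ι' κ := fun j =>
    if h : j ∉ J ∧ j ≠ k then X ⟨j, h⟩ else if j = k then 1 else 0
  let v : ι' → E := fun j => r (u j)
  let Rel := pderiv j1 P * pderiv j2 Q + pderiv j2 P * pderiv j1 Q
  have hru : ∀ (T : MvPolynomial (Fin (m+1)) κ), aeval v (aeval sub T) = r (aeval u T) := by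
    intro T
    have h1 : ((aeval v).comp (aeval sub) : MvPolynomial (Fin (m+1)) κ →ₐ[κ] E)
      = r.comp (aeval u) := by
      apply MvPolynomial.algHom_ext
      intro j
      simp only [AlgHom.comp_apply, aeval_X, sub]
      by_cases h : j ∉ J ∧ j ≠ k
      · simp [h, v]
      · rw [dif_neg h]
        by_cases hjk : j = k
        · simp [hjk, hk]
        · rw [if_neg hjk, map_zero]
          symm
          rw [hr, ← hJ]
          by_contra h'
          exact h ⟨h', hjk⟩
    exact DFunLike.congr_fun h1 T
  have hRel0 : aeval sub Rel ≠ 0 := by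
    intro h0
    apply hp
    have h1 : ((eval (fun j : ι' => p j)).comp (aeval sub : MvPolynomial (Fin (m+1)) κ →ₐ[κ] _).toRingHom
      : MvPolynomial (Fin (m+1)) κ →+* κ) = eval p := by
      apply MvPolynomial.ringHom_ext
      · intro c; simp
      · intro j
        simp only [RingHom.comp_apply, AlgHom.toRingHom_eq_coe, RingHom.coe_coe, aeval_X, eval_X, sub]
        by_cases h : j ∉ J ∧ j ≠ k
        · simp [h]
        · rw [dif_neg h]
          by_cases hjk : j = k
          · simp [hjk, hpk]
          · rw [if_neg hjk, map_zero]
            symm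
            apply hpJ
            by_contra h'
            exact h ⟨h', hjk⟩
    have h2 := DFunLike.congr_fun h1 Rel
    rw [← h2]
    simp only [RingHom.comp_apply, AlgHom.toRingHom_eq_coe, RingHom.coe_coe]
    rw [h0, map_zero]
  have hRelv : aeval v (aeval sub Rel) = 0 := by
    rw [hru]
    have g1 : r (G j1) = 0 := (hr _).2 hu1
    have g2 : r (G j2) = 0 := (hr _).2 hu2
    simp only [G, map_add, map_mul, hf j1 (fun h => (hcard h).1), hf j2 (fun h => (hcard h).2)]
      at g1 g2
    have h2' : (2 : E) = 0 := by rw [← map_ofNat r 2, h2, map_zero]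
    simp only [Rel, map_add, map_mul]
    linear_combination r (aeval u (pderiv j2 Q)) * g1 + r (aeval u (pderiv j1 Q)) * g2
      - r (aeval u (pderiv j2 Q)) * r (aeval u (pderiv j1 Q)) * r (s ^ 2) * h2'
  obtain ⟨R, hRv, j0, hj0⟩ := sep_relation v (aeval sub Rel) hRel0 hRelv
  let u' : ι' → A := fun j => u j
  have hru' : ∀ T : MvPolynomial ι' κ, aeval v T = r (aeval u' T) := by
    intro T
    rw [← AlgHom.comp_apply]
    congr 1
    apply MvPolynomial.algHom_ext
    intro j; simp [v, u']
  let z := aeval u' R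
  have hz : π ∣ z := by
    rw [← hmem, ← hr, ← hru', hRv]
  let b : Fin (m+1) → A := fun j => if h : j ∉ J ∧ j ≠ k then aeval u' (pderiv ⟨j, h⟩ R) else 0
  have hb : ∀ i, ∑ j, b j * D i (u j) = 1 * D i z := by
    intro i
    rw [one_mul, deriv_aeval (D i) u' R]
    rw [← Finset.sum_subtype (Finset.univ.filter (fun j => j ∉ J ∧ j ≠ k)) (by simp)
      (fun j => b j * D i (u j)) |>.symm.symm.trans (Finset.sum_congr rfl ?_)]
    · rw [Finset.sum_filter]
      apply Finset.sum_congr rfl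
      intro j _
      by_cases h : j ∉ J ∧ j ≠ k
      · rw [if_pos h]
      · rw [if_neg h]; simp only [b]; rw [dif_neg h, zero_mul]
    · intro j _
      simp only [b, u']
      rw [dif_pos j.2]
  have hbu : IsUnit (b j0) := by
    simp only [b]
    rw [dif_pos j0.2]
    by_contra h
    rw [← hr, ← hru'] at h
    exact hj0 h
  have hW := Wr_replace' D u j0 k hk j0.2.2 b 1 z hb
  rw [one_mul] at hW
  have hT : ∏ j ∈ insert (j0 : Fin (m+1)) J, Function.update u (j0 : Fin (m+1)) z j
      = z * ∏ j ∈ J, u j := by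
    rw [Finset.prod_insert j0.2.1, Function.update_self]
    congr 1
    apply Finset.prod_congr rfl
    intro j hj
    rw [Function.update_of_ne]
    rintro rfl
    exact j0.2.1 hj
  refine ⟨?_, fun hD _ => ?_⟩
  · rw [← hprod.dvd_iff_dvd_left, ← hbu.dvd_mul_left, hW]
    have h1 := Wr_reg D hπ (Function.update u (j0 : Fin (m+1)) z) (insert (j0 : Fin (m+1)) J)
    rw [hT] at h1
    exact (mul_dvd_mul_iff_left hπ.ne_zero).1 ((mul_dvd_mul_right hz _).trans h1)
  · rw [← (hprod.mul_left π).dvd_iff_dvd_left, ← hbu.dvd_mul_left, hW]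
    have h1 := Wr_log D (Function.update u (j0 : Fin (m+1)) z) (insert (j0 : Fin (m+1)) J)
      (fun j _ i => dvd_deriv_of_dvr (D i) hπ (hD i) _)
    rw [hT] at h1
    exact (mul_dvd_mul_right hz _).trans h1
end Local
end ConicBundleFormalization

set_option linter.unusedSimpArgs false
namespace ConicBundleFormalization
open MvPolynomial

section Sel

noncomputable def QQ (κ : Type*) [CommRing κ] (m a t : ℕ) : MvPolynomial (Fin (m+1)) κ :=
  ∑ i, X i ^ (2*a+1) * X (i + t • (1 : Fin (m+1)))

lemma nsmul_one_val (m a : ℕ) : ((a • (1 : Fin (m+1)) : Fin (m+1)) : ℕ) = a % (m+1) := by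
  induction a with
  | zero => simp
  | succ a ih =>
    rw [succ_nsmul, Fin.val_add, ih]
    rcases m with _ | m
    · simp [Nat.mod_one]
    · simp

lemma shift_inj {m : ℕ} (hm : 6 ≤ m) (k : Fin (m+1)) {a b : ℕ} (ha : a ≤ 6) (hb : b ≤ 6)
    (h : k + a • (1 : Fin (m+1)) = k + b • 1) : a = b := by
  have h1 := add_left_cancel h
  have h2 := congrArg Fin.val h1
  rw [nsmul_one_val, nsmul_one_val, Nat.mod_eq_of_lt (by omega), Nat.mod_eq_of_lt (by omega)] at h2
  exact h2

variable {κ : Type*} [Field κ] [IsAlgClosed κ] [CharP κ 2] {m : ℕ}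

lemma pderiv_QQ (a t : ℕ) (j : Fin (m+1)) :
    pderiv j (QQ κ m a t) = X j ^ (2*a) * X (j + t • 1) + X (j - t • 1) ^ (2*a+1) := by
  classical
  unfold QQ
  have h2 : (2 : MvPolynomial (Fin (m+1)) κ) = 0 := by
    exact_mod_cast CharP.cast_eq_zero (MvPolynomial (Fin (m+1)) κ) 2
  rw [map_sum]
  simp only [Derivation.leibniz, Derivation.leibniz_pow, smul_eq_mul, nsmul_eq_mul]
  rw [Finset.sum_add_distrib, add_comm (Finset.sum _ _)]
  congr 1
  · rw [Finset.sum_eq_single j]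
    · rw [pderiv_X_self]
      push_cast
      have e : 2 * a + 1 - 1 = 2 * a := by omega
      try rw [e]
      linear_combination (a * X (j + t • 1) * X j ^ (2*a)) * h2
    · intro b _ hb
      rw [pderiv_X_of_ne hb]; simp
    · simp
  · rw [Finset.sum_eq_single (j - t • 1)]
    · rw [sub_add_cancel, pderiv_X_self, mul_one]
    · intro b _ hb
      rw [pderiv_X_of_ne, mul_zero]
      intro h
      apply hb
      rw [← h]; simp
    · simp

lemma SelCond.symm {P Q : MvPolynomial (Fin (m+1)) κ} (h : SelCond P Q) : SelCond Q P := by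
  intro k J hk hJ
  obtain ⟨j1, j2, h1, h2, h3, p, h4, h5, h6⟩ := h k J hk hJ
  refine ⟨j1, j2, h1, h2, h3, p, h4, h5, ?_⟩
  rw [mul_comm (pderiv j1 Q), mul_comm (pderiv j2 Q), add_comm (_ * _)]
  exact h6

lemma selCond_QQ (hm : 6 ≤ m) (a1 a2 : ℕ) : SelCond (QQ κ m a1 1) (QQ κ m a2 2) := by
  classical
  intro k J hk hJ
  set c : ℕ → Fin (m+1) := fun a => k + a • 1 with hc
  have hc0 : k = c 0 := by simp [hc]
  have cadd : ∀ a t, c a + t • 1 = c (a + t) := by intro a t; simp only [hc]; rw [add_nsmul]; abel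
  have csub : ∀ a t, c (a + t) - t • 1 = c a := by intro a t; rw [← cadd]; simp
  have cne : ∀ a b, a ≤ 6 → b ≤ 6 → a ≠ b → c a ≠ c b := fun a b ha hb hab h =>
    hab (shift_inj hm k ha hb h)
  have key : ∀ (l : ℕ) (p : Fin (m+1) → κ), eval p (pderiv (c (l+1)) (QQ κ m a1 1) * pderiv (c (l+2)) (QQ κ m a2 2) +
      pderiv (c (l+2)) (QQ κ m a1 1) * pderiv (c (l+1)) (QQ κ m a2 2)) =
      (p (c (l+1)) ^ (2*a1) * p (c (l+2)) + p (c l) ^ (2*a1+1)) *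
      (p (c (l+2)) ^ (2*a2) * p (c (l+4)) + p (c l) ^ (2*a2+1)) +
      (p (c (l+2)) ^ (2*a1) * p (c (l+3)) + p (c (l+1)) ^ (2*a1+1)) *
      (p (c (l+1)) ^ (2*a2) * p (c (l+3)) + p (c (l+1) - 2 • 1) ^ (2*a2+1)) := by
    intro l p
    simp only [pderiv_QQ, map_add, map_mul, map_pow, eval_X, cadd]
    rw [csub l 1, csub l 2, csub (l+1) 1]
  by_cases hcase : J.card = 1 ∧ (c 1 ∈ J ∨ c 2 ∈ J)
  · obtain ⟨hcard, hmem⟩ := hcase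
    obtain ⟨js, rfl⟩ := Finset.card_eq_one.1 hcard
    have hjs : js = c 1 ∨ js = c 2 := by
      rcases hmem with h | h
      · left; exact (Finset.mem_singleton.1 h).symm
      · right; exact (Finset.mem_singleton.1 h).symm
    obtain ⟨z, hz⟩ := Infinite.exists_notMem_finset ({0, 1} : Finset κ)
    simp only [Finset.mem_insert, Finset.mem_singleton, not_or] at hz
    let p : Fin (m+1) → κ := fun j => if j = c 0 then 1 else if j = c 3 then z else 0
    have hp : ∀ a, a ≤ 6 → a ≠ 0 → a ≠ 3 → p (c a) = 0 := by
      intro a ha h0 h3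
      simp only [p]
      rw [if_neg (cne a 0 ha (by norm_num) h0), if_neg (cne a 3 ha (by norm_num) h3)]
    have hp3 : p (c 3) = z := by
      simp only [p]
      rw [if_neg (cne 3 0 (by norm_num) (by norm_num) (by norm_num))]; simp
    refine ⟨c 4, c 5, ?_, ?_, ?_, p, ?_, ?_, ?_⟩
    · rw [hc0]; exact cne _ _ (by norm_num) (by norm_num) (by norm_num)
    · rw [hc0]; exact cne _ _ (by norm_num) (by norm_num) (by norm_num)
    · intro _
      simp only [Finset.mem_singleton]
      rcases hjs with rfl | rfl
      · exact ⟨cne _ _ (by norm_num) (by norm_num) (by norm_num),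
          cne _ _ (by norm_num) (by norm_num) (by norm_num)⟩
      · exact ⟨cne _ _ (by norm_num) (by norm_num) (by norm_num),
          cne _ _ (by norm_num) (by norm_num) (by norm_num)⟩
    · simp only [p]; rw [if_pos hc0]
    · intro j hj
      rw [Finset.mem_singleton] at hj
      subst hj
      rcases hjs with rfl | rfl
      · exact hp 1 (by norm_num) (by norm_num) (by norm_num)
      · exact hp 2 (by norm_num) (by norm_num) (by norm_num)
    · have := key 3 p
      simp only [Nat.reduceAdd, zero_add] at this
      rw [this, hp3, hp 4 (by norm_num) (by norm_num) (by norm_num),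
        hp 5 (by norm_num) (by norm_num) (by norm_num),
        hp 6 (by norm_num) (by norm_num) (by norm_num)]
      have h7 : p (c 7) = 0 ∨ p (c 7) = 1 := by
        by_cases h : c 7 = c 0
        · right; simp only [p]; rw [if_pos h]
        · left; simp only [p]; rw [if_neg h, if_neg]
          intro h'
          have : c 4 = c 0 := by
            have e1 : c 4 + 3 • 1 = c 0 + 3 • 1 := by rw [cadd, cadd]; exact h'
            exact add_right_cancel e1
          exact cne 4 0 (by norm_num) (by norm_num) (by norm_num) this
      simp only [mul_zero, zero_add, ne_eq, Nat.succ_ne_zero, not_false_eq_true, zero_pow, zero_mul,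
        add_zero]
      refine mul_ne_zero (pow_ne_zero _ hz.1) ?_
      rcases Nat.eq_zero_or_pos a2 with h0 | h0
      · subst h0
        rcases h7 with h | h
        · rw [h]; simpa using hz.1
        · rw [h]; simp
          intro h'
          apply hz.2
          have h2 : (2 : κ) = 0 := by exact_mod_cast CharP.cast_eq_zero κ 2
          linear_combination h' - h2
      · rw [zero_pow (by omega), zero_mul, zero_add]
        exact pow_ne_zero _ hz.1
  · let p : Fin (m+1) → κ := fun j => if j = c 0 then 1 else 0
    have hp : ∀ a, a ≤ 6 → a ≠ 0 → p (c a) = 0 := by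
      intro a ha h0
      simp only [p]
      rw [if_neg (cne a 0 ha (by norm_num) h0)]
    have hp0 : p (c 0) = 1 := by simp [p]
    refine ⟨c 1, c 2, ?_, ?_, ?_, p, ?_, ?_, ?_⟩
    · rw [hc0]; exact cne _ _ (by norm_num) (by norm_num) (by norm_num)
    · rw [hc0]; exact cne _ _ (by norm_num) (by norm_num) (by norm_num)
    · intro h
      by_contra h'
      exact hcase ⟨h, by tauto⟩
    · simp only [p]; rw [if_pos hc0]
    · intro j hj
      simp only [p]
      rw [if_neg]
      rintro rfl
      rw [← hc0] at hj
      exact hk hj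
    · have := key 0 p
      simp only [Nat.reduceAdd, zero_add] at this
      rw [this, hp0, hp 1 (by norm_num) (by norm_num), hp 2 (by norm_num) (by norm_num),
        hp 3 (by norm_num) (by norm_num), hp 4 (by norm_num) (by norm_num)]
      simp
end Sel
end ConicBundleFormalization

namespace ConicBundleFormalization
open MvPolynomial

section G0
variable {κ : Type*} [CommRing κ] {B : Type*} [CommRing B] [Algebra κ B] {m : ℕ}

noncomputable def G0 (κ : Type*) [CommRing κ] {B : Type*} [CommRing B] [Algebra κ B] {m : ℕ}
    (a1 a2 N : ℕ) (u : Fin (m+1) → B) (x0 x1 x2 : B) : B :=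
  x0 ^ 2 + aeval u (QQ κ m a1 1) * x1 ^ 2 + aeval u (FF κ m N) * x1 * x2
    + aeval u (QQ κ m a2 2) * x2 ^ 2

lemma aeval_QQ_smul (a t : ℕ) (c : B) (u : Fin (m+1) → B) :
    aeval (fun j => c * u j) (QQ κ m a t) = c ^ (2*a+2) * aeval u (QQ κ m a t) := by
  unfold QQ
  simp only [map_sum, map_mul, map_pow, aeval_X]
  rw [Finset.mul_sum]
  apply Finset.sum_congr rfl
  intro i _
  ring

lemma aeval_FF_smul (N : ℕ) (c : B) (u : Fin (m+1) → B) :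
    aeval (fun j => c * u j) (FF κ m N) = c ^ (m+1+N) * aeval u (FF κ m N) := by
  unfold FF
  simp only [map_mul, map_pow, map_prod, aeval_X, Finset.prod_mul_distrib]
  simp
  ring

lemma G0_smul_u {a1 a2 N : ℕ} (hN : m + 1 + N = a1 + a2 + 2) (c : B) (u : Fin (m+1) → B)
    (x0 x1 x2 : B) :
    G0 κ a1 a2 N (fun j => c * u j) x0 x1 x2
      = G0 κ a1 a2 N u x0 (c ^ (a1+1) * x1) (c ^ (a2+1) * x2) := by
  unfold G0
  rw [aeval_QQ_smul, aeval_QQ_smul, aeval_FF_smul, hN]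
  ring

lemma G0_smul_x {a1 a2 N : ℕ} (c : B) (u : Fin (m+1) → B) (x0 x1 x2 : B) :
    G0 κ a1 a2 N u (c * x0) (c * x1) (c * x2) = c ^ 2 * G0 κ a1 a2 N u x0 x1 x2 := by
  unfold G0; ring

lemma G0_map {a1 a2 N : ℕ} {B' : Type*} [CommRing B'] [Algebra κ B'] (φ : B →ₐ[κ] B')
    (u : Fin (m+1) → B) (x0 x1 x2 : B) :
    φ (G0 κ a1 a2 N u x0 x1 x2) = G0 κ a1 a2 N (fun j => φ (u j)) (φ x0) (φ x1) (φ x2) := by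
  unfold G0
  simp only [map_add, map_mul, map_pow]
  have : ∀ P : MvPolynomial (Fin (m+1)) κ, φ (aeval u P) = aeval (fun j => φ (u j)) P := by
    intro P
    rw [← AlgHom.comp_apply, comp_aeval]
  simp only [this]

end G0

section Local2
variable {κ : Type*} [Field κ] [IsAlgClosed κ] [CharP κ 2]
variable {A : Type*} [CommRing A] [IsDomain A] [IsDiscreteValuationRing A] [Algebra κ A] {m : ℕ}

lemma local_lemma (hm : 6 ≤ m) (D : Fin m → Derivation κ A A) {π : A} (hπ : Irreducible π)
    {a1 a2 N : ℕ} (hN : m + 1 + N = a1 + a2 + 2)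
    (u : Fin (m+1) → A) (hu : ∏ j, u j ≠ 0) (x0 x1 x2 : A) (hx : x1 ≠ 0 ∨ x2 ≠ 0)
    (heq : G0 κ a1 a2 N u x0 x1 x2 = 0) :
    (∏ j, u j ∣ Wr D u) ∧
    ((∀ i, π ∣ D i π) → (∃ j, IsUnit (u j)) → ¬ IsUnit (∏ j, u j) → π * ∏ j, u j ∣ Wr D u) := by
  obtain ⟨k, hk⟩ := Finite.exists_min (fun j => IsDiscreteValuationRing.addVal A (u j))
  have hk2 : ∀ j, ∃ c, u j = u k * c := fun j =>
    (IsDiscreteValuationRing.addVal_le_iff_dvd).1 (hk j)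
  choose v hv using hk2
  have huk : u k ≠ 0 := fun h => hu (Finset.prod_eq_zero (Finset.mem_univ k) h)
  have hvk : v k = 1 := by
    have := hv k
    exact (mul_left_cancel₀ huk (by rw [mul_one]; exact this)).symm
  have hu' : u = fun j => u k * v j := funext hv
  have heq2 : G0 κ a1 a2 N v x0 (u k ^ (a1+1) * x1) (u k ^ (a2+1) * x2) = 0 := by
    rw [← G0_smul_u hN, ← hu']; exact heq
  generalize hy1 : u k ^ (a1+1) * x1 = y1 at heq2
  generalize hy2 : u k ^ (a2+1) * x2 = y2 at heq2
  have hy : y1 ≠ 0 ∨ y2 ≠ 0 := by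
    rcases hx with h | h
    · left; rw [← hy1]; exact mul_ne_zero (pow_ne_zero _ huk) h
    · right; rw [← hy2]; exact mul_ne_zero (pow_ne_zero _ huk) h
  have hW : Wr D u = u k ^ (m+1) * Wr D v := by
    conv_lhs => rw [hu']
    rw [Wr_smul]
  have hP : ∏ j, u j = u k ^ (m+1) * ∏ j, v j := by
    conv_lhs => rw [Finset.prod_congr rfl (fun j _ => hv j)]
    rw [Finset.prod_mul_distrib]; simp
  have core : (∏ j, v j ∣ Wr D v) ∧
      ((∀ i, π ∣ D i π) → ¬ IsUnit (∏ j, v j) → π * ∏ j, v j ∣ Wr D v) := by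
    unfold G0 at heq2
    rcases ValuationRing.dvd_total y1 y2 with h | h
    · obtain ⟨s, hs⟩ := h
      have h1 : y1 ≠ 0 := by
        rintro rfl
        rw [zero_mul] at hs
        simp [hs] at hy
      have h2 : y1 ^ 2 ∣ x0 ^ 2 := by
        refine ⟨- (aeval v (QQ κ m a1 1) + aeval v (FF κ m N) * s + aeval v (QQ κ m a2 2) * s ^ 2), ?_⟩
        rw [hs] at heq2
        linear_combination heq2
      obtain ⟨x, hx⟩ := (IsIntegrallyClosed.pow_dvd_pow_iff two_ne_zero).1 h2
      refine local_core D hπ _ _ N (selCond_QQ hm a1 a2) v x s k hvk ?_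
      apply mul_left_cancel₀ (pow_ne_zero 2 h1)
      rw [mul_zero, ← heq2, hs, hx]
      ring
    · obtain ⟨s, hs⟩ := h
      have h1 : y2 ≠ 0 := by
        rintro rfl
        rw [zero_mul] at hs
        simp [hs] at hy
      have h2 : y2 ^ 2 ∣ x0 ^ 2 := by
        refine ⟨- (aeval v (QQ κ m a2 2) + aeval v (FF κ m N) * s + aeval v (QQ κ m a1 1) * s ^ 2), ?_⟩
        rw [hs] at heq2
        linear_combination heq2
      obtain ⟨x, hx⟩ := (IsIntegrallyClosed.pow_dvd_pow_iff two_ne_zero).1 h2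
      refine local_core D hπ _ _ N (selCond_QQ hm a1 a2).symm v x s k hvk ?_
      apply mul_left_cancel₀ (pow_ne_zero 2 h1)
      rw [mul_zero, ← heq2, hs, hx]
      ring
  refine ⟨?_, fun hD hj hn => ?_⟩
  · rw [hW, hP]; exact mul_dvd_mul_left _ core.1
  · obtain ⟨j, hj⟩ := hj
    have huk' : IsUnit (u k) := by
      rw [hv j] at hj
      exact isUnit_of_mul_isUnit_left hj
    rw [hP] at hn
    have hn' : ¬ IsUnit (∏ j, v j) := fun h => hn ((huk'.pow _).mul h)
    rw [hW, hP, mul_left_comm]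
    exact mul_dvd_mul_left _ (core.2 hD hn')
end Local2
end ConicBundleFormalization

namespace ConicBundleFormalization

section LocDer
variable {κ R S : Type*} [CommRing κ] [CommRing R] [CommRing S] [Algebra κ R] [Algebra R S]
  [Algebra κ S] [IsScalarTower κ R S]

lemma exists_locDer (M : Submonoid R) [IsLocalization M S] (D : Derivation κ R R) :
    ∃ D' : Derivation κ S S, ∀ r, D' (algebraMap R S r) = algebraMap R S (D r) := by
  let f : R →+* TrivSqZeroExt S S :=
    { toFun := fun r => ((algebraMap R S r, algebraMap R S (D r)) : S × S)
      map_one' := TrivSqZeroExt.ext (map_one (algebraMap R S)) (by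
        show algebraMap R S (D 1) = 0
        rw [Derivation.map_one_eq_zero, map_zero])
      map_zero' := TrivSqZeroExt.ext (map_zero (algebraMap R S)) (by
        show algebraMap R S (D 0) = 0
        rw [map_zero, map_zero])
      map_add' := fun a b => TrivSqZeroExt.ext (map_add (algebraMap R S) a b) (by
        show algebraMap R S (D (a + b)) = algebraMap R S (D a) + algebraMap R S (D b)
        rw [map_add, map_add])
      map_mul' := fun a b => TrivSqZeroExt.ext (map_mul (algebraMap R S) a b) (by
        show algebraMap R S (D (a * b)) = algebraMap R S a * algebraMap R S (D b)
          + algebraMap R S (D a) * algebraMap R S b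
        rw [Derivation.leibniz, map_add, smul_eq_mul, smul_eq_mul, map_mul, map_mul]
        ring) }
  have hf1 : ∀ r, (f r).fst = algebraMap R S r := fun r => rfl
  have hf2 : ∀ r, (f r).snd = algebraMap R S (D r) := fun r => rfl
  have hu : ∀ y : M, IsUnit (f y) := by
    intro y
    rw [TrivSqZeroExt.isUnit_iff_isUnit_fst, hf1]
    exact IsLocalization.map_units S y
  let g : S →+* TrivSqZeroExt S S := IsLocalization.lift hu
  have hg : ∀ r, g (algebraMap R S r) = f r := fun r => IsLocalization.lift_eq hu r
  have hfst : ∀ s, (g s).fst = s := by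
    intro s
    have : (TrivSqZeroExt.fstHom S S S).toRingHom.comp g = RingHom.id S := by
      apply IsLocalization.ringHom_ext M
      ext r
      simp [hg, hf1]
    exact DFunLike.congr_fun this s
  let l : S →ₗ[κ] S :=
    { toFun := fun s => (g s).snd
      map_add' := by intro a b; simp
      map_smul' := by
        intro c s
        rw [Algebra.smul_def, map_mul, TrivSqZeroExt.snd_mul, hfst, hfst,
          IsScalarTower.algebraMap_apply κ R S, hg, hf2]
        simp [Algebra.smul_def]
        rw [IsScalarTower.algebraMap_apply κ R S] }
  refine ⟨Derivation.mk' l ?_, ?_⟩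
  · intro a b
    simp only [l, LinearMap.coe_mk, AddHom.coe_mk, map_mul, TrivSqZeroExt.snd_mul, hfst]
    simp [mul_comm]
  · intro r
    simp [l, hg, hf2]
end LocDer

section PolyDer
open Polynomial
variable {κ L : Type*} [CommRing κ] [CommRing L] [Algebra κ L]

noncomputable def polyDer (D : Derivation κ L L) : Derivation κ L[X] L[X] :=
  (PolynomialModule.equivPolynomialSelf (R := L)).toLinearMap.compDer D.mapCoeffs

lemma coeff_polyDer (D : Derivation κ L L) (p : L[X]) (i : ℕ) :
    (polyDer D p).coeff i = D (p.coeff i) := rfl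

lemma polyDer_X (D : Derivation κ L L) : polyDer D (X : L[X]) = 0 := by
  ext i; rw [coeff_polyDer, coeff_X]; split_ifs <;> simp

lemma eval_polyDer (D : Derivation κ L L) (p : L[X]) (c : L) (hc : D c = 0) :
    (polyDer D p).eval c = D (p.eval c) := by
  induction p using Polynomial.induction_on' with
  | add p q hp hq => simp [hp, hq]
  | monomial n a =>
    have : polyDer D (monomial n a) = monomial n (D a) := by
      ext i; rw [coeff_polyDer, coeff_monomial, coeff_monomial]; split_ifs <;> simp
    rw [this]
    simp [Derivation.leibniz, Derivation.leibniz_pow, hc, mul_comm]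

lemma map_Wr {k A A' : Type*} [CommRing k] [CommRing A] [Algebra k A] [CommRing A'] [Algebra k A']
    {m : ℕ} (D : Fin m → Derivation k A A) (D' : Fin m → Derivation k A' A') (φ : A →+* A')
    (y : Fin (m+1) → A) (h : ∀ i j, φ (D i (y j)) = D' i (φ (y j))) :
    φ (Wr D y) = Wr D' (fun j => φ (y j)) := by
  unfold Wr
  rw [RingHom.map_det]
  congr 1
  ext r j
  refine Fin.cases ?_ (fun i => ?_) r
  · simp
  · simp [h]
end PolyDer
end ConicBundleFormalization

namespace ConicBundleFormalization
open Polynomial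

lemma exists_X_pow_factor {L ι : Type*} [Field L] (p : ι → L[X]) (i0 : ι) (h0 : p i0 ≠ 0) :
    ∃ (a : ℕ) (p' : ι → L[X]), (∀ i, p i = X ^ a * p' i) ∧ ∃ i, (p' i).coeff 0 ≠ 0 := by
  induction hn : (p i0).natDegree using Nat.strong_induction_on generalizing p with
  | _ n ih =>
    by_cases h : ∃ i, (p i).coeff 0 ≠ 0
    · exact ⟨0, p, by simp, h⟩
    · push Not at h
      have h1 : ∀ i, ∃ q, p i = X * q := fun i => X_dvd_iff.2 (h i)
      choose q hq using h1
      have hq0 : q i0 ≠ 0 := by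
        intro h'; rw [hq, h', mul_zero] at h0; exact h0 rfl
      have hd : (q i0).natDegree < n := by
        rw [← hn, hq i0, natDegree_X_mul hq0]; omega
      obtain ⟨a, p', h2, h3⟩ := ih _ hd q hq0 rfl
      exact ⟨a+1, p', fun i => by rw [hq, h2]; ring, h3⟩

section Edge
variable {κ : Type*} [Field κ] [IsAlgClosed κ] [CharP κ 2]
variable {L : Type*} [Field L] [Algebra κ L] {m : ℕ}

lemma loc_pack (P : Ideal L[X]) [P.IsMaximal] : IsDiscreteValuationRing (Localization.AtPrime P) :=
  IsLocalization.AtPrime.isDiscreteValuationRing_of_dedekind_domain _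
    (Ring.ne_bot_of_isMaximal_of_not_isField (M := P) inferInstance (Polynomial.not_isField L)) _

lemma loc_Wr (P : Ideal L[X]) [P.IsMaximal] (D : Fin m → Derivation κ L[X] L[X]) :
    ∃ D' : Fin m → Derivation κ (Localization.AtPrime P) (Localization.AtPrime P),
      (∀ i r, D' i (algebraMap _ _ r) = algebraMap _ _ (D i r)) ∧
      ∀ u : Fin (m+1) → L[X], algebraMap L[X] (Localization.AtPrime P) (Wr D u) =
        Wr D' (fun j => algebraMap _ _ (u j)) := by
  have h := fun i => exists_locDer (S := Localization.AtPrime P) P.primeCompl (D i)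
  choose D' hD' using h
  exact ⟨D', hD', fun u => map_Wr D D' _ u (fun i j => (hD' i (u j)).symm)⟩

lemma prod_dvd_Wr (hm : 6 ≤ m) (D : Fin m → Derivation κ L[X] L[X])
    {a1 a2 N : ℕ} (hN : m + 1 + N = a1 + a2 + 2)
    (u : Fin (m+1) → L[X]) (hu : ∏ j, u j ≠ 0) (x0 x1 x2 : L[X]) (hx : x1 ≠ 0 ∨ x2 ≠ 0)
    (heq : G0 κ a1 a2 N u x0 x1 x2 = 0) : ∏ j, u j ∣ Wr D u := by
  rw [← Ideal.mem_span_singleton]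
  apply Ideal.mem_of_localization_maximal
  intro P hP
  have := loc_pack P
  obtain ⟨D', hD', hW⟩ := loc_Wr P D
  obtain ⟨π, hπ⟩ := IsDiscreteValuationRing.exists_irreducible (Localization.AtPrime P)
  have hinj : Function.Injective (algebraMap L[X] (Localization.AtPrime P)) :=
    IsLocalization.injective _ P.primeCompl_le_nonZeroDivisors
  rw [Ideal.map_span, Set.image_singleton, Ideal.mem_span_singleton, hW, map_prod]
  refine (local_lemma hm D' hπ hN _ ?_ (algebraMap _ _ x0) (algebraMap _ _ x1) (algebraMap _ _ x2)
    ?_ ?_).1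
  · rw [← map_prod]; exact (map_ne_zero_iff _ hinj).2 hu
  · exact hx.imp (map_ne_zero_iff _ hinj).2 (map_ne_zero_iff _ hinj).2
  · have := G0_map (κ := κ) (a1 := a1) (a2 := a2) (N := N)
      (IsScalarTower.toAlgHom κ L[X] (Localization.AtPrime P)) u x0 x1 x2
    rw [heq, map_zero] at this
    exact this.symm

lemma X_mul_prod_dvd_Wr (hm : 6 ≤ m) (D : Fin m → Derivation κ L[X] L[X])
    (hDX : ∀ i, D i X = 0)
    {a1 a2 N : ℕ} (hN : m + 1 + N = a1 + a2 + 2)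
    (u : Fin (m+1) → L[X]) (hu : ∏ j, u j ≠ 0) (x0 x1 x2 : L[X]) (hx : x1 ≠ 0 ∨ x2 ≠ 0)
    (heq : G0 κ a1 a2 N u x0 x1 x2 = 0) (hu0 : ∃ j, (u j).coeff 0 ≠ 0)
    (hp : (∏ j, u j).coeff 0 = 0) (η : L[X]) (hη : Wr D u = (∏ j, u j) * η) : η.coeff 0 = 0 := by
  let P : Ideal L[X] := Ideal.span {X}
  have hP : P.IsMaximal := PrincipalIdealRing.isMaximal_of_irreducible irreducible_X
  have := loc_pack P
  obtain ⟨D', hD', hW⟩ := loc_Wr P D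
  have hinj : Function.Injective (algebraMap L[X] (Localization.AtPrime P)) :=
    IsLocalization.injective _ P.primeCompl_le_nonZeroDivisors
  have hmem : ∀ r : L[X], IsUnit (algebraMap L[X] (Localization.AtPrime P) r) ↔ r.coeff 0 ≠ 0 := by
    intro r
    rw [IsLocalization.AtPrime.isUnit_to_map_iff (Localization.AtPrime P) P]
    show r ∉ P ↔ _
    rw [Ideal.mem_span_singleton, X_dvd_iff]
  have hπ : Irreducible (algebraMap L[X] (Localization.AtPrime P) X) := by
    rw [IsDiscreteValuationRing.irreducible_iff_uniformizer,
      ← IsLocalization.AtPrime.map_eq_maximalIdeal P (Localization.AtPrime P), Ideal.map_span,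
      Set.image_singleton]
  have key := (local_lemma hm D' hπ hN (fun j => algebraMap _ _ (u j)) (by
      rw [← map_prod]; exact (map_ne_zero_iff _ hinj).2 hu)
    (algebraMap _ _ x0) (algebraMap _ _ x1) (algebraMap _ _ x2)
    (hx.imp (map_ne_zero_iff _ hinj).2 (map_ne_zero_iff _ hinj).2) (by
      have := G0_map (κ := κ) (a1 := a1) (a2 := a2) (N := N)
        (IsScalarTower.toAlgHom κ L[X] (Localization.AtPrime P)) u x0 x1 x2
      rw [heq, map_zero] at this
      exact this.symm)).2 (by intro i; rw [hD', hDX, map_zero]; exact dvd_zero _)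
      (by obtain ⟨j, hj⟩ := hu0; exact ⟨j, (hmem _).2 hj⟩)
      (by rw [← map_prod, hmem]; simpa using hp)
  rw [← hW, hη, ← map_prod, map_mul, mul_comm (algebraMap _ _ X)] at key
  have h2 := (mul_dvd_mul_iff_left ((map_ne_zero_iff _ hinj).2 hu)).1 key
  by_contra h3
  exact hπ.not_isUnit (isUnit_of_dvd_unit h2 ((hmem _).2 h3))

noncomputable def hW (D : Fin m → Derivation κ L L) (u : Fin (m+1) → L) : L := Wr D u / ∏ j, u j

lemma hW_smul (D : Fin m → Derivation κ L L) (c : L) (hc : c ≠ 0) (u : Fin (m+1) → L) :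
    hW D (fun j => c * u j) = hW D u := by
  unfold hW
  rw [Wr_smul, Finset.prod_mul_distrib]
  simp only [Finset.prod_const, Finset.card_univ, Fintype.card_fin]
  rw [mul_div_mul_left _ _ (pow_ne_zero _ hc)]

lemma eta_eval (D : Fin m → Derivation κ L L) (u : Fin (m+1) → L[X]) (η : L[X])
    (hη : Wr (fun i => polyDer (D i)) u = (∏ j, u j) * η) (c : L) (hc : ∀ i, D i c = 0)
    (hp : (∏ j, u j).eval c ≠ 0) : η.eval c = hW D (fun j => (u j).eval c) := by
  unfold hW
  have h := map_Wr (fun i => polyDer (D i)) D (evalRingHom c) u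
    (fun i j => eval_polyDer (D i) (u j) c (hc i))
  simp only [coe_evalRingHom] at h
  rw [← h, hη, eval_mul, ← eval_prod, mul_div_cancel_left₀ _ hp]

lemma eta_zero (hm : 6 ≤ m) (D : Fin m → Derivation κ L L)
    {a1 a2 N : ℕ} (hN : m + 1 + N = a1 + a2 + 2)
    (u : Fin (m+1) → L[X]) (hu : ∏ j, u j ≠ 0) (x0 x1 x2 : L[X]) (hx : x1 ≠ 0 ∨ x2 ≠ 0)
    (heq : G0 κ a1 a2 N u x0 x1 x2 = 0) (hu0 : ∃ j, (u j).coeff 0 ≠ 0)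
    (η : L[X]) (hη : Wr (fun i => polyDer (D i)) u = (∏ j, u j) * η) :
    η.coeff 0 = hW D (fun j => (u j).coeff 0) := by
  by_cases hp : (∏ j, u j).coeff 0 = 0
  · rw [X_mul_prod_dvd_Wr hm _ (fun i => polyDer_X (D i)) hN u hu x0 x1 x2 hx heq hu0 hp η hη]
    unfold hW
    simp only [coeff_zero_eq_eval_zero] at hp ⊢
    rw [← eval_prod, hp, div_zero]
  · have := eta_eval D u η hη 0 (by simp) (by rwa [← coeff_zero_eq_eval_zero])
    simpa [coeff_zero_eq_eval_zero] using this

end Edge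
end ConicBundleFormalization

namespace ConicBundleFormalization
open Polynomial

abbrev PIdx (m : ℕ) := Fin 2 × Fin (m+1) × Fin (m+1)

def Phi {B : Type*} [CommRing B] {m : ℕ} (a1 a2 : ℕ) (u : Fin (m+1) → B) (x1 x2 : B) :
    PIdx m → B :=
  fun p => u p.2.1 * u p.2.2 ^ (if p.1 = 0 then a1 else a2) * (if p.1 = 0 then x1 else x2)

def VPt (κ : Type*) [CommRing κ] {B : Type*} [CommRing B] [Algebra κ B] {m : ℕ} (a1 a2 N : ℕ)
    (u : Fin (m+1) → B) (x0 x1 x2 : B) : Prop :=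
  u ≠ 0 ∧ (x1 ≠ 0 ∨ x2 ≠ 0) ∧ G0 κ a1 a2 N u x0 x1 x2 = 0

lemma Phi_smul {B : Type*} [CommRing B] {m : ℕ} (a1 a2 : ℕ) (c : B) (u : Fin (m+1) → B) (x1 x2 : B) :
    Phi a1 a2 (fun j => c * u j) x1 x2 = Phi a1 a2 u (c^(a1+1) * x1) (c^(a2+1) * x2) := by
  ext p
  unfold Phi
  split_ifs <;> ring

lemma Phi_smul_x {B : Type*} [CommRing B] {m : ℕ} (a1 a2 : ℕ) (c : B) (u : Fin (m+1) → B) (x1 x2 : B)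
    (p : PIdx m) :
    Phi a1 a2 u (c * x1) (c * x2) p = c * Phi a1 a2 u x1 x2 p := by
  unfold Phi
  split_ifs <;> ring

lemma Phi_map {B B' : Type*} [CommRing B] [CommRing B'] {m : ℕ} (φ : B →+* B') (a1 a2 : ℕ)
    (u : Fin (m+1) → B) (x1 x2 : B) (p : PIdx m) :
    φ (Phi a1 a2 u x1 x2 p) = Phi a1 a2 (fun j => φ (u j)) (φ x1) (φ x2) p := by
  unfold Phi
  split_ifs <;> simp

lemma Phi_ne_zero {B : Type*} [CommRing B] [IsDomain B] {m : ℕ} (a1 a2 : ℕ) (u : Fin (m+1) → B)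
    (x1 x2 : B) (hu : ∃ j, u j ≠ 0) (hx : x1 ≠ 0 ∨ x2 ≠ 0) :
    ∃ p, Phi a1 a2 u x1 x2 p ≠ 0 := by
  obtain ⟨j, hj⟩ := hu
  rcases hx with h | h
  · refine ⟨(0, j, j), ?_⟩
    simp [Phi, hj, h]
  · refine ⟨(1, j, j), ?_⟩
    simp [Phi, hj, h]

section Edge2
variable {κ : Type*} [Field κ] [IsAlgClosed κ] [CharP κ 2]
variable {L : Type*} [Field L] [Algebra κ L] {m : ℕ}

def HPt (D : Fin m → Derivation κ L L) (a1 a2 N : ℕ) (v : PIdx m → L) (x : L) : Prop :=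
  ∃ u x0 x1 x2, VPt κ a1 a2 N u x0 x1 x2 ∧ v = Phi a1 a2 u x1 x2 ∧ hW D u = x

lemma HPt_unique (D : Fin m → Derivation κ L L) (a1 a2 N : ℕ) (v v' : PIdx m → L) (c x x' : L)
    (hc : c ≠ 0) (hv : ∀ p, v' p = c * v p) (h : HPt D a1 a2 N v x) (h' : HPt D a1 a2 N v' x') :
    x = x' := by
  obtain ⟨u, x0, x1, x2, ⟨hu, hx, -⟩, rfl, rfl⟩ := h
  obtain ⟨u', x0', x1', x2', ⟨hu', hx', -⟩, rfl, rfl⟩ := h'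
  have hj : ∃ j, u j ≠ 0 := by by_contra h; push Not at h; exact hu (funext h)
  obtain ⟨⟨p1, p2, p3⟩, hp⟩ := Phi_ne_zero a1 a2 u x1 x2 hj hx
  have e1 : ∀ j, u' j * (u' p3 ^ (if p1 = 0 then a1 else a2) * (if p1 = 0 then x1' else x2'))
      = c * (u j * (u p3 ^ (if p1 = 0 then a1 else a2) * (if p1 = 0 then x1 else x2))) := by
    intro j
    have := hv (p1, j, p3)
    simp only [Phi] at this
    rw [← mul_assoc, this]; ring
  have h1 : (u p3 ^ (if p1 = 0 then a1 else a2) * (if p1 = 0 then x1 else x2)) ≠ 0 := by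
    intro h0
    apply hp
    simp only [Phi]
    rw [mul_assoc, h0, mul_zero]
  generalize (u p3 ^ (if p1 = 0 then a1 else a2) * (if p1 = 0 then x1 else x2)) = s at e1 h1
  generalize (u' p3 ^ (if p1 = 0 then a1 else a2) * (if p1 = 0 then x1' else x2')) = s' at e1
  have h2 : s' ≠ 0 := by
    rintro rfl
    obtain ⟨j, hj⟩ := hj
    have := e1 j
    rw [mul_zero] at this
    exact mul_ne_zero hc (mul_ne_zero hj h1) this.symm
  have : u' = fun j => (c * s / s') * u j := by
    ext j
    field_simp
    rw [e1]; ring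
  rw [this, hW_smul]
  exact div_ne_zero (mul_ne_zero hc h1) h2

lemma low_lemma (hm : 6 ≤ m) (D : Fin m → Derivation κ L L)
    {a1 a2 N : ℕ} (hN : m + 1 + N = a1 + a2 + 2)
    (u : Fin (m+1) → L[X]) (x0 x1 x2 : L[X]) (hV : VPt κ a1 a2 N u x0 x1 x2)
    (η : L[X]) (hη : Wr (fun i => polyDer (D i)) u = (∏ j, u j) * η)
    (hη0 : ∏ j, u j = 0 → η = 0)
    (k : ℕ) (hk : ∀ k' < k, ∀ p, (Phi a1 a2 u x1 x2 p).coeff k' = 0)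
    (hk2 : ∃ p, (Phi a1 a2 u x1 x2 p).coeff k ≠ 0) :
    HPt D a1 a2 N (fun p => (Phi a1 a2 u x1 x2 p).coeff k) (η.coeff 0) := by
  obtain ⟨hu, hx, heq⟩ := hV
  have hj : ∃ j, u j ≠ 0 := by by_contra h; push Not at h; exact hu (funext h)
  obtain ⟨j0, hj0⟩ := hj
  obtain ⟨a, u', hu', hu0⟩ := exists_X_pow_factor u j0 hj0
  have hX : ∀ n : ℕ, (X : L[X]) ^ n ≠ 0 := fun n => pow_ne_zero _ X_ne_zero
  have huf : u = fun j => X ^ a * u' j := funext hu'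

  obtain ⟨b, y, hy, hy0⟩ : ∃ (b : ℕ) (y : Fin 2 → L[X]),
      (∀ i, ![(X ^ a) ^ (a1+1) * x1, (X ^ a) ^ (a2+1) * x2] i = X ^ b * y i)
      ∧ ∃ i, (y i).coeff 0 ≠ 0 := by
    rcases hx with h | h
    · exact exists_X_pow_factor _ 0 (by simpa using h)
    · exact exists_X_pow_factor _ 1 (by simpa using h)
  have hy1 : (X ^ a) ^ (a1+1) * x1 = X ^ b * y 0 := hy 0
  have hy2 : (X ^ a) ^ (a2+1) * x2 = X ^ b * y 1 := hy 1
  have heq2 : G0 κ a1 a2 N u' x0 (X ^ b * y 0) (X ^ b * y 1) = 0 := by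
    rw [← hy1, ← hy2, ← G0_smul_u hN, ← huf]; exact heq
  have hdv : (X ^ b) ^ 2 ∣ x0 ^ 2 := by
    refine ⟨-(MvPolynomial.aeval u' (QQ κ m a1 1) * y 0 ^ 2 + MvPolynomial.aeval u' (FF κ m N) * y 0 * y 1
      + MvPolynomial.aeval u' (QQ κ m a2 2) * y 1 ^ 2), ?_⟩
    unfold G0 at heq2
    linear_combination heq2
  obtain ⟨z, hz⟩ := (IsIntegrallyClosed.pow_dvd_pow_iff two_ne_zero).1 hdv
  have heq3 : G0 κ a1 a2 N u' z (y 0) (y 1) = 0 := by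
    rw [hz, G0_smul_x] at heq2
    exact (mul_eq_zero.1 heq2).resolve_left (pow_ne_zero _ (hX b))
  have hPhi : ∀ p, Phi a1 a2 u x1 x2 p = X ^ b * Phi a1 a2 u' (y 0) (y 1) p := by
    intro p
    rw [huf, Phi_smul, hy1, hy2, Phi_smul_x]
  have hc0 : ∀ p, (Phi a1 a2 u' (y 0) (y 1) p).coeff 0
      = Phi a1 a2 (fun j => (u' j).coeff 0) ((y 0).coeff 0) ((y 1).coeff 0) p := by
    intro p
    exact Phi_map constantCoeff a1 a2 u' (y 0) (y 1) p
  have hyy : (y 0).coeff 0 ≠ 0 ∨ (y 1).coeff 0 ≠ 0 := by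
    obtain ⟨i, hi⟩ := hy0
    fin_cases i
    · exact Or.inl hi
    · exact Or.inr hi
  obtain ⟨p0, hp0⟩ := Phi_ne_zero a1 a2 _ _ _ hu0 hyy
  rw [← hc0] at hp0
  have hbk : b = k := by
    rcases lt_trichotomy b k with h | h | h
    · exfalso
      have := hk b h p0
      rw [hPhi, coeff_X_pow_mul'] at this
      simp at this
      exact hp0 (by simpa using this)
    · exact h
    · exfalso
      obtain ⟨p, hp⟩ := hk2
      rw [hPhi, coeff_X_pow_mul'] at hp
      simp [h] at hp
  subst hbk
  refine ⟨fun j => (u' j).coeff 0, z.coeff 0, (y 0).coeff 0, (y 1).coeff 0, ⟨?_, hyy, ?_⟩, ?_, ?_⟩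
  · obtain ⟨j, hj⟩ := hu0
    intro h; exact hj (congrFun h j)
  · have := G0_map (κ := κ) (a1 := a1) (a2 := a2) (N := N)
      ((aeval (0:L)).restrictScalars κ : L[X] →ₐ[κ] L) u' z (y 0) (y 1)
    rw [heq3, map_zero] at this
    simp only [AlgHom.coe_restrictScalars', coe_aeval_eq_eval, ← coeff_zero_eq_eval_zero] at this
    exact this.symm
  · ext p
    rw [hPhi, coeff_X_pow_mul', if_pos le_rfl, Nat.sub_self, hc0]
  · by_cases hP : ∏ j, u j = 0
    · rw [hη0 hP]
      rw [Finset.prod_eq_zero_iff] at hP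
      obtain ⟨j, -, hj⟩ := hP
      have : u' j = 0 := by
        have := hu' j
        rw [hj] at this
        exact (mul_eq_zero.1 this.symm).resolve_left (hX a)
      unfold hW
      rw [Finset.prod_eq_zero (Finset.mem_univ j) (by simp [this]), div_zero, coeff_zero]
    · symm
      have hprod : ∏ j, u j = (X^a)^(m+1) * ∏ j, u' j := by
        rw [huf, Finset.prod_mul_distrib]; simp
      have hP' : ∏ j, u' j ≠ 0 := by
        intro h; rw [hprod, h, mul_zero] at hP; exact hP rfl
      refine eta_zero hm D hN u' hP' z (y 0) (y 1) ?_ heq3 hu0 η ?_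
      · exact hyy.imp (fun h h' => h (by simp [h'])) (fun h h' => h (by simp [h']))
      · rw [hprod] at hη
        rw [huf, Wr_smul, mul_assoc] at hη
        exact mul_left_cancel₀ (pow_ne_zero _ (hX a)) hη

end Edge2
end ConicBundleFormalization

namespace ConicBundleFormalization
open Polynomial

lemma eval_reflect' {L : Type*} [Field L] (N : ℕ) (f : L[X]) (hf : f.natDegree ≤ N) (c : L) (hc : c ≠ 0) :
    (reflect N f).eval c = c ^ N * f.eval c⁻¹ := by
  have hc' : c⁻¹ ≠ 0 := inv_ne_zero hc
  have := invertibleOfNonzero hc'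
  have h := eval₂_reflect_mul_pow (RingHom.id L) c⁻¹ N f hf
  rw [invOf_eq_inv, inv_inv] at h
  simp only [eval₂_id] at h
  rw [← h, mul_comm, mul_assoc, ← mul_pow, inv_mul_cancel₀ hc, one_pow, mul_one]

lemma poly_zero_of_eval (κ : Type*) {L : Type*} [Field κ] [Infinite κ] [Field L] [Algebra κ L] (p : L[X])
    (h : ∀ c : κ, c ≠ 0 → p.eval (algebraMap κ L c) = 0) : p = 0 := by
  apply eq_zero_of_infinite_isRoot
  have h1 : ({0}ᶜ : Set κ).Infinite := Set.Finite.infinite_compl (Set.finite_singleton 0)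
  refine (h1.image (algebraMap κ L).injective.injOn).mono ?_
  rintro _ ⟨c, hc, rfl⟩
  exact h c hc

section Edge2
variable {κ : Type*} [Field κ] [IsAlgClosed κ] [CharP κ 2]
variable {L : Type*} [Field L] [Algebra κ L] {m : ℕ}

lemma Wr_eq_zero_of_prod {k A : Type*} [CommRing k] [CommRing A] [IsDomain A] [Algebra k A] {m : ℕ}
    (D : Fin m → Derivation k A A) (u : Fin (m+1) → A) (h : ∏ j, u j = 0) : Wr D u = 0 := by
  rw [Finset.prod_eq_zero_iff] at h
  obtain ⟨j, -, hj⟩ := h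
  unfold Wr
  apply Matrix.det_eq_zero_of_column_eq_zero j
  intro r
  refine Fin.cases ?_ (fun i => ?_) r <;> simp [hj]

lemma exists_eta (hm : 6 ≤ m) (D : Fin m → Derivation κ L L)
    {a1 a2 N : ℕ} (hN : m + 1 + N = a1 + a2 + 2)
    (u : Fin (m+1) → L[X]) (x0 x1 x2 : L[X]) (hV : VPt κ a1 a2 N u x0 x1 x2) :
    ∃ η : L[X], Wr (fun i => polyDer (D i)) u = (∏ j, u j) * η ∧ (∏ j, u j = 0 → η = 0) := by
  by_cases h : ∏ j, u j = 0
  · exact ⟨0, by rw [mul_zero, Wr_eq_zero_of_prod _ _ h], fun _ => rfl⟩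
  · obtain ⟨η, hη⟩ := prod_dvd_Wr hm (fun i => polyDer (D i)) hN u h x0 x1 x2 hV.2.1 hV.2.2
    exact ⟨η, hη, fun h' => absurd h' h⟩

lemma natDegree_Phi_le (a1 a2 M T1 T2 T : ℕ) (u : Fin (m+1) → L[X]) (x1 x2 : L[X])
    (hu : ∀ j, (u j).natDegree ≤ M) (h1 : x1.natDegree ≤ T1) (h2 : x2.natDegree ≤ T2)
    (hT1 : M * (a1+1) + T1 = T) (hT2 : M * (a2+1) + T2 = T) (p : PIdx m) :
    (Phi a1 a2 u x1 x2 p).natDegree ≤ T := by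
  unfold Phi
  split_ifs
  · rw [← hT1]
    refine natDegree_mul_le_of_le ?_ h1
    exact (natDegree_mul_le_of_le (hu _) (natDegree_pow_le_of_le a1 (hu _))).trans (by
      apply le_of_eq; ring)
  · rw [← hT2]
    refine natDegree_mul_le_of_le ?_ h2
    exact (natDegree_mul_le_of_le (hu _) (natDegree_pow_le_of_le a2 (hu _))).trans (by
      apply le_of_eq; ring)

lemma edge_lemma (hm : 6 ≤ m) (D : Fin m → Derivation κ L L)
    {a1 a2 N : ℕ} (hN : m + 1 + N = a1 + a2 + 2)
    (u : Fin (m+1) → L[X]) (x0 x1 x2 : L[X]) (hV : VPt κ a1 a2 N u x0 x1 x2)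
    (k : ℕ) (hk : ∀ k' < k, ∀ p, (Phi a1 a2 u x1 x2 p).coeff k' = 0)
    (hk2 : ∃ p, (Phi a1 a2 u x1 x2 p).coeff k ≠ 0)
    (l : ℕ) (hl : ∀ k' > l, ∀ p, (Phi a1 a2 u x1 x2 p).coeff k' = 0)
    (hl2 : ∃ p, (Phi a1 a2 u x1 x2 p).coeff l ≠ 0) :
    ∃ x, HPt D a1 a2 N (fun p => (Phi a1 a2 u x1 x2 p).coeff k) x ∧
      HPt D a1 a2 N (fun p => (Phi a1 a2 u x1 x2 p).coeff l) x := by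
  obtain ⟨η, hη, hη0⟩ := exists_eta hm D hN u x0 x1 x2 hV
  refine ⟨η.coeff 0, low_lemma hm D hN u x0 x1 x2 hV η hη hη0 k hk hk2, ?_⟩
  let M := ∑ j, (u j).natDegree
  have hM : ∀ j, (u j).natDegree ≤ M := fun j =>
    Finset.single_le_sum (f := fun j => (u j).natDegree) (fun _ _ => Nat.zero_le _) (Finset.mem_univ j)
  let T1 := M * (a2+1) + (x0.natDegree + x1.natDegree + x2.natDegree)
  let T2 := M * (a1+1) + (x0.natDegree + x1.natDegree + x2.natDegree)
  let T := M * (a1+1) + T1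
  have hT1 : M * (a1+1) + T1 = T := rfl
  have hT2 : M * (a2+1) + T2 = T := by simp only [T, T1, T2]; ring
  have hx1T : x1.natDegree ≤ T1 := by simp only [T1]; omega
  have hx2T : x2.natDegree ≤ T2 := by simp only [T2]; omega
  have hx0T : x0.natDegree ≤ T := by simp only [T, T1]; omega
  clear_value T1 T2 T M
  let uR : Fin (m+1) → L[X] := fun j => reflect M (u j)
  have huR : ∀ c : L, c ≠ 0 → ∀ j, (uR j).eval c = c ^ M * (u j).eval c⁻¹ := fun c hc j =>
    eval_reflect' M (u j) (hM j) c hc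
  have hinj : ∀ c : κ, c ≠ 0 → algebraMap κ L c ≠ 0 := fun c hc => by simpa using hc
  have : Infinite κ := IsAlgClosed.instInfinite
  have hPhi : ∀ p, Phi a1 a2 uR (reflect T1 x1) (reflect T2 x2) p = reflect T (Phi a1 a2 u x1 x2 p) := by
    intro p
    rw [← sub_eq_zero]
    apply poly_zero_of_eval κ
    intro c hc
    have hc := hinj c hc
    generalize algebraMap κ L c = c at hc
    rw [eval_sub, sub_eq_zero,
      eval_reflect' T _ (natDegree_Phi_le a1 a2 M T1 T2 T u x1 x2 hM hx1T hx2T hT1 hT2 p) c hc]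
    have e1 := Phi_map (evalRingHom c) a1 a2 uR (reflect T1 x1) (reflect T2 x2) p
    have e2 := Phi_map (evalRingHom c⁻¹) a1 a2 u x1 x2 p
    simp only [coe_evalRingHom] at e1 e2
    rw [e1, e2, funext (huR c hc), Phi_smul, eval_reflect' T1 _ hx1T c hc,
      eval_reflect' T2 _ hx2T c hc, ← mul_assoc, ← mul_assoc, ← pow_mul, ← pow_mul, ← pow_add, ← pow_add,
      hT1, hT2, Phi_smul_x]
  have hG : G0 κ a1 a2 N uR (reflect T x0) (reflect T1 x1) (reflect T2 x2) = 0 := by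
    apply poly_zero_of_eval κ
    intro c hc
    have hc := hinj c hc
    generalize algebraMap κ L c = c at hc
    have e0 := fun c : L => fun (u : Fin (m+1) → L[X]) (x0 x1 x2 : L[X]) =>
      G0_map (κ := κ) (a1 := a1) (a2 := a2) (N := N)
      ((aeval c).restrictScalars κ : L[X] →ₐ[κ] L) u x0 x1 x2
    simp only [AlgHom.coe_restrictScalars', coe_aeval_eq_eval] at e0
    rw [e0, funext (huR c hc), G0_smul_u hN, eval_reflect' T _ hx0T c hc,
      eval_reflect' T1 _ hx1T c hc,
      eval_reflect' T2 _ hx2T c hc, ← mul_assoc, ← mul_assoc, ← pow_mul, ← pow_mul, ← pow_add, ← pow_add,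
      hT1, hT2, G0_smul_x, ← e0, hV.2.2]
    simp
  have hrne : ∀ (n : ℕ) (f : L[X]), reflect n f = 0 ↔ f = 0 := fun n f => reflect_eq_zero_iff
  have hVR : VPt κ a1 a2 N uR (reflect T x0) (reflect T1 x1) (reflect T2 x2) := by
    refine ⟨fun h => hV.1 (funext fun j => ?_), ?_, hG⟩
    · exact (hrne _ _).1 (congrFun h j)
    · exact hV.2.1.imp (fun h h' => h ((hrne _ _).1 h')) (fun h h' => h ((hrne _ _).1 h'))
  obtain ⟨ηR, hηR, hηR0⟩ := exists_eta hm D hN uR _ _ _ hVR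
  have hlT : l ≤ T := by
    obtain ⟨p, hp⟩ := hl2
    exact (le_natDegree_of_ne_zero hp).trans
      (natDegree_Phi_le a1 a2 M T1 T2 T u x1 x2 hM hx1T hx2T hT1 hT2 p)
  have key := low_lemma hm D hN uR _ _ _ hVR ηR hηR hηR0 (T - l) (by
      intro k' hk' p
      rw [hPhi, coeff_reflect, revAt_le (by omega)]
      exact hl _ (by omega) p) (by
      obtain ⟨p, hp⟩ := hl2
      refine ⟨p, ?_⟩
      rw [hPhi, coeff_reflect, revAt_le (by omega), Nat.sub_sub_self hlT]
      exact hp)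
  have e : (fun p => (Phi a1 a2 uR (reflect T1 x1) (reflect T2 x2) p).coeff (T - l)) =
      fun p => (Phi a1 a2 u x1 x2 p).coeff l := by
    ext p
    rw [hPhi, coeff_reflect, revAt_le (by omega), Nat.sub_sub_self hlT]
  rw [e] at key
  suffices h : η.coeff 0 = ηR.coeff 0 by rw [h]; exact key
  by_cases hP : ∏ j, u j = 0
  · rw [hη0 hP, hηR0]
    rw [Finset.prod_eq_zero_iff] at hP ⊢
    obtain ⟨j, hj, h⟩ := hP
    exact ⟨j, hj, (hrne _ _).2 h⟩
  · have hQ : (∏ j, u j) * (X ^ ηR.natDegree * η - reflect ηR.natDegree ηR) = 0 := by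
      apply poly_zero_of_eval κ
      intro c hc
      have hDc : ∀ i, D i (algebraMap κ L c) = 0 := fun i => Derivation.map_algebraMap _ _
      have hDc' : ∀ i, D i (algebraMap κ L c)⁻¹ = 0 := fun i => by
        rw [← map_inv₀]; exact Derivation.map_algebraMap _ _
      have hc := hinj c hc
      generalize algebraMap κ L c = c at hc hDc hDc'
      rw [eval_mul]
      by_cases h0 : (∏ j, u j).eval c = 0
      · rw [h0, zero_mul]
      have hev : ∀ j, (uR j).eval c⁻¹ = c⁻¹ ^ M * (u j).eval c := by
        intro j; rw [huR _ (inv_ne_zero hc), inv_inv]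
      rw [eval_sub, eval_mul, eval_reflect' _ _ le_rfl c hc, eta_eval D u η hη c hDc h0,
        eta_eval D uR ηR hηR c⁻¹ hDc' ?_, funext hev, hW_smul _ _ (pow_ne_zero _ (inv_ne_zero hc))]
      · simp
      · rw [eval_prod, Finset.prod_congr rfl (fun j _ => hev j), Finset.prod_mul_distrib, ← eval_prod]
        refine mul_ne_zero ?_ h0
        simp [hc]
    have hQ2 := (mul_eq_zero.1 hQ).resolve_left hP
    have := congrArg (fun q => coeff q ηR.natDegree) (sub_eq_zero.1 hQ2)
    simp only [coeff_reflect, revAt_le le_rfl, Nat.sub_self] at this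
    rw [coeff_X_pow_mul', if_pos le_rfl, Nat.sub_self] at this
    exact this

end Edge2
end ConicBundleFormalization

namespace ConicBundleFormalization

section Newton
variable {K : Type*} [Field K] [IsAlgClosed K] {Γ : Type*} [LinearOrderedCommGroupWithZero Γ]
  (val : Valuation K Γ)

lemma newton_scale (ρ ρ' γ : K) (hρ : ρ ≠ 0) (i : ℕ) :
    val (γ * ρ' ^ i) = val (γ * ρ ^ i) * val (ρ' / ρ) ^ i := by
  rw [← map_pow, ← map_mul, mul_assoc, ← mul_pow, mul_div_cancel₀ _ hρ]

lemma newton_next (γ : ℕ → K) (k kt : ℕ) (hk : γ k ≠ 0) (hkt : γ kt ≠ 0) (hlt : k < kt)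
    (htop : ∀ i > kt, γ i = 0) :
    ∃ ρ : K, ρ ≠ 0 ∧ (∀ j > k, val (γ j * ρ ^ j) ≤ val (γ k * ρ ^ k)) ∧
      ∃ j > k, γ j ≠ 0 ∧ val (γ j * ρ ^ j) = val (γ k * ρ ^ k) := by
  have h1 : ∀ j, ∃ r : K, j > k → γ j ≠ 0 → r ≠ 0 ∧ γ j * r ^ j = γ k * r ^ k := by
    intro j
    by_cases hj : j > k ∧ γ j ≠ 0
    · obtain ⟨r, hr⟩ := IsAlgClosed.exists_pow_nat_eq (γ k / γ j) (n := j - k) (by omega)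
      refine ⟨r, fun _ _ => ⟨?_, ?_⟩⟩
      · rintro rfl
        rw [zero_pow (by omega)] at hr
        exact div_ne_zero hk hj.2 hr.symm
      · have : j = (j - k) + k := by omega
        conv_lhs => rw [this]
        rw [pow_add, hr]
        have := hj.2
        have e : j - k + k = j := by omega
        rw [e]
        field_simp
    · exact ⟨1, fun a b => absurd ⟨a, b⟩ hj⟩
  choose r hr using h1
  classical
  let S := (Finset.range (kt+1)).filter (fun j => j > k ∧ γ j ≠ 0)
  have hS : ∀ j, j ∈ S ↔ j > k ∧ γ j ≠ 0 := by
    intro j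
    simp only [S, Finset.mem_filter, Finset.mem_range, and_iff_right_iff_imp]
    rintro ⟨_, h⟩
    by_contra h'
    exact h (htop j (by omega))
  obtain ⟨j0, hj0, hmin⟩ := S.exists_min_image (fun j => val (r j)) ⟨kt, (hS kt).2 ⟨hlt, hkt⟩⟩
  obtain ⟨hj0k, hj0g⟩ := (hS j0).1 hj0
  obtain ⟨hr0, hr1⟩ := hr j0 hj0k hj0g
  refine ⟨r j0, hr0, ?_, j0, hj0k, hj0g, by rw [hr1]⟩
  intro j hj
  by_cases hg : γ j = 0
  · rw [hg]; simp
  obtain ⟨hrj0, hrj1⟩ := hr j hj hg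
  have hle := hmin j ((hS j).2 ⟨hj, hg⟩)
  rw [newton_scale val (r j) (r j0) _ hrj0, newton_scale val (r j) (r j0) (γ k) hrj0, hrj1]
  apply mul_le_mul_right
  apply pow_le_pow_right_of_le_one' _ hj.le
  rw [map_div₀]
  exact div_le_one_of_le₀ hle zero_le

lemma newton (γ : ℕ → K) (R : ℕ → ℕ → Prop) (htrans : ∀ a b c, R a b → R b c → R a c)
    (hstep : ∀ ρ : K, ρ ≠ 0 → ∀ k l, γ k ≠ 0 → γ l ≠ 0 → k ≤ l →
      (∀ i, val (γ i * ρ ^ i) ≤ val (γ k * ρ ^ k)) → val (γ l * ρ ^ l) = val (γ k * ρ ^ k) →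
      (∀ i < k, val (γ i * ρ ^ i) < val (γ k * ρ ^ k)) →
      (∀ i > l, val (γ i * ρ ^ i) < val (γ k * ρ ^ k)) → R k l)
    (kb kt : ℕ) (hkb : γ kb ≠ 0) (hkt : γ kt ≠ 0) (hbot : ∀ i < kb, γ i = 0)
    (htop : ∀ i > kt, γ i = 0) : R kb kt := by
  have hpos : ∀ (ρ : K) k, ρ ≠ 0 → γ k ≠ 0 → 0 < val (γ k * ρ ^ k) := by
    intro ρ k hρ hk
    exact (Valuation.pos_iff val).2 (mul_ne_zero hk (pow_ne_zero _ hρ))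
  have main : ∀ n k, kt - k = n → k < kt → γ k ≠ 0 →
      (∀ ρ : K, ρ ≠ 0 → (∀ j > k, val (γ j * ρ ^ j) ≤ val (γ k * ρ ^ k)) →
        (∃ j > k, γ j ≠ 0 ∧ val (γ j * ρ ^ j) = val (γ k * ρ ^ k)) →
        ∀ i < k, val (γ i * ρ ^ i) < val (γ k * ρ ^ k)) → R k kt := by
    intro n
    induction n using Nat.strong_induction_on with
    | _ n ih =>
      intro k hn hlt hk hinv
      obtain ⟨ρ, hρ, h1, h2⟩ := newton_next val γ k kt hk hkt hlt htop
      have h3 := hinv ρ hρ h1 h2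
      classical

      let S := (Finset.range (kt+1)).filter
        (fun j => j > k ∧ γ j ≠ 0 ∧ val (γ j * ρ ^ j) = val (γ k * ρ ^ k))
      have hS : ∀ j, j ∈ S ↔ (j > k ∧ γ j ≠ 0 ∧ val (γ j * ρ ^ j) = val (γ k * ρ ^ k)) := by
        intro j
        simp only [S, Finset.mem_filter, Finset.mem_range, and_iff_right_iff_imp]
        rintro ⟨_, h, _⟩
        by_contra h'
        exact h (htop j (by omega))
      have hSne : S.Nonempty := by
        obtain ⟨j, hj, hj2⟩ := h2
        exact ⟨j, (hS j).2 ⟨hj, hj2⟩⟩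
      obtain ⟨l, hl, hmax⟩ := S.exists_max_image id hSne
      obtain ⟨hkl, hgl, hle⟩ := (hS l).1 hl
      have h4 : ∀ i > l, val (γ i * ρ ^ i) < val (γ k * ρ ^ k) := by
        intro i hi
        refine lt_of_le_of_ne (h1 i (by omega)) ?_
        intro he
        by_cases hgi : γ i = 0
        · rw [hgi, zero_mul, map_zero] at he
          exact (hpos ρ k hρ hk).ne he
        · have := hmax i ((hS i).2 ⟨by omega, hgi, he⟩)
          simp at this
          omega
      have hkl' : R k l := by
        refine hstep ρ hρ k l hk hgl hkl.le ?_ hle h3 h4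
        intro i
        rcases lt_trichotomy i k with h | h | h
        · exact (h3 i h).le
        · rw [h]
        · exact h1 i h
      have hlkt : l ≤ kt := by
        by_contra h'
        exact hgl (htop l (by omega))
      rcases hlkt.eq_or_lt with rfl | hlt'
      · exact hkl'
      refine htrans _ _ _ hkl' (ih (kt - l) (by omega) l rfl hlt' hgl ?_)
      intro ρ' hρ' g1 g2 i hi
      have ht : 1 < val (ρ' / ρ) := by
        by_contra hle1
        push Not at hle1
        obtain ⟨j, hj, hgj, he⟩ := g2
        rw [newton_scale val ρ ρ' _ hρ, newton_scale val ρ ρ' (γ l) hρ] at he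
        have e1 := h4 j hj
        rw [← hle] at e1
        have e2 : val (ρ' / ρ) ^ j ≤ val (ρ' / ρ) ^ l := pow_le_pow_right_of_le_one' hle1 hj.le
        have hpp : 0 < val (ρ' / ρ) := (Valuation.pos_iff val).2 (div_ne_zero hρ' hρ)
        have e3 : val (γ j * ρ ^ j) * val (ρ' / ρ) ^ j < val (γ l * ρ ^ l) * val (ρ' / ρ) ^ j :=
          mul_lt_mul_of_pos_right e1 (pow_pos hpp _)
        have e4 : val (γ l * ρ ^ l) * val (ρ' / ρ) ^ j ≤ val (γ l * ρ ^ l) * val (ρ' / ρ) ^ l :=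
          mul_le_mul_right e2 _
        exact (e3.trans_le e4).ne he
      rw [newton_scale val ρ ρ' _ hρ, newton_scale val ρ ρ' (γ l) hρ]
      have e1 : val (γ i * ρ ^ i) ≤ val (γ l * ρ ^ l) := by
        rw [hle]
        rcases lt_trichotomy i k with h | h | h
        · exact (h3 i h).le
        · rw [h]
        · exact h1 i h
      have e2 : val (ρ' / ρ) ^ i < val (ρ' / ρ) ^ l := pow_lt_pow_right₀ ht hi
      exact (mul_le_mul_left e1 _).trans_lt (mul_lt_mul_of_pos_left e2 (hpos ρ l hρ hgl))
  have hle : kb ≤ kt := by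
    by_contra h'
    exact hkt (hbot kt (by omega))
  rcases hle.eq_or_lt with rfl | hlt
  · refine hstep 1 one_ne_zero kb kb hkb hkb le_rfl ?_ rfl ?_ ?_
    · intro i
      rcases lt_trichotomy i kb with h | h | h
      · rw [hbot i h]; simp
      · rw [h]
      · rw [htop i h]; simp
    · intro i h
      rw [hbot i h, zero_mul, map_zero]; exact hpos _ _ one_ne_zero hkb
    · intro i h
      rw [htop i h, zero_mul, map_zero]; exact hpos _ _ one_ne_zero hkb
  · refine main _ kb rfl hlt hkb ?_
    intro ρ hρ _ _ i hi
    rw [hbot i hi, zero_mul, map_zero]; exact hpos ρ kb hρ hkb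

end Newton
end ConicBundleFormalization

namespace ConicBundleFormalization
open Polynomial

section Chain
variable {K : Type*} [Field K] [IsAlgClosed K] {M : Type*} [Field M] [Algebra K M]
  (V : ValuationSubring M)
  {κ : Type*} [Field κ] [IsAlgClosed κ] [CharP κ 2] {L : Type*} [Field L] [Algebra κ L] {m : ℕ}
  (res : V →+* L)

structure GRed (K : Type*) [Field K] {M : Type*} [Field M] [Algebra K M]
  (V : ValuationSubring M) (κ : Type*) [Field κ] {L : Type*} [Field L] [Algebra κ L] {m : ℕ}
  (res : V →+* L) (a1 a2 N : ℕ)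
  (Gz : (Fin (m+1) → M[X]) → M[X] → M[X] → M[X] → Prop) : Prop where
  hres : ∀ a : V, res a = 0 ↔ V.valuation (a : M) < 1
  hunit : ∀ a : M, a ≠ 0 → ∃ c : K, c ≠ 0 ∧ V.valuation (algebraMap K M c * a) = 1
  smul_u : ∀ (c : M) u x0 x1 x2, Gz u x0 (C c ^ (a1+1) * x1) (C c ^ (a2+1) * x2) →
    Gz (fun j => C c * u j) x0 x1 x2
  smul_x : ∀ (c : M) u x0 x1 x2, Gz u x0 x1 x2 → Gz u (C c * x0) (C c * x1) (C c * x2)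
  comp : ∀ (q : M[X]) u x0 x1 x2, Gz u x0 x1 x2 →
    Gz (fun j => (u j).comp q) (x0.comp q) (x1.comp q) (x2.comp q)
  red : ∀ (U : Fin (m+1) → V[X]) (Y0 Y1 Y2 : V[X]),
    Gz (fun j => (U j).map V.subtype) (Y0.map V.subtype) (Y1.map V.subtype) (Y2.map V.subtype) →
    G0 κ a1 a2 N (fun j => (U j).map res) (Y0.map res) (Y1.map res) (Y2.map res) = 0

lemma norm_fin (hunit : ∀ a : M, a ≠ 0 → ∃ c : K, c ≠ 0 ∧ V.valuation (algebraMap K M c * a) = 1)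
    {J : Type*} (s : Finset J) (a : J → M) (h : ∃ j ∈ s, a j ≠ 0) :
    ∃ c : K, c ≠ 0 ∧ (∀ j ∈ s, V.valuation (algebraMap K M c * a j) ≤ 1) ∧
      ∃ j ∈ s, V.valuation (algebraMap K M c * a j) = 1 := by
  obtain ⟨j1, hj1, hne⟩ := h
  obtain ⟨j0, hj0, hmax⟩ := s.exists_max_image (fun j => V.valuation (a j)) ⟨j1, hj1⟩
  have hne0 : a j0 ≠ 0 := by
    intro h0
    have := hmax j1 hj1
    rw [h0, map_zero, nonpos_iff_eq_zero, map_eq_zero] at this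
    exact hne this
  obtain ⟨c, hc, hc1⟩ := hunit _ hne0
  refine ⟨c, hc, fun j hj => ?_, j0, hj0, hc1⟩
  rw [← hc1, map_mul, map_mul]
  exact mul_le_mul_right (hmax j hj) _

lemma norm_poly (hres : ∀ a : V, res a = 0 ↔ V.valuation (a : M) < 1)
    (hunit : ∀ a : M, a ≠ 0 → ∃ c : K, c ≠ 0 ∧ V.valuation (algebraMap K M c * a) = 1)
    {ι : Type*} [Fintype ι] (p : ι → M[X]) (h : ∃ i, p i ≠ 0) :
    ∃ c : K, c ≠ 0 ∧ ∃ P : ι → V[X], (∀ i, (P i).map V.subtype = C (algebraMap K M c) * p i) ∧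
      ∃ i, (P i).map res ≠ 0 := by
  classical
  let s : Finset (ι × ℕ) := Finset.univ ×ˢ Finset.range (∑ i, (p i).natDegree + 1)
  have hs : ∀ i k, (p i).coeff k ≠ 0 → (i, k) ∈ s := by
    intro i k hk
    simp only [s, Finset.mem_product, Finset.mem_univ, true_and, Finset.mem_range]
    have h1 := le_natDegree_of_ne_zero hk
    have h2 := Finset.single_le_sum (f := fun j => (p j).natDegree) (fun _ _ => Nat.zero_le _)
      (Finset.mem_univ i)
    omega
  obtain ⟨c, hc, hle, ⟨i0, k0⟩, hi0, h1⟩ := norm_fin V hunit s (fun x => (p x.1).coeff x.2) (by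
    obtain ⟨i, hi⟩ := h
    obtain ⟨k, hk⟩ : ∃ k, (p i).coeff k ≠ 0 := by
      by_contra h'; push Not at h'; exact hi (Polynomial.ext (by simpa using h'))
    exact ⟨(i, k), hs i k hk, hk⟩)
  have hle' : ∀ i k, V.valuation (algebraMap K M c * (p i).coeff k) ≤ 1 := by
    intro i k
    by_cases hk : (p i).coeff k = 0
    · rw [hk]; simp
    · exact hle (i, k) (hs i k hk)
  have hP : ∀ i, ∃ P : V[X], P.map V.subtype = C (algebraMap K M c) * p i := by
    intro i
    have : C (algebraMap K M c) * p i ∈ lifts (V.subtype) := by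
      rw [lifts_iff_coeff_lifts]
      intro k
      rw [coeff_C_mul]
      exact ⟨⟨_, (V.valuation_le_one_iff _).1 (hle' i k)⟩, rfl⟩
    exact (mem_lifts _).1 this
  choose P hP using hP
  refine ⟨c, hc, P, hP, i0, fun h0 => ?_⟩
  have e1 : res ((P i0).coeff k0) = 0 := by rw [← coeff_map, h0, coeff_zero]
  rw [hres] at e1
  have e2 : (((P i0).coeff k0 : V) : M) = algebraMap K M c * (p i0).coeff k0 := by
    have := congrArg (fun q => coeff q k0) (hP i0)
    simpa using this
  rw [e2] at e1
  exact e1.ne h1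

def HM (K : Type*) [Field K] {M : Type*} [Field M] [Algebra K M]
    (V : ValuationSubring M)
    {κ : Type*} [Field κ] {L : Type*} [Field L] [Algebra κ L] {m : ℕ}
    (res : V →+* L) (D : Fin m → Derivation κ L L) (a1 a2 N : ℕ) (a : PIdx m → M) (x : L) : Prop :=
  ∃ c : K, c ≠ 0 ∧ ∃ w : PIdx m → V, (∀ p, (w p : M) = algebraMap K M c * a p) ∧
    HPt D a1 a2 N (fun p => res (w p)) x

lemma HPt.ne_zero {D : Fin m → Derivation κ L L} {a1 a2 N : ℕ} {v : PIdx m → L} {x : L}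
    (h : HPt D a1 a2 N v x) : ∃ p, v p ≠ 0 := by
  obtain ⟨u, x0, x1, x2, ⟨hu, hx, -⟩, rfl, -⟩ := h
  have hj : ∃ j, u j ≠ 0 := by by_contra h; push Not at h; exact hu (funext h)
  exact Phi_ne_zero a1 a2 u x1 x2 hj hx

lemma HM_unique (hres : ∀ a : V, res a = 0 ↔ V.valuation (a : M) < 1)
    (D : Fin m → Derivation κ L L) (a1 a2 N : ℕ) (a : PIdx m → M) (x x' : L)
    (h : HM K V res D a1 a2 N a x) (h' : HM K V res D a1 a2 N a x') : x = x' := by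
  obtain ⟨c, hc, w, hw, hH⟩ := h
  obtain ⟨c', hc', w', hw', hH'⟩ := h'
  have hval : ∀ (c : K) (w : PIdx m → V), (∀ p, (w p : M) = algebraMap K M c * a p) →
      (∃ p, res (w p) ≠ 0) → (∀ p, V.valuation (algebraMap K M c) * V.valuation (a p) ≤ 1) ∧
      ∃ p, V.valuation (algebraMap K M c) * V.valuation (a p) = 1 := by
    intro c w hw ⟨p, hp⟩
    refine ⟨fun p => ?_, p, ?_⟩
    · rw [← map_mul, ← hw]; exact V.valuation_le_one _
    · rw [Ne, hres, not_lt, hw, map_mul] at hp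
      refine le_antisymm ?_ hp
      rw [← map_mul, ← hw]; exact V.valuation_le_one _
  obtain ⟨b1, q1, e1⟩ := hval c w hw hH.ne_zero
  obtain ⟨b2, q2, e2⟩ := hval c' w' hw' hH'.ne_zero
  have hA : algebraMap K M c ≠ 0 := by simpa using hc
  have hA' : algebraMap K M c' ≠ 0 := by simpa using hc'
  have hle : ∀ (c c' : K), (algebraMap K M c ≠ 0) →
      (∃ p, V.valuation (algebraMap K M c) * V.valuation (a p) = 1) →
      (∀ p, V.valuation (algebraMap K M c') * V.valuation (a p) ≤ 1) →
      V.valuation (algebraMap K M c' / algebraMap K M c) ≤ 1 := by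
    intro c c' hc ⟨p, hp⟩ h
    have : a p ≠ 0 := by intro h0; rw [h0, map_zero, mul_zero] at hp; exact zero_ne_one hp
    have e : algebraMap K M c' / algebraMap K M c = (algebraMap K M c' * a p) / (algebraMap K M c * a p) := by
      field_simp
    rw [e, map_div₀, map_mul, map_mul, hp, div_one]
    exact h p
  have t1 := hle c c' hA ⟨q1, e1⟩ b2
  have t2 := hle c' c hA' ⟨q2, e2⟩ b1
  let t : V := ⟨algebraMap K M c' / algebraMap K M c, (V.valuation_le_one_iff _).1 t1⟩
  have ht0 : res t ≠ 0 := by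
    rw [Ne, hres, not_lt]
    show 1 ≤ V.valuation (algebraMap K M c' / algebraMap K M c)
    rw [map_div₀] at t2 ⊢
    rw [← inv_div]
    exact (one_le_inv₀ (by
      apply div_pos <;> rw [Valuation.pos_iff] <;> assumption)).2 t2
  refine HPt_unique D a1 a2 N _ _ (res t) x x' ht0 (fun p => ?_) hH hH'
  rw [← map_mul]
  congr 1
  apply Subtype.ext
  show (w' p : M) = algebraMap K M c' / algebraMap K M c * (w p : M)
  rw [hw, hw']
  field_simp

lemma chain_step (hm : 6 ≤ m) (D : Fin m → Derivation κ L L)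
    {a1 a2 N : ℕ} (hN : m + 1 + N = a1 + a2 + 2)
    {Gz : (Fin (m+1) → M[X]) → M[X] → M[X] → M[X] → Prop}
    (H : GRed K V κ res a1 a2 N Gz)
    (u : Fin (m+1) → M[X]) (x0 x1 x2 : M[X]) (hu : ∃ j, u j ≠ 0) (hx : x1 ≠ 0 ∨ x2 ≠ 0)
    (hG : Gz u x0 x1 x2) :
    ∃ c : K, c ≠ 0 ∧ ∃ W : ℕ → PIdx m → V,
      (∀ k p, (W k p : M) = algebraMap K M c * (Phi a1 a2 u x1 x2 p).coeff k) ∧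
      (∃ k p, res (W k p) ≠ 0) ∧
      ∀ k l, (∀ k' < k, ∀ p, res (W k' p) = 0) → (∃ p, res (W k p) ≠ 0) →
        (∀ k' > l, ∀ p, res (W k' p) = 0) → (∃ p, res (W l p) ≠ 0) →
        ∃ x, HPt D a1 a2 N (fun p => res (W k p)) x ∧ HPt D a1 a2 N (fun p => res (W l p)) x := by
  obtain ⟨c1, hc1, U, hU, hU0⟩ := norm_poly V res H.hres H.hunit u hu
  have hA : algebraMap K M c1 ≠ 0 := by simpa using hc1
  set A := algebraMap K M c1 with hAdef
  have hCA : ∀ n : ℕ, (C A)^n * C (A⁻¹ ^ n) = 1 := by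
    intro n
    rw [← C_pow, ← C_mul, ← mul_pow, mul_inv_cancel₀ hA, one_pow, C_1]
  have hG1 : Gz (fun j => C A * u j) x0 (C (A⁻¹ ^ (a1+1)) * x1) (C (A⁻¹ ^ (a2+1)) * x2) := by
    apply H.smul_u
    rw [← mul_assoc, ← mul_assoc, hCA, hCA, one_mul, one_mul]
    exact hG
  have hPhi1 : Phi a1 a2 (fun j => C A * u j) (C (A⁻¹ ^ (a1+1)) * x1) (C (A⁻¹ ^ (a2+1)) * x2) =
      Phi a1 a2 u x1 x2 := by
    rw [Phi_smul, ← mul_assoc, ← mul_assoc, hCA, hCA, one_mul, one_mul]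
  have hne : ∀ n : ℕ, C (A⁻¹ ^ n) ≠ 0 := fun n => by
    rw [Ne, C_eq_zero]; exact pow_ne_zero _ (inv_ne_zero hA)
  generalize hy1 : C (A⁻¹ ^ (a1+1)) * x1 = y1 at hG1 hPhi1
  generalize hy2 : C (A⁻¹ ^ (a2+1)) * x2 = y2 at hG1 hPhi1
  have hyy : y1 ≠ 0 ∨ y2 ≠ 0 := by
    rcases hx with h | h
    · left; rw [← hy1]; exact mul_ne_zero (hne _) h
    · right; rw [← hy2]; exact mul_ne_zero (hne _) h
  obtain ⟨c2, hc2, Y, hY, hY0⟩ := norm_poly V res H.hres H.hunit ![y1, y2] (by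
    rcases hyy with h | h
    · exact ⟨0, h⟩
    · exact ⟨1, h⟩)
  have hB : algebraMap K M c2 ≠ 0 := by simpa using hc2
  set B := algebraMap K M c2 with hBdef
  have hG2 := H.smul_x B _ _ _ _ hG1
  have hY1 : (Y 0).map V.subtype = C B * y1 := hY 0
  have hY2 : (Y 1).map V.subtype = C B * y2 := hY 1
  have hUf : (fun j => C A * u j) = fun j => (U j).map V.subtype := funext fun j => (hU j).symm
  rw [hUf, ← hY1, ← hY2] at hG2

  obtain ⟨Z, hZ⟩ : ∃ Z : V[X], Z.map V.subtype = C B * x0 := by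
    by_cases h0 : x0 = 0
    · exact ⟨0, by simp [h0]⟩
    obtain ⟨c3, hc3, P, hP, hP0⟩ := norm_poly V res H.hres H.hunit (fun _ : Unit => C B * x0)
      ⟨(), mul_ne_zero (by simpa using hB) h0⟩
    have hE : algebraMap K M c3 ≠ 0 := by simpa using hc3
    have hP := hP ()
    have hP0 : (P ()).map res ≠ 0 := by obtain ⟨⟨⟩, h⟩ := hP0; exact h
    generalize P () = P at hP hP0
    by_cases hv : V.valuation (algebraMap K M c3) < 1
    · exfalso
      let e : V := ⟨algebraMap K M c3, (V.valuation_le_one_iff _).1 hv.le⟩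
      have he : res e = 0 := (H.hres e).2 hv
      have hG3 := H.smul_x (algebraMap K M c3) _ _ _ _ hG2
      have e1 : C (algebraMap K M c3) * (Y 0).map V.subtype = (C e * Y 0).map V.subtype := by
        rw [Polynomial.map_mul, map_C]; rfl
      have e2 : C (algebraMap K M c3) * (Y 1).map V.subtype = (C e * Y 1).map V.subtype := by
        rw [Polynomial.map_mul, map_C]; rfl
      rw [← hP, e1, e2] at hG3
      have := H.red U P _ _ hG3
      rw [Polynomial.map_mul, Polynomial.map_mul, map_C, he, C_0, zero_mul, zero_mul] at this
      simp only [G0] at this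
      have h4 : (P.map res) ^ 2 = 0 := by linear_combination this
      exact hP0 (pow_eq_zero_iff two_ne_zero |>.1 h4)
    · have : V.valuation (algebraMap K M c3)⁻¹ ≤ 1 := by
        rw [map_inv₀]
        push Not at hv
        exact inv_le_one_of_one_le₀ hv
      refine ⟨C (⟨_, (V.valuation_le_one_iff _).1 this⟩ : V) * P, ?_⟩
      rw [Polynomial.map_mul, map_C, hP, ← mul_assoc]
      show C (algebraMap K M c3)⁻¹ * C (algebraMap K M c3) * _ = _
      rw [← C_mul, inv_mul_cancel₀ hE, C_1, one_mul]
  rw [← hZ] at hG2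
  have hGr := H.red U Z _ _ hG2
  have hVP : VPt κ a1 a2 N (fun j => (U j).map res) (Z.map res) ((Y 0).map res) ((Y 1).map res) := by
    refine ⟨?_, ?_, hGr⟩
    · obtain ⟨j, hj⟩ := hU0
      intro h; exact hj (congrFun h j)
    · obtain ⟨i, hi⟩ := hY0
      fin_cases i
      · exact Or.inl hi
      · exact Or.inr hi
  have hmapS : ∀ p, (Phi a1 a2 U (Y 0) (Y 1) p).map V.subtype = C B * Phi a1 a2 u x1 x2 p := by
    intro p
    have := Phi_map (mapRingHom V.subtype) a1 a2 U (Y 0) (Y 1) p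
    simp only [coe_mapRingHom] at this
    rw [this, hY1, hY2, ← hUf, Phi_smul_x, hPhi1]
  have hmapR : ∀ p k, res ((Phi a1 a2 U (Y 0) (Y 1) p).coeff k) =
      (Phi a1 a2 (fun j => (U j).map res) ((Y 0).map res) ((Y 1).map res) p).coeff k := by
    intro p k
    have := Phi_map (mapRingHom res) a1 a2 U (Y 0) (Y 1) p
    simp only [coe_mapRingHom] at this
    rw [← this, coeff_map]
  refine ⟨c2, hc2, fun k p => (Phi a1 a2 U (Y 0) (Y 1) p).coeff k, ?_, ?_, ?_⟩
  · intro k p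
    have := congrArg (fun q => coeff q k) (hmapS p)
    simpa using this
  · have hj : ∃ j, (U j).map res ≠ 0 := hU0
    obtain ⟨p, hp⟩ := Phi_ne_zero a1 a2 _ _ _ hj hVP.2.1
    obtain ⟨k, hk⟩ : ∃ k, (Phi a1 a2 (fun j => (U j).map res) ((Y 0).map res) ((Y 1).map res) p).coeff k ≠ 0 := by
      by_contra h'; push Not at h'; exact hp (Polynomial.ext (by simpa using h'))
    exact ⟨k, p, by rw [hmapR]; exact hk⟩
  · intro k l h1 h2 h3 h4
    simp only [hmapR] at h1 h2 h3 h4 ⊢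
    exact edge_lemma hm D hN _ _ _ _ hVP k h1 h2 l h3 h4

end Chain
end ConicBundleFormalization

namespace ConicBundleFormalization
open Polynomial

section Chain
variable {K : Type*} [Field K] [IsAlgClosed K] {M : Type*} [Field M] [Algebra K M]
  (V : ValuationSubring M)
  {κ : Type*} [Field κ] [IsAlgClosed κ] [CharP κ 2] {L : Type*} [Field L] [Algebra κ L] {m : ℕ}
  (res : V →+* L)

lemma chain_lemma (hm : 6 ≤ m) (D : Fin m → Derivation κ L L)
    {a1 a2 N : ℕ} (hN : m + 1 + N = a1 + a2 + 2)
    {Gz : (Fin (m+1) → M[X]) → M[X] → M[X] → M[X] → Prop}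
    (H : GRed K V κ res a1 a2 N Gz)
    (u : Fin (m+1) → M[X]) (x0 x1 x2 : M[X]) (hu : ∃ j, u j ≠ 0) (hx : x1 ≠ 0 ∨ x2 ≠ 0)
    (hG : Gz u x0 x1 x2) (kb kt : ℕ)
    (hkb : ∃ p, (Phi a1 a2 u x1 x2 p).coeff kb ≠ 0) (hkt : ∃ p, (Phi a1 a2 u x1 x2 p).coeff kt ≠ 0)
    (hbot : ∀ i < kb, ∀ p, (Phi a1 a2 u x1 x2 p).coeff i = 0)
    (htop : ∀ i > kt, ∀ p, (Phi a1 a2 u x1 x2 p).coeff i = 0) :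
    ∃ x, HM K V res D a1 a2 N (fun p => (Phi a1 a2 u x1 x2 p).coeff kb) x ∧
      HM K V res D a1 a2 N (fun p => (Phi a1 a2 u x1 x2 p).coeff kt) x := by
  classical
  have hγ : ∀ k, ∃ γ : K, ((∀ p, (Phi a1 a2 u x1 x2 p).coeff k = 0) → γ = 0) ∧
      (γ = 0 → (∀ p, (Phi a1 a2 u x1 x2 p).coeff k = 0)) ∧
      (∀ p, V.valuation ((Phi a1 a2 u x1 x2 p).coeff k) ≤ V.valuation (algebraMap K M γ)) ∧
      ∃ p, V.valuation ((Phi a1 a2 u x1 x2 p).coeff k) = V.valuation (algebraMap K M γ) := by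
    intro k
    by_cases h : ∀ p, (Phi a1 a2 u x1 x2 p).coeff k = 0
    · refine ⟨0, fun _ => rfl, fun _ => h, fun p => by rw [h]; simp, (0, 0, 0), by rw [h]; simp⟩
    · obtain ⟨c, hc, h1, p, -, h2⟩ := norm_fin V H.hunit (Finset.univ : Finset (PIdx m))
        (fun p => (Phi a1 a2 u x1 x2 p).coeff k) (by push Not at h; simpa using h)
      have hc' : algebraMap K M c ≠ 0 := by simpa using hc
      have hpos : 0 < V.valuation (algebraMap K M c) := (Valuation.pos_iff _).2 hc'
      refine ⟨c⁻¹, fun h' => absurd h' h, fun h' => absurd h' (inv_ne_zero hc), fun p => ?_, p, ?_⟩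
      · have := h1 p (Finset.mem_univ p)
        rw [map_mul] at this
        rw [map_inv₀, map_inv₀, ← one_div, le_div_iff₀ hpos, mul_comm]
        exact this
      · rw [map_mul] at h2
        rw [map_inv₀, map_inv₀]
        exact eq_inv_of_mul_eq_one_right h2
  choose γ hγ0 hγ1 hγ2 hγ3 using hγ
  let val : Valuation K V.ValueGroup := V.valuation.comap (algebraMap K M)
  have hval : ∀ a, val a = V.valuation (algebraMap K M a) := fun a => rfl
  refine newton val γ (fun k l => ∃ x, HM K V res D a1 a2 N (fun p => (Phi a1 a2 u x1 x2 p).coeff k) x ∧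
      HM K V res D a1 a2 N (fun p => (Phi a1 a2 u x1 x2 p).coeff l) x) ?_ ?_ kb kt ?_ ?_ ?_ ?_
  · rintro a b c ⟨x, h1, h2⟩ ⟨y, h3, h4⟩
    rw [HM_unique V res H.hres D a1 a2 N _ y x h3 h2] at h4
    exact ⟨x, h1, h4⟩
  · intro ρ hρ k l hk hl hkl hmax hleq hlow hhigh
    have hρM : algebraMap K M ρ ≠ 0 := by simpa using hρ
    have hq : (C (algebraMap K M ρ) * X : M[X]) ≠ 0 := by simp [hρM]
    have hcomp : ∀ f : M[X], f ≠ 0 → f.comp (C (algebraMap K M ρ) * X) ≠ 0 := by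
      intro f hf h0
      apply hf
      ext i
      have := congrArg (fun g => coeff g i) h0
      simp only [comp_C_mul_X_coeff, coeff_zero] at this
      simpa using (mul_eq_zero.1 this).resolve_right (pow_ne_zero _ hρM)
    obtain ⟨c, hc, W, hW1, ⟨k1, p1, hkp⟩, hW3⟩ := chain_step V res hm D hN H
      (fun j => (u j).comp (C (algebraMap K M ρ) * X)) (x0.comp (C (algebraMap K M ρ) * X))
      (x1.comp (C (algebraMap K M ρ) * X)) (x2.comp (C (algebraMap K M ρ) * X))
      (by obtain ⟨j, hj⟩ := hu; exact ⟨j, hcomp _ hj⟩)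
      (hx.imp (hcomp _) (hcomp _)) (H.comp _ _ _ _ _ hG)
    have hcoef : ∀ k p, (W k p : M) = algebraMap K M c * ((Phi a1 a2 u x1 x2 p).coeff k *
        algebraMap K M ρ ^ k) := by
      intro k p
      rw [hW1]
      have := Phi_map (compRingHom (C (algebraMap K M ρ) * X)) a1 a2 u x1 x2 p
      simp only [coe_compRingHom_apply] at this
      rw [← this, comp_C_mul_X_coeff]

    have hWv : ∀ k p, V.valuation (W k p : M) ≤ val c * val (γ k * ρ ^ k) := by
      intro k p
      rw [hcoef, map_mul, map_mul, hval, hval, map_mul, map_mul, map_pow, map_pow, map_pow]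
      exact mul_le_mul_right (mul_le_mul_left (hγ2 k p) _) _
    have hWv2 : ∀ k, ∃ p, V.valuation (W k p : M) = val c * val (γ k * ρ ^ k) := by
      intro k
      obtain ⟨p, hp⟩ := hγ3 k
      refine ⟨p, ?_⟩
      rw [hcoef, map_mul, map_mul, hval, hval, map_mul, map_mul, map_pow, map_pow, map_pow, hp]
    have hone : val c * val (γ k * ρ ^ k) = 1 := by
      apply le_antisymm
      · obtain ⟨p, hp⟩ := hWv2 k
        rw [← hp]; exact V.valuation_le_one _
      · rw [Ne, H.hres, not_lt] at hkp
        exact hkp.trans ((hWv k1 p1).trans (mul_le_mul_right (hmax k1) _))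
    have hcpos : 0 < val c := by
      rw [hval, Valuation.pos_iff]; simpa using hc
    have hsmall : ∀ i, val (γ i * ρ ^ i) < val (γ k * ρ ^ k) → ∀ p, res (W i p) = 0 := by
      intro i hi p
      rw [H.hres]
      refine (hWv i p).trans_lt ?_
      rw [← hone]
      exact mul_lt_mul_of_pos_left hi hcpos
    obtain ⟨x, hx1, hx2⟩ := hW3 k l (fun i hi => hsmall i (hlow i hi)) (by
        obtain ⟨p, hp⟩ := hWv2 k
        refine ⟨p, ?_⟩
        rw [Ne, H.hres, hp, hone]; simp) (fun i hi => hsmall i (hhigh i hi)) (by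
        obtain ⟨p, hp⟩ := hWv2 l
        refine ⟨p, ?_⟩
        rw [Ne, H.hres, hp, hleq, hone]; simp)
    refine ⟨x, ⟨c * ρ ^ k, mul_ne_zero hc (pow_ne_zero _ hρ), W k, ?_, hx1⟩,
      ⟨c * ρ ^ l, mul_ne_zero hc (pow_ne_zero _ hρ), W l, ?_, hx2⟩⟩
    · intro p; rw [hcoef, map_mul, map_pow]; ring
    · intro p; rw [hcoef, map_mul, map_pow]; ring
  · intro h; obtain ⟨p, hp⟩ := hkb; exact hp (hγ1 _ h p)
  · intro h; obtain ⟨p, hp⟩ := hkt; exact hp (hγ1 _ h p)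
  · intro i hi; exact hγ0 i (hbot i hi)
  · intro i hi; exact hγ0 i (htop i hi)

lemma curve_lemma (hm : 6 ≤ m) (D : Fin m → Derivation κ L L)
    {a1 a2 N : ℕ} (hN : m + 1 + N = a1 + a2 + 2)
    {Gz : (Fin (m+1) → M[X]) → M[X] → M[X] → M[X] → Prop}
    (H : GRed K V κ res a1 a2 N Gz)
    (u : Fin (m+1) → M[X]) (x0 x1 x2 : M[X])
    (hG : Gz u x0 x1 x2)
    (hu0 : ∃ j, (u j).eval 0 ≠ 0) (hx0 : x1.eval 0 ≠ 0 ∨ x2.eval 0 ≠ 0)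
    (hu1 : ∃ j, (u j).eval 1 ≠ 0) (hx1 : x1.eval 1 ≠ 0 ∨ x2.eval 1 ≠ 0) :
    ∃ x, HM K V res D a1 a2 N (Phi a1 a2 (fun j => (u j).eval 0) (x1.eval 0) (x2.eval 0)) x ∧
      HM K V res D a1 a2 N (Phi a1 a2 (fun j => (u j).eval 1) (x1.eval 1) (x2.eval 1)) x := by
  have hev : ∀ (c : M) p, (Phi a1 a2 u x1 x2 p).eval c =
      Phi a1 a2 (fun j => (u j).eval c) (x1.eval c) (x2.eval c) p := fun c p =>
    Phi_map (evalRingHom c) a1 a2 u x1 x2 p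
  obtain ⟨p0, hp0⟩ := Phi_ne_zero a1 a2 _ _ _ hu0 hx0
  obtain ⟨p1, hp1⟩ := Phi_ne_zero a1 a2 _ _ _ hu1 hx1
  rw [← hev] at hp0 hp1

  have hcomp : ∀ (u : Fin (m+1) → M[X]) (x1 x2 : M[X]) p (q : M[X]),
      (Phi a1 a2 u x1 x2 p).comp q = Phi a1 a2 (fun j => (u j).comp q) (x1.comp q) (x2.comp q) p :=
    fun u x1 x2 p q => Phi_map (compRingHom q) a1 a2 u x1 x2 p
  let q : M[X] := X + C 1
  have hq : ∀ f : M[X], (f.comp q).natDegree = f.natDegree := by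
    intro f; rw [natDegree_comp, natDegree_X_add_C, mul_one]
  obtain ⟨pm, -, hpm⟩ := (Finset.univ : Finset (PIdx m)).exists_max_image
    (fun p => (Phi a1 a2 u x1 x2 p).natDegree) ⟨p0, Finset.mem_univ _⟩
  have hpm : ∀ p, (Phi a1 a2 u x1 x2 p).natDegree ≤ (Phi a1 a2 u x1 x2 pm).natDegree :=
    fun p => hpm p (Finset.mem_univ _)

  obtain ⟨pt, hpt0, hpt⟩ : ∃ pt, Phi a1 a2 u x1 x2 pt ≠ 0 ∧ ∀ p, (Phi a1 a2 u x1 x2 p).natDegree ≤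
      (Phi a1 a2 u x1 x2 pt).natDegree := by
    by_cases h : Phi a1 a2 u x1 x2 pm = 0
    · refine ⟨p0, fun h' => hp0 (by rw [h']; simp), fun p => ?_⟩
      have := hpm p
      rw [h] at this
      simp at this
      omega
    · exact ⟨pm, h, hpm⟩
  set T := (Phi a1 a2 u x1 x2 pt).natDegree with hT
  have hne : ∀ (f : M[X]) (c : M), f.eval c ≠ 0 → f ≠ 0 := by
    rintro f c h rfl; simp at h
  have h1 := chain_lemma V res hm D hN H u x0 x1 x2 (by obtain ⟨j, hj⟩ := hu0; exact ⟨j, hne _ _ hj⟩)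
    (hx0.imp (hne _ _) (hne _ _)) hG 0 T ⟨p0, by rwa [coeff_zero_eq_eval_zero]⟩
    ⟨pt, by rw [hT]; simpa using hpt0⟩ (by intro i hi; omega)
    (fun i hi p => coeff_eq_zero_of_natDegree_lt ((hpt p).trans_lt hi))
  have hq0 : ∀ f : M[X], (f.comp q).coeff 0 = f.eval 1 := by
    intro f; rw [coeff_zero_eq_eval_zero, eval_comp]; simp [q]
  have hqT : ∀ f : M[X], f.natDegree ≤ T → (f.comp q).coeff T = f.coeff T := by
    intro f hf
    rcases hf.eq_or_lt with h | h
    · rw [← h]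
      have e : (f.comp q).coeff f.natDegree = (f.comp q).leadingCoeff := by
        rw [leadingCoeff, hq]
      rw [e, leadingCoeff_comp (by rw [natDegree_X_add_C]; exact one_ne_zero), show q.leadingCoeff = 1 from leadingCoeff_X_add_C 1, one_pow, mul_one]
      rfl
    · rw [coeff_eq_zero_of_natDegree_lt h, coeff_eq_zero_of_natDegree_lt (by rwa [hq])]
  have hqne : ∀ f : M[X], f.eval 1 ≠ 0 → f.comp q ≠ 0 := by
    intro f hf h
    rw [← hq0, h] at hf; simp at hf
  have h2 := chain_lemma V res hm D hN H (fun j => (u j).comp q) (x0.comp q) (x1.comp q) (x2.comp q)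
    (by obtain ⟨j, hj⟩ := hu1; exact ⟨j, hqne _ hj⟩)
    (hx1.imp (hqne _) (hqne _)) (H.comp _ _ _ _ _ hG) 0 T
    ⟨p1, by rw [← hcomp, hq0]; exact hp1⟩
    ⟨pt, by rw [← hcomp, hqT _ le_rfl, hT]; simpa using hpt0⟩ (by intro i hi; omega)
    (fun i hi p => by
      rw [← hcomp]
      exact coeff_eq_zero_of_natDegree_lt (by rw [hq]; exact (hpt p).trans_lt hi))
  obtain ⟨x, h3, h4⟩ := h1
  obtain ⟨y, h5, h6⟩ := h2
  simp only [← hcomp, hq0, hqT _ (hpt _)] at h5 h6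
  rw [HM_unique V res H.hres D a1 a2 N _ y x h6 h4] at h5
  simp only [coeff_zero_eq_eval_zero, hev] at h3 h5
  exact ⟨x, h3, h5⟩

end Chain
end ConicBundleFormalization

namespace ConicBundleFormalization

section Place
variable {B M L : Type*} [CommRing B] [Field M] [Field L] (ψ : B →+* M) (θ : B →+* L)

def placeGraph (h1 : ∀ b, ψ b = 0 → θ b = 0) : Subring (M × L) where
  carrier := {x | ∃ P Q, θ Q ≠ 0 ∧ x.1 * ψ Q = ψ P ∧ x.2 * θ Q = θ P}
  mul_mem' := by
    rintro x y ⟨P, Q, h, e1, e2⟩ ⟨P', Q', h', e1', e2'⟩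
    refine ⟨P * P', Q * Q', by rw [map_mul]; exact mul_ne_zero h h', ?_, ?_⟩
    · rw [map_mul, map_mul, ← e1, ← e1', Prod.fst_mul]; ring
    · rw [map_mul, map_mul, ← e2, ← e2', Prod.snd_mul]; ring
  one_mem' := ⟨1, 1, by simp, by simp, by simp⟩
  add_mem' := by
    rintro x y ⟨P, Q, h, e1, e2⟩ ⟨P', Q', h', e1', e2'⟩
    refine ⟨P * Q' + P' * Q, Q * Q', by rw [map_mul]; exact mul_ne_zero h h', ?_, ?_⟩
    · rw [map_mul, map_add, map_mul, map_mul, ← e1, ← e1', Prod.fst_add]; ring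
    · rw [map_mul, map_add, map_mul, map_mul, ← e2, ← e2', Prod.snd_add]; ring
  zero_mem' := ⟨0, 1, by simp, by simp, by simp⟩
  neg_mem' := by
    rintro x ⟨P, Q, h, e1, e2⟩
    refine ⟨-P, Q, h, ?_, ?_⟩
    · rw [map_neg, ← e1, Prod.fst_neg]; ring
    · rw [map_neg, ← e2, Prod.snd_neg]; ring

lemma exists_place (h1 : ∀ b, ψ b = 0 → θ b = 0)
    (h2 : ∀ a : M, a ≠ 0 → ∃ P Q o, θ P ≠ 0 ∧ θ Q ≠ 0 ∧
      (a * ψ Q = ψ (o * P) ∨ a * ψ (o * Q) = ψ P)) :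
    ∃ (V : ValuationSubring M) (res : V →+* L),
      (∀ b, ∃ hb : ψ b ∈ V, res ⟨ψ b, hb⟩ = θ b) ∧
      (∀ P Q a, θ Q ≠ 0 → a * ψ Q = ψ P → ∃ ha : a ∈ V, res ⟨a, ha⟩ * θ Q = θ P) ∧
      (∀ a : V, res a = 0 ↔ V.valuation (a : M) < 1) := by
  classical
  let Γ := placeGraph ψ θ h1
  have hψ : ∀ b, θ b ≠ 0 → ψ b ≠ 0 := fun b h h' => h (h1 b h')
  have huniq : ∀ a l l', (a, l) ∈ Γ → (a, l') ∈ Γ → l = l' := by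
    rintro a l l' ⟨P, Q, h, e1, e2⟩ ⟨P', Q', h', e1', e2'⟩
    simp only at e1 e2 e1' e2'
    have : ψ (P * Q' - P' * Q) = 0 := by
      rw [map_sub, map_mul, map_mul, ← e1, ← e1']; ring
    have := h1 _ this
    rw [map_sub, map_mul, map_mul, ← e2, ← e2'] at this
    have h3 : (l - l') * (θ Q * θ Q') = 0 := by linear_combination this
    exact sub_eq_zero.1 ((mul_eq_zero.1 h3).resolve_right (mul_ne_zero h h'))
  let S : Subring M := Γ.map (RingHom.fst M L)
  have hS : ∀ a, a ∈ S ↔ ∃ l, (a, l) ∈ Γ := by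
    intro a
    simp [S, Subring.mem_map]
  let V : ValuationSubring M := { S with
    mem_or_inv_mem' := by
      intro a
      by_cases ha : a = 0
      · left; rw [ha]; exact S.zero_mem
      obtain ⟨P, Q, o, hP, hQ, h | h⟩ := h2 a ha
      · left
        refine (hS _).2 ⟨θ (o * P) / θ Q, o * P, Q, hQ, h, ?_⟩
        simp [hQ]
      · right
        refine (hS _).2 ⟨θ (o * Q) / θ P, o * Q, P, hP, ?_, by simp [hP]⟩
        simp only
        rw [← h]; field_simp }
  have hV : ∀ a, a ∈ V ↔ ∃ l, (a, l) ∈ Γ := hS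
  have hr : ∀ a : V, ∃ l, ((a : M), l) ∈ Γ := fun a => (hV a).1 a.2
  choose r hr using hr
  let res : V →+* L :=
    { toFun := r
      map_one' := huniq _ _ _ (hr 1) Γ.one_mem
      map_zero' := huniq _ _ _ (hr 0) Γ.zero_mem
      map_add' := fun a b => huniq _ _ _ (hr (a + b)) (Γ.add_mem (hr a) (hr b))
      map_mul' := fun a b => huniq _ _ _ (hr (a * b)) (Γ.mul_mem (hr a) (hr b)) }
  have hres : ∀ (a : V) l, ((a : M), l) ∈ Γ → res a = l := fun a l h => huniq _ _ _ (hr a) h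
  have hPQ : ∀ P Q a, θ Q ≠ 0 → a * ψ Q = ψ P → ∃ ha : a ∈ V, res ⟨a, ha⟩ * θ Q = θ P := by
    intro P Q a hQ h
    have hm : (a, θ P / θ Q) ∈ Γ := ⟨P, Q, hQ, h, by simp [hQ]⟩
    refine ⟨(hV a).2 ⟨_, hm⟩, ?_⟩
    rw [hres ⟨a, _⟩ _ hm]; field_simp
  refine ⟨V, res, ?_, hPQ, ?_⟩
  · intro b
    obtain ⟨hb, h⟩ := hPQ b 1 (ψ b) (by simp) (by simp)
    exact ⟨hb, by simpa using h⟩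
  · intro a
    rw [← ValuationSubring.valuation_lt_one_iff, IsLocalRing.mem_maximalIdeal, mem_nonunits_iff]
    constructor
    · intro h hu
      exact (hu.map res).ne_zero h
    · intro h
      by_contra h0
      apply h
      obtain ⟨P, Q, hQ, e1, e2⟩ := hr a
      simp only at e1 e2
      have hP : θ P ≠ 0 := by rw [← e2]; exact mul_ne_zero h0 hQ
      have ha0 : (a : M) ≠ 0 := by
        intro h'; rw [h', zero_mul] at e1; exact hψ P hP e1.symm
      obtain ⟨hi, -⟩ := hPQ Q P (a : M)⁻¹ hP (by rw [← e1]; field_simp)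
      exact IsUnit.of_mul_eq_one ⟨_, hi⟩ (Subtype.ext (mul_inv_cancel₀ ha0))

end Place
end ConicBundleFormalization

namespace ConicBundleFormalization
open Polynomial

section Special
universe v
variable {κ : Type v} [Field κ] [IsAlgClosed κ] [CharP κ 2] {m : ℕ}

abbrev RR (m : ℕ) (A : Type*) [CommRing A] := MvPolynomial (Fin (m+1) ⊕ Fin 2) A

noncomputable def rho (κ : Type*) [CommRing κ] (m a1 a2 N : ℕ) : RR m κ :=
  G0 κ a1 a2 N (fun j => MvPolynomial.X (Sum.inl j)) 0 (MvPolynomial.X (Sum.inr 0))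
    (MvPolynomial.X (Sum.inr 1))

lemma pderiv_inr_aeval (P : MvPolynomial (Fin (m+1)) κ) (k : Fin 2) :
    MvPolynomial.pderiv (Sum.inr k)
      (MvPolynomial.aeval (fun j => (MvPolynomial.X (Sum.inl j) : RR m κ)) P) = 0 := by
  induction P using MvPolynomial.induction_on with
  | C a => simp
  | add p q hp hq => rw [map_add, map_add, hp, hq, add_zero]
  | mul_X p i hp =>
    rw [map_mul, Derivation.leibniz, hp, MvPolynomial.aeval_X, MvPolynomial.pderiv_X_of_ne (by simp)]
    simp

noncomputable def polar (κ : Type*) [CommRing κ] (m N : ℕ) : RR m κ :=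
  MvPolynomial.aeval (fun j => (MvPolynomial.X (Sum.inl j) : RR m κ)) (FF κ m N) *
    MvPolynomial.X (Sum.inr 0)

lemma pderiv_rho (a1 a2 N : ℕ) :
    MvPolynomial.pderiv (Sum.inr 1) (rho κ m a1 a2 N) = polar κ m N := by
  have h2 : (2 : RR m κ) = 0 := by
    have := CharP.cast_eq_zero (RR m κ) 2
    exact_mod_cast this
  unfold rho G0 polar
  simp only [map_add, Derivation.leibniz, pderiv_inr_aeval, Derivation.leibniz_pow,
    MvPolynomial.pderiv_X_self, MvPolynomial.pderiv_X_of_ne (show (Sum.inr 0 : Fin (m+1) ⊕ Fin 2) ≠ Sum.inr 1 by simp)]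
  simp [h2]

lemma polar_ne (N : ℕ) : polar κ m N ≠ 0 := by
  unfold polar FF
  simp [Finset.prod_eq_zero_iff, MvPolynomial.X_ne_zero]

lemma prime_g0 (a1 a2 N : ℕ) : Prime (X ^ 2 + C (rho κ m a1 a2 N) : (RR m κ)[X]) := by
  apply Irreducible.prime
  have hm : (X ^ 2 + C (rho κ m a1 a2 N) : (RR m κ)[X]).Monic := monic_X_pow_add_C _ two_ne_zero
  have hd : (X ^ 2 + C (rho κ m a1 a2 N) : (RR m κ)[X]).natDegree = 2 := natDegree_X_pow_add_C
  rw [hm.irreducible_iff_roots_eq_zero_of_degree_le_three (by rw [hd]) (by rw [hd]; norm_num)]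
  rw [Multiset.eq_zero_iff_forall_notMem]
  intro s hs
  rw [mem_roots hm.ne_zero, IsRoot.def] at hs
  simp only [eval_add, eval_pow, eval_X, eval_C] at hs
  have h2 : (2 : RR m κ) = 0 := by
    have := CharP.cast_eq_zero (RR m κ) 2
    exact_mod_cast this
  have := congrArg (MvPolynomial.pderiv (Sum.inr 1)) hs
  rw [map_add, pderiv_rho, Derivation.leibniz_pow, map_zero] at this
  simp [h2] at this
  exact polar_ne N this

lemma exists_special (a1 a2 N : ℕ) : ∃ (L : Type v) (_ : Field L) (_ : Algebra κ L)
    (Θ : (RR m κ)[X] →ₐ[κ] L) (D : Fin m → Derivation κ L L),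
    (∀ p, Θ p = 0 ↔ (X ^ 2 + C (rho κ m a1 a2 N) : (RR m κ)[X]) ∣ p) ∧
    hW D (fun j => Θ (C (MvPolynomial.X (Sum.inl j)))) ≠ 0 := by
  classical
  set g0 : (RR m κ)[X] := X ^ 2 + C (rho κ m a1 a2 N) with hg0
  have hp : Prime g0 := prime_g0 a1 a2 N
  have hI : (Ideal.span {g0}).IsPrime := (Ideal.span_singleton_prime hp.ne_zero).2 hp
  obtain ⟨A, iA, iD, iAl, q, hq, hq0⟩ : ∃ (A : Type v) (_ : CommRing A) (_ : IsDomain A)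
      (_ : Algebra κ A) (q : (RR m κ)[X] →ₐ[κ] A), Function.Surjective q ∧ ∀ p, q p = 0 ↔ g0 ∣ p := by
    refine ⟨(RR m κ)[X] ⧸ Ideal.span {g0}, inferInstance, inferInstance, inferInstance,
      Ideal.Quotient.mkₐ κ _, Ideal.Quotient.mkₐ_surjective κ _, fun p => ?_⟩
    rw [← Ideal.mem_span_singleton]
    exact Ideal.Quotient.eq_zero_iff_mem
  let L := FractionRing A
  let Θ : (RR m κ)[X] →ₐ[κ] L := (IsScalarTower.toAlgHom κ A L).comp q
  have hΘ : ∀ p, Θ p = algebraMap A L (q p) := fun p => rfl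
  have h2 : (2 : RR m κ) = 0 := by
    have := CharP.cast_eq_zero (RR m κ) 2
    exact_mod_cast this
  let d : Fin (m+1) ⊕ Fin 2 → Derivation κ (RR m κ)[X] (RR m κ)[X] :=
    fun i => polyDer (MvPolynomial.pderiv i)
  have hdC : ∀ i c, d i (C c) = C (MvPolynomial.pderiv i c) := by
    intro i c; ext1 k; rw [coeff_polyDer, coeff_C, coeff_C]; split_ifs <;> simp
  have hdg : ∀ i, d i g0 = C (MvPolynomial.pderiv i (rho κ m a1 a2 N)) := by
    intro i
    rw [hg0, map_add, hdC, Derivation.leibniz_pow, show d i X = 0 from polyDer_X _]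
    simp
  let D1 : Fin m → Derivation κ (RR m κ)[X] (RR m κ)[X] := fun i =>
    C (polar κ m N) • d (Sum.inl i.succ) - C (MvPolynomial.pderiv (Sum.inl i.succ) (rho κ m a1 a2 N)) • d (Sum.inr 1)
  have hD1 : ∀ i p, D1 i p = C (polar κ m N) * d (Sum.inl i.succ) p
    - C (MvPolynomial.pderiv (Sum.inl i.succ) (rho κ m a1 a2 N)) * d (Sum.inr 1) p := fun i p => rfl
  have hD1g : ∀ i, D1 i g0 = 0 := by
    intro i
    rw [hD1, hdg, hdg, pderiv_rho]; ring
  have hD1X : ∀ i j, D1 i (C (MvPolynomial.X (Sum.inl j))) = if j = i.succ then C (polar κ m N) else 0 := by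
    intro i j
    rw [hD1, hdC, hdC, MvPolynomial.pderiv_X, MvPolynomial.pderiv_X]
    by_cases h : j = i.succ
    · subst h; simp
    · have : (Sum.inl j : Fin (m+1) ⊕ Fin 2) ≠ Sum.inl i.succ := by simpa using h
      simp [h]
  have hlift : ∀ i x, q x = 0 → q (D1 i x) = 0 := by
    intro i x hx
    rw [hq0] at hx ⊢
    obtain ⟨y, rfl⟩ := hx
    rw [Derivation.leibniz, hD1g]
    simp
  let D2 : Fin m → Derivation κ A A := fun i => Derivation.liftOfSurjective hq (hlift i)
  have hD2 : ∀ i x, D2 i (q x) = q (D1 i x) := fun i x => Derivation.liftOfSurjective_apply hq (hlift i) x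
  choose D hD using fun i => exists_locDer (S := L) (nonZeroDivisors A) (D2 i)
  have hDΘ : ∀ i x, D i (Θ x) = Θ (D1 i x) := by
    intro i x
    rw [hΘ, hΘ, hD, hD2]
  have hΘ0 : ∀ p, Θ p = 0 ↔ g0 ∣ p := by
    intro p
    rw [hΘ, ← hq0]
    exact (map_eq_zero_iff _ (IsFractionRing.injective A L))
  refine ⟨L, inferInstance, inferInstance, Θ, D, hΘ0, ?_⟩
  have hC : ∀ c : RR m κ, c ≠ 0 → Θ (C c) ≠ 0 := by
    intro c hc h
    rw [hΘ0] at h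
    have := natDegree_le_of_dvd h (C_ne_zero.2 hc)
    rw [natDegree_C, hg0, natDegree_X_pow_add_C] at this
    omega
  unfold hW
  apply div_ne_zero
  · have : Wr D (fun j => Θ (C (MvPolynomial.X (Sum.inl j)))) =
        Θ (C (MvPolynomial.X (Sum.inl 0))) * Θ (C (polar κ m N)) ^ m := by
      unfold Wr
      rw [Matrix.det_of_isUpperTriangular]
      · rw [Fin.prod_univ_succ]
        simp [hDΘ, hD1X]
      · intro i j hij
        refine Fin.cases ?_ (fun i => ?_) i hij
        · intro h; exact absurd h (by simp)
        · intro h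
          have : j ≠ i.succ := by rintro rfl; exact lt_irrefl _ h
          simp [hDΘ, hD1X, this]
    rw [this]
    exact mul_ne_zero (hC _ (MvPolynomial.X_ne_zero _)) (pow_ne_zero _ (hC _ (polar_ne N)))
  · rw [Finset.prod_ne_zero_iff]
    intro j _
    exact hC _ (MvPolynomial.X_ne_zero _)

end Special
end ConicBundleFormalization

namespace ConicBundleFormalization
open Polynomial

section Gev
variable {A A' B B' : Type*} [CommRing A] [CommRing A'] [CommRing B] [CommRing B'] {m : ℕ}

noncomputable def gev (f : A →+* B) (g : (RR m A)[X]) (u : Fin (m+1) → B) (x0 x1 x2 : B) : B :=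
  g.eval₂ (MvPolynomial.eval₂Hom f (Sum.elim u ![x1, x2])) x0

lemma sumElim_comp (φ : B → B') (u : Fin (m+1) → B) (x1 x2 : B) :
    (fun i => φ (Sum.elim u ![x1, x2] i)) = Sum.elim (fun j => φ (u j)) ![φ x1, φ x2] := by
  ext i
  rcases i with i | i
  · rfl
  · fin_cases i <;> rfl

lemma gev_comp (φ : B →+* B') (f : A →+* B) (g : (RR m A)[X]) (u : Fin (m+1) → B) (x0 x1 x2 : B) :
    φ (gev f g u x0 x1 x2) = gev (φ.comp f) g (fun j => φ (u j)) (φ x0) (φ x1) (φ x2) := by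
  unfold gev
  rw [hom_eval₂, MvPolynomial.comp_eval₂Hom, sumElim_comp]

lemma gev_map (h : A' →+* A) (f : A →+* B) (g : (RR m A')[X]) (u : Fin (m+1) → B) (x0 x1 x2 : B) :
    gev f (g.map (MvPolynomial.map h)) u x0 x1 x2 = gev (f.comp h) g u x0 x1 x2 := by
  unfold gev
  rw [eval₂_map]
  congr 1
  ext i
  · simp
  · simp

lemma gev_g0 [Algebra A B] (a1 a2 N : ℕ) (u : Fin (m+1) → B) (x0 x1 x2 : B) :
    gev (algebraMap A B) (X ^ 2 + C (rho A m a1 a2 N)) u x0 x1 x2 = G0 A a1 a2 N u x0 x1 x2 := by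
  unfold gev
  rw [eval₂_add, eval₂_pow, eval₂_X, eval₂_C]
  have : MvPolynomial.eval₂Hom (algebraMap A B) (Sum.elim u ![x1, x2]) (rho A m a1 a2 N)
    = MvPolynomial.aeval (Sum.elim u ![x1, x2]) (rho A m a1 a2 N) := rfl
  rw [this, rho, G0_map]
  simp [G0]
  ring
end Gev

section Norm
variable {K : Type*} [Field K] (O : ValuationSubring K) {κ : Type*} [Field κ] (r : O →+* κ)

lemma norm_mv (hr : ∀ a : O, r a = 0 ↔ O.valuation (a : K) < 1)
    {σ : Type*} (a b : MvPolynomial σ K) (h : a ≠ 0 ∨ b ≠ 0) :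
    ∃ c : K, c ≠ 0 ∧ ∃ A B : MvPolynomial σ O,
      MvPolynomial.map O.subtype A = MvPolynomial.C c * a ∧
      MvPolynomial.map O.subtype B = MvPolynomial.C c * b ∧
      (MvPolynomial.map r A ≠ 0 ∨ MvPolynomial.map r B ≠ 0) := by
  classical
  have hS : ∃ x ∈ a.support.image a.coeff ∪ b.support.image b.coeff, x ≠ 0 := by
    rcases h with h | h
    · obtain ⟨e, he⟩ := MvPolynomial.ne_zero_iff.1 h
      exact ⟨_, Finset.mem_union_left _ (Finset.mem_image_of_mem _ (MvPolynomial.mem_support_iff.2 he)), he⟩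
    · obtain ⟨e, he⟩ := MvPolynomial.ne_zero_iff.1 h
      exact ⟨_, Finset.mem_union_right _ (Finset.mem_image_of_mem _ (MvPolynomial.mem_support_iff.2 he)), he⟩
  obtain ⟨x, hx, hx0⟩ := hS
  obtain ⟨v, hv, hmax⟩ := Finset.exists_max_image _ (fun y => O.valuation y) ⟨x, hx⟩
  have hv0 : v ≠ 0 := by
    rintro rfl
    have := hmax x hx
    rw [map_zero, nonpos_iff_eq_zero, map_eq_zero] at this
    exact hx0 this
  have hle : ∀ y ∈ a.support.image a.coeff ∪ b.support.image b.coeff, v⁻¹ * y ∈ O := by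
    intro y hy
    rw [← ValuationSubring.valuation_le_one_iff, map_mul, map_inv₀]
    have h1 : O.valuation v ≠ 0 := by rwa [Ne, map_eq_zero]
    exact inv_mul_le_one_of_le₀ (hmax y hy) zero_le
  have hlift : ∀ p : MvPolynomial σ K, (∀ e, p.coeff e ≠ 0 → v⁻¹ * p.coeff e ∈ O) →
      ∃ P : MvPolynomial σ O, MvPolynomial.map O.subtype P = MvPolynomial.C v⁻¹ * p := by
    intro p hp
    have : MvPolynomial.C v⁻¹ * p ∈ Set.range (MvPolynomial.map (σ := σ) O.subtype) := by
      rw [MvPolynomial.mem_range_map_iff_coeffs_subset]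
      intro z hz
      simp only [MvPolynomial.coeffs, Finset.coe_image, Set.mem_image] at hz
      obtain ⟨e, he, rfl⟩ := hz
      rw [MvPolynomial.coeff_C_mul]
      refine ⟨⟨_, hp e ?_⟩, rfl⟩
      intro h0
      rw [SetLike.mem_coe, MvPolynomial.mem_support_iff, MvPolynomial.coeff_C_mul, h0, mul_zero] at he
      exact he rfl
    exact this
  obtain ⟨A, hA⟩ := hlift a (fun e he => hle _ (Finset.mem_union_left _ (Finset.mem_image_of_mem _ (MvPolynomial.mem_support_iff.2 he))))
  obtain ⟨B, hB⟩ := hlift b (fun e he => hle _ (Finset.mem_union_right _ (Finset.mem_image_of_mem _ (MvPolynomial.mem_support_iff.2 he))))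
  refine ⟨v⁻¹, inv_ne_zero hv0, A, B, hA, hB, ?_⟩
  have key : ∀ (p : MvPolynomial σ K) (P : MvPolynomial σ O), MvPolynomial.map O.subtype P = MvPolynomial.C v⁻¹ * p →
      v ∈ p.support.image p.coeff → MvPolynomial.map r P ≠ 0 := by
    intro p P hP hvp h0
    obtain ⟨e, -, he⟩ := Finset.mem_image.1 hvp
    have h1 := congrArg (MvPolynomial.coeff e) hP
    have h2 := congrArg (MvPolynomial.coeff e) h0
    rw [MvPolynomial.coeff_map, MvPolynomial.coeff_C_mul, he, inv_mul_cancel₀ hv0] at h1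
    rw [MvPolynomial.coeff_map, MvPolynomial.coeff_zero, hr] at h2
    have h3 : ((P.coeff e : O) : K) = 1 := h1
    rw [h3, map_one] at h2
    exact lt_irrefl _ h2
  rcases Finset.mem_union.1 hv with h | h
  · exact Or.inl (key a A hA h)
  · exact Or.inr (key b B hB h)

variable {m : ℕ}
lemma claimC (hr : ∀ a : O, r a = 0 ↔ O.valuation (a : K) < 1)
    (gO : (RR m O)[X]) (hm : gO.Monic) (hd : gO.natDegree = 2) (p : (RR m K)[X])
    (hp : ¬ gO.map (MvPolynomial.map O.subtype) ∣ p) :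
    ∃ c : K, c ≠ 0 ∧ ∃ P : (RR m O)[X],
      gO.map (MvPolynomial.map O.subtype) ∣ C (MvPolynomial.C c) * p - P.map (MvPolynomial.map O.subtype) ∧
      ¬ gO.map (MvPolynomial.map r) ∣ P.map (MvPolynomial.map r) := by
  set gK := gO.map (MvPolynomial.map O.subtype) with hgK
  have hmK : gK.Monic := hm.map _
  have hdK : gK.natDegree = 2 := by rw [hgK, hm.natDegree_map, hd]
  set q := p %ₘ gK with hq
  have hq0 : q ≠ 0 := by rwa [hq, Ne, modByMonic_eq_zero_iff_dvd hmK]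
  have hqd : q.natDegree ≤ 1 := by
    have := natDegree_modByMonic_lt p hmK (by intro h; rw [h] at hdK; simp at hdK)
    rw [← hq, hdK] at this; omega
  have hqe := eq_X_add_C_of_natDegree_le_one hqd
  obtain ⟨c, hc, A, B, hA, hB, hAB⟩ := norm_mv O r hr (q.coeff 1) (q.coeff 0) (by
    by_contra h
    push Not at h
    rw [h.1, h.2] at hqe
    exact hq0 (by rw [hqe]; simp))
  refine ⟨c, hc, C A * X + C B, ?_, ?_⟩
  · have : (C A * X + C B).map (MvPolynomial.map O.subtype) = C (MvPolynomial.C c) * q := by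
      rw [hqe]
      simp only [Polynomial.map_add, Polynomial.map_mul, map_C, map_X, hA, hB, C_mul]
      ring
    rw [this, ← mul_sub]
    apply Dvd.dvd.mul_left
    rw [hq, modByMonic_eq_sub_mul_div]
    exact ⟨p /ₘ gK, by ring⟩
  · have e : (C A * X + C B).map (MvPolynomial.map r) = C (MvPolynomial.map r A) * X + C (MvPolynomial.map r B) := by simp
    rw [e]
    have hne : C (MvPolynomial.map r A) * X + C (MvPolynomial.map r B) ≠ 0 := by
      intro h0
      have h1 := congrArg (fun f => coeff f 1) h0
      have h2 := congrArg (fun f => coeff f 0) h0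
      simp at h1 h2
      rcases hAB with h | h
      · exact h h1
      · exact h h2
    intro hdvd
    have h1 := natDegree_le_of_dvd hdvd hne
    rw [hm.natDegree_map, hd] at h1
    have h2 := natDegree_linear_le (a := MvPolynomial.map r A) (b := MvPolynomial.map r B)
    omega

lemma claimD (gO : (RR m O)[X]) (hm : gO.Monic) (P : (RR m O)[X])
    (hp : gO.map (MvPolynomial.map O.subtype) ∣ P.map (MvPolynomial.map O.subtype)) :
    gO.map (MvPolynomial.map r) ∣ P.map (MvPolynomial.map r) := by
  apply Polynomial.map_dvd
  rw [← modByMonic_eq_zero_iff_dvd (hm.map _), ← map_modByMonic _ hm] at hp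
  rw [← modByMonic_eq_zero_iff_dvd hm]
  exact (Polynomial.map_eq_zero_iff (MvPolynomial.map_injective _ Subtype.val_injective)).1 hp
end Norm
end ConicBundleFormalization

namespace ConicBundleFormalization
open Polynomial

section Aux
variable {K : Type*} [Field K] [IsAlgClosed K] {M : Type*} [Field M] [Algebra K M]
  (V : ValuationSubring M)
  {κ : Type*} [Field κ] [IsAlgClosed κ] [CharP κ 2] {L : Type*} [Field L] [Algebra κ L] {m : ℕ}
  (res : V →+* L)

lemma HPt_scale (D : Fin m → Derivation κ L L) (a1 a2 N : ℕ) (v : PIdx m → L) (x c : L) (hc : c ≠ 0)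
    (h : HPt D a1 a2 N v x) : HPt D a1 a2 N (fun p => c * v p) x := by
  obtain ⟨u, x0, x1, x2, ⟨hu, hx, hG⟩, rfl, rfl⟩ := h
  refine ⟨u, c * x0, c * x1, c * x2, ⟨hu, ?_, ?_⟩, ?_, rfl⟩
  · exact hx.imp (mul_ne_zero hc) (mul_ne_zero hc)
  · rw [G0_smul_x, hG, mul_zero]
  · ext p; rw [Phi_smul_x]

lemma HM_scale (hres : ∀ a : V, res a = 0 ↔ V.valuation (a : M) < 1)
    (hunit : ∀ a : M, a ≠ 0 → ∃ c : K, c ≠ 0 ∧ V.valuation (algebraMap K M c * a) = 1)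
    (D : Fin m → Derivation κ L L) (a1 a2 N : ℕ) (a b : PIdx m → M) (x : L) (t : M) (ht : t ≠ 0)
    (hb : ∀ p, b p = t * a p)
    (h : HM K V res D a1 a2 N a x) : HM K V res D a1 a2 N b x := by
  obtain ⟨c, hc, w, hw, h⟩ := h
  obtain ⟨c', hc', h1⟩ := hunit t ht
  have hmem : algebraMap K M c' * t ∈ V := by
    rw [← ValuationSubring.valuation_le_one_iff, h1]
  refine ⟨c' * c, mul_ne_zero hc' hc, fun p => ⟨_, hmem⟩ * w p, ?_, ?_⟩
  · intro p
    show algebraMap K M c' * t * (w p : M) = _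
    rw [hw, hb, map_mul]; ring
  · simp only [map_mul]
    apply HPt_scale _ _ _ _ _ _ _ _ h
    rw [Ne, hres, h1]; exact lt_irrefl _

lemma HPt_const (hm : 0 < m) (D : Fin m → Derivation κ L L) (a1 a2 N : ℕ) (v : PIdx m → L) (x : L)
    (hv : ∀ p, ∃ c : κ, v p = algebraMap κ L c) (h : HPt D a1 a2 N v x) : x = 0 := by
  obtain ⟨u, x0, x1, x2, ⟨hu, hx, hG⟩, rfl, rfl⟩ := h
  choose c hc using hv
  obtain ⟨j0, hj0⟩ : ∃ j, u j ≠ 0 := by by_contra h; push Not at h; exact hu (funext h)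
  have key : ∀ k : Fin 2, (if k = 0 then x1 else x2) ≠ 0 →
      ∀ j, u j = u j0 * algebraMap κ L (c (k, j, j0) / c (k, j0, j0)) := by
    intro k hk j
    rw [map_div₀, ← hc, ← hc]
    unfold Phi
    simp only
    have : u j0 ^ (if k = 0 then a1 else a2) ≠ 0 := pow_ne_zero _ hj0
    field_simp
  obtain ⟨k, hk⟩ : ∃ k : Fin 2, (if k = 0 then x1 else x2) ≠ 0 := by
    rcases hx with h | h
    · exact ⟨0, by simpa⟩
    · exact ⟨1, by simpa⟩
  rw [show u = fun j => u j0 * algebraMap κ L (c (k, j, j0) / c (k, j0, j0)) from funext (key k hk),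
    hW_smul _ _ hj0]
  unfold hW
  rw [div_eq_zero_iff]
  left
  unfold Wr
  apply Matrix.det_eq_zero_of_row_eq_zero (Fin.succ ⟨0, hm⟩)
  intro j
  simp only [Matrix.of_apply, EOp_succ, Derivation.map_algebraMap]
end Aux

section Main2
universe v
variable {K : Type*} [Field K] [IsAlgClosed K] {M : Type*} [Field M] [Algebra K M]
  (O : ValuationSubring K) {κ : Type v} [Field κ] [IsAlgClosed κ] [CharP κ 2] (r : O →+* κ) {m : ℕ}

theorem main2 (hr : ∀ a : O, r a = 0 ↔ O.valuation (a : K) < 1) (hm6 : 6 ≤ m) {a1 a2 N : ℕ}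
    (hN : m + 1 + N = a1 + a2 + 2)
    (gO : (RR m O)[X]) (hm : gO.Monic) (hd : gO.natDegree = 2)
    (hred : gO.map (MvPolynomial.map r) = X ^ 2 + C (rho κ m a1 a2 N))
    (gK : (RR m K)[X]) (hgK : gO.map (MvPolynomial.map O.subtype) = gK)
    (Ψ : (RR m K)[X] →ₐ[K] M) (hker : ∀ p, Ψ p = 0 ↔ gK ∣ p)
    (hfrac : ∀ a, ∃ p q, Ψ q ≠ 0 ∧ a * Ψ q = Ψ p)
    (hsu : ∀ (c : M[X]) u x0 x1 x2, gev (algebraMap K M[X]) gK (fun j => c * u j) x0 x1 x2 =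
      gev (algebraMap K M[X]) gK u x0 (c ^ (a1+1) * x1) (c ^ (a2+1) * x2))
    (hsx : ∀ (c : M[X]) u x0 x1 x2, gev (algebraMap K M[X]) gK u (c * x0) (c * x1) (c * x2) =
      c ^ 2 * gev (algebraMap K M[X]) gK u x0 x1 x2)
    {σ : Type*} (U : Fin (m+1) → MvPolynomial σ K) (Z0 Z1 Z2 : MvPolynomial σ K)
    (hG : gev MvPolynomial.C gK U Z0 Z1 Z2 = 0) (y : σ → M) (t : M) (ht : t ≠ 0)
    (hPhi : ∀ p, Phi a1 a2 (fun j => MvPolynomial.aeval y (U j)) (MvPolynomial.aeval y Z1)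
      (MvPolynomial.aeval y Z2) p = t * Phi a1 a2 (fun j => Ψ (C (MvPolynomial.X (Sum.inl j))))
        (Ψ (C (MvPolynomial.X (Sum.inr 0)))) (Ψ (C (MvPolynomial.X (Sum.inr 1)))) p) : False := by
  classical
  obtain ⟨L, iL, iA, Θ, D, hΘ, hW0⟩ := exists_special (κ := κ) (m := m) a1 a2 N
  let ψ : (RR m O)[X] →+* M := (Ψ : (RR m K)[X] →+* M).comp (mapRingHom (MvPolynomial.map O.subtype))
  let θ : (RR m O)[X] →+* L := (Θ : (RR m κ)[X] →+* L).comp (mapRingHom (MvPolynomial.map r))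
  have hψ : ∀ P, ψ P = Ψ (P.map (MvPolynomial.map O.subtype)) := fun P => rfl
  have hθ : ∀ P, θ P = Θ (P.map (MvPolynomial.map r)) := fun P => rfl
  have hθ0 : ∀ P, θ P = 0 ↔ gO.map (MvPolynomial.map r) ∣ P.map (MvPolynomial.map r) := by
    intro P; rw [hθ, hΘ, hred]
  have h1 : ∀ b, ψ b = 0 → θ b = 0 := by
    intro b hb
    rw [hψ, hker, ← hgK] at hb
    rw [hθ0]
    exact claimD O r gO hm b hb
  have hCc : ∀ c : K, Ψ (C (MvPolynomial.C c)) = algebraMap K M c := by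
    intro c
    exact Ψ.commutes c
  have hC : ∀ p, Ψ p ≠ 0 → ∃ c : K, c ≠ 0 ∧ ∃ P, θ P ≠ 0 ∧ algebraMap K M c * Ψ p = ψ P := by
    intro p hp
    rw [Ne, hker, ← hgK] at hp
    obtain ⟨c, hc, P, hP, hP'⟩ := claimC O r hr gO hm hd p hp
    refine ⟨c, hc, P, by rwa [Ne, hθ0], ?_⟩
    rw [hgK, ← hker, map_sub, map_mul, hCc, sub_eq_zero] at hP
    exact hP
  have hC2 : ∀ a : M, a ≠ 0 → ∃ c : K, c ≠ 0 ∧ ∃ P Q, θ P ≠ 0 ∧ θ Q ≠ 0 ∧ algebraMap K M c * a * ψ Q = ψ P := by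
    intro a ha
    obtain ⟨p, q, hq, hpq⟩ := hfrac a
    obtain ⟨c, hc, P, hP, hP'⟩ := hC p (by rw [← hpq]; exact mul_ne_zero ha hq)
    obtain ⟨c', hc', Q, hQ, hQ'⟩ := hC q hq
    refine ⟨c / c', div_ne_zero hc hc', P, Q, hP, hQ, ?_⟩
    rw [← hP', ← hQ', ← hpq, map_div₀]
    have : algebraMap K M c' ≠ 0 := by simpa using hc'
    field_simp
  have hψC : ∀ o : O, ψ (C (MvPolynomial.C o)) = algebraMap K M (o : K) := by
    intro o
    rw [hψ, map_C, MvPolynomial.map_C]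
    exact hCc _
  have hθC : ∀ o : O, θ (C (MvPolynomial.C o)) = algebraMap κ L (r o) := by
    intro o
    rw [hθ, map_C, MvPolynomial.map_C]
    exact Θ.commutes _
  obtain ⟨V, res, hV1, hV2, hres⟩ := exists_place ψ θ h1 (by
    intro a ha
    obtain ⟨c, hc, P, Q, hP, hQ, h⟩ := hC2 a ha
    have hc' : algebraMap K M c ≠ 0 := by simpa using hc
    rcases O.mem_or_inv_mem c with ho | ho
    · refine ⟨P, Q, C (MvPolynomial.C ⟨c, ho⟩), hP, hQ, Or.inr ?_⟩
      rw [map_mul, hψC, ← h]; ring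
    · refine ⟨P, Q, C (MvPolynomial.C ⟨c⁻¹, ho⟩), hP, hQ, Or.inl ?_⟩
      rw [map_mul, hψC, ← h]
      simp only [map_inv₀]
      field_simp)
  have hunit : ∀ a : M, a ≠ 0 → ∃ c : K, c ≠ 0 ∧ V.valuation (algebraMap K M c * a) = 1 := by
    intro a ha
    obtain ⟨c, hc, P, Q, hP, hQ, h⟩ := hC2 a ha
    refine ⟨c, hc, ?_⟩
    obtain ⟨hmem, h'⟩ := hV2 P Q _ hQ h
    have hne : res ⟨_, hmem⟩ ≠ 0 := by
      intro h0; rw [h0, zero_mul] at h'; exact hP h'.symm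
    rw [Ne, hres, not_lt] at hne
    exact le_antisymm ((ValuationSubring.valuation_le_one_iff _ _).2 hmem) hne
  have hOV : ∀ o : O, ∃ h : algebraMap K M (o : K) ∈ V, res ⟨_, h⟩ = algebraMap κ L (r o) := by
    intro o
    obtain ⟨hb, h⟩ := hV1 (C (MvPolynomial.C o))
    rw [hθC] at h
    simp only [hψC] at h hb
    exact ⟨hb, h⟩

  let ι : O →+* V :=
    { toFun := fun o => ⟨algebraMap K M (o : K), (hOV o).1⟩
      map_one' := by ext; simp
      map_zero' := by ext; simp
      map_add' := by intro a b; ext; simp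
      map_mul' := by intro a b; ext; simp }
  have hι : ∀ o, ((ι o : V) : M) = algebraMap K M (o : K) := fun o => rfl
  have hresι : ∀ o, res (ι o) = algebraMap κ L (r o) := fun o => (hOV o).2
  have HR : GRed K V κ res a1 a2 N (fun u x0 x1 x2 => gev (algebraMap K M[X]) gK u x0 x1 x2 = 0) := by
    refine ⟨hres, hunit, ?_, ?_, ?_, ?_⟩
    · intro c u x0 x1 x2 h
      rw [hsu, h]
    · intro c u x0 x1 x2 h
      rw [hsx, h, mul_zero]
    · intro q u x0 x1 x2 h
      have := gev_comp (compRingHom q) (algebraMap K M[X]) gK u x0 x1 x2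
      rw [h, map_zero] at this
      simp only [coe_compRingHom_apply] at this
      rw [this]
      congr 1
      ext c
      simp [Polynomial.algebraMap_apply]
    · intro U Y0 Y1 Y2 h
      rw [← hgK, gev_map] at h
      have e1 := gev_comp (mapRingHom V.subtype) ((C : V →+* V[X]).comp ι) gO U Y0 Y1 Y2
      have e2 : (mapRingHom V.subtype).comp ((C : V →+* V[X]).comp ι) = (algebraMap K M[X]).comp O.subtype := by
        ext1 o
        simp [Polynomial.algebraMap_apply, hι]
      rw [e2] at e1
      simp only [coe_mapRingHom] at e1
      rw [h, Polynomial.map_eq_zero_iff Subtype.val_injective] at e1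
      have e3 := gev_comp (mapRingHom res) ((C : V →+* V[X]).comp ι) gO U Y0 Y1 Y2
      rw [e1, map_zero] at e3
      have e4 : (mapRingHom res).comp ((C : V →+* V[X]).comp ι) = (algebraMap κ L[X]).comp r := by
        ext1 o
        simp [Polynomial.algebraMap_apply, hresι]
      rw [e4, ← gev_map, hred, gev_g0] at e3
      simpa using e3.symm

  set ug : Fin (m+1) → M := fun j => Ψ (C (MvPolynomial.X (Sum.inl j))) with hug
  set xg1 : M := Ψ (C (MvPolynomial.X (Sum.inr 0))) with hxg1
  set xg2 : M := Ψ (C (MvPolynomial.X (Sum.inr 1))) with hxg2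
  have hXψ : ∀ i, ψ (C (MvPolynomial.X i)) = Ψ (C (MvPolynomial.X i)) := by intro i; rw [hψ]; simp
  have hXθ : ∀ i, θ (C (MvPolynomial.X i)) = Θ (C (MvPolynomial.X i)) := by intro i; rw [hθ]; simp
  have hΘne : ∀ i, Θ (C (MvPolynomial.X i)) ≠ 0 := by
    intro c h
    rw [hΘ] at h
    have := natDegree_le_of_dvd h (C_ne_zero.2 (MvPolynomial.X_ne_zero _))
    rw [natDegree_C, natDegree_X_pow_add_C] at this
    omega
  have hΨne : ∀ i, Ψ (C (MvPolynomial.X i)) ≠ 0 := by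
    intro i h
    rw [← hXψ] at h
    exact hΘne i (by rw [← hXθ]; exact h1 _ h)
  let xg : L := hW D (fun j => Θ (C (MvPolynomial.X (Sum.inl j))))
  have hgen : HM K V res D a1 a2 N (Phi a1 a2 ug xg1 xg2) xg := by
    have hb : ∀ i, ∃ h : Ψ (C (MvPolynomial.X i)) ∈ V, res ⟨_, h⟩ = Θ (C (MvPolynomial.X i)) := by
      intro i
      obtain ⟨hb, h⟩ := hV1 (C (MvPolynomial.X i))
      rw [hXθ] at h
      simp only [hXψ] at h hb
      exact ⟨hb, h⟩
    choose hb1 hb2 using hb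
    refine ⟨1, one_ne_zero, Phi a1 a2 (fun j => ⟨_, hb1 (Sum.inl j)⟩) ⟨_, hb1 (Sum.inr 0)⟩ ⟨_, hb1 (Sum.inr 1)⟩, ?_, ?_⟩
    · intro p
      rw [map_one, one_mul]
      rw [← ValuationSubring.subtype_apply, Phi_map V.subtype]; rfl
    · refine ⟨fun j => Θ (C (MvPolynomial.X (Sum.inl j))), Θ X, Θ (C (MvPolynomial.X (Sum.inr 0))),
        Θ (C (MvPolynomial.X (Sum.inr 1))), ⟨?_, Or.inl (hΘne _), ?_⟩, ?_, rfl⟩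
      · intro h; exact hΘne _ (congrFun h 0)
      · have h0 : Θ (X ^ 2 + C (rho κ m a1 a2 N)) = 0 := (hΘ _).2 dvd_rfl
        rw [map_add, rho] at h0
        have e := G0_map (a1 := a1) (a2 := a2) (N := N) (Θ.comp (IsScalarTower.toAlgHom κ (RR m κ) (RR m κ)[X]))
          (fun j => MvPolynomial.X (Sum.inl j)) 0 (MvPolynomial.X (Sum.inr 0)) (MvPolynomial.X (Sum.inr 1))
        have e' : ∀ z, (Θ.comp (IsScalarTower.toAlgHom κ (RR m κ) (RR m κ)[X])) z = Θ (C z) := fun z => rfl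
        simp only [e'] at e
        rw [e] at h0
        unfold G0 at h0 ⊢
        rw [← h0]
        simp only [map_pow, map_zero]
        ring
      · ext p
        rw [Phi_map res]
        simp only [hb2]
  have hgen2 := HM_scale V res hres hunit D a1 a2 N _ _ xg t ht hPhi hgen

  have hUne : ∀ j, MvPolynomial.aeval y (U j) ≠ 0 := by
    intro j h
    have := hPhi (0, j, j)
    simp only [Phi, h, zero_mul] at this
    have h0 : t * (ug j * ug j ^ a1 * xg1) = 0 := by simpa using this.symm
    exact mul_ne_zero ht (mul_ne_zero (mul_ne_zero (hΨne _) (pow_ne_zero _ (hΨne _))) (hΨne _)) h0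
  have hZne : MvPolynomial.aeval y Z1 ≠ 0 := by
    intro h
    have := hPhi (0, 0, 0)
    simp only [Phi, h] at this
    have h0 : t * (ug 0 * ug 0 ^ a1 * xg1) = 0 := by simpa using this.symm
    exact mul_ne_zero ht (mul_ne_zero (mul_ne_zero (hΨne _) (pow_ne_zero _ (hΨne _))) (hΨne _)) h0
  have hprod : U 0 * Z1 ≠ 0 := by
    intro h
    have := congrArg (MvPolynomial.aeval y) h
    rw [map_mul, map_zero] at this
    exact mul_ne_zero (hUne 0) hZne this
  obtain ⟨b, hb⟩ : ∃ b : σ → K, MvPolynomial.eval b (U 0 * Z1) ≠ 0 := by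
    by_contra h
    push Not at h
    exact hprod (MvPolynomial.funext (by intro x; rw [h, map_zero]))
  rw [map_mul] at hb
  let E : MvPolynomial σ K →ₐ[K] M[X] := MvPolynomial.aeval
    (fun i => C (algebraMap K M (b i)) + X * C (y i - algebraMap K M (b i)))
  have hE0 : ∀ P, (E P).eval 0 = algebraMap K M (MvPolynomial.eval b P) := by
    intro P
    have : (evalRingHom (0:M)).comp (E : MvPolynomial σ K →+* M[X]) = (algebraMap K M).comp (MvPolynomial.eval b) := by
      ext i
      · simp [E, Polynomial.algebraMap_apply]
      · simp [E]
    exact DFunLike.congr_fun this P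
  have hE1 : ∀ P, (E P).eval 1 = MvPolynomial.aeval y P := by
    intro P
    have : (evalRingHom (1:M)).comp (E : MvPolynomial σ K →+* M[X]) = (MvPolynomial.aeval y : MvPolynomial σ K →ₐ[K] M) := by
      ext i
      · simp [E, Polynomial.algebraMap_apply]
      · simp [E]
    exact DFunLike.congr_fun this P
  have hGE : gev (algebraMap K M[X]) gK (fun j => E (U j)) (E Z0) (E Z1) (E Z2) = 0 := by
    have := gev_comp (E : MvPolynomial σ K →+* M[X]) MvPolynomial.C gK U Z0 Z1 Z2
    rw [hG, map_zero] at this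
    have e : (E : MvPolynomial σ K →+* M[X]).comp MvPolynomial.C = algebraMap K M[X] := by
      ext1 c; exact E.commutes c
    rw [e] at this
    exact this.symm
  obtain ⟨x, hx0, hx1⟩ := curve_lemma V res hm6 D hN HR (fun j => E (U j)) (E Z0) (E Z1) (E Z2) hGE
    ⟨0, by rw [hE0]; simpa using left_ne_zero_of_mul hb⟩
    (Or.inl (by rw [hE0]; simpa using right_ne_zero_of_mul hb))
    ⟨0, by rw [hE1]; exact hUne 0⟩ (Or.inl (by rw [hE1]; exact hZne))
  simp only [hE1] at hx1
  have hxe : x = xg := HM_unique V res hres D a1 a2 N _ x xg hx1 hgen2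
  apply hW0
  change xg = 0
  rw [← hxe]
  obtain ⟨c, hc, w, hw, hpt⟩ := hx0
  refine HPt_const (by omega) D a1 a2 N _ _ ?_ hpt
  intro p
  simp only [hE0] at hw
  rw [show (fun j => algebraMap K M (MvPolynomial.eval b (U j))) = fun j => algebraMap K M ((fun j => MvPolynomial.eval b (U j)) j) from rfl] at hw
  have h3 := hw p
  rw [← Phi_map (algebraMap K M) a1 a2, ← map_mul] at h3
  set z : K := c * Phi a1 a2 (fun j => MvPolynomial.eval b (U j)) (MvPolynomial.eval b Z1) (MvPolynomial.eval b Z2) p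
  rcases O.mem_or_inv_mem z with ho | ho
  · refine ⟨r ⟨z, ho⟩, ?_⟩
    rw [← hresι]
    congr 1
    ext
    exact h3
  · by_cases hz : z = 0
    · refine ⟨0, ?_⟩
      rw [hz, map_zero] at h3
      rw [map_zero, show w p = 0 from Subtype.ext h3, map_zero]
    have hmul : w p * ι ⟨z⁻¹, ho⟩ = 1 := by
      ext
      show (w p : M) * algebraMap K M z⁻¹ = 1
      rw [h3, ← map_mul, mul_inv_cancel₀ hz, map_one]
    have h4 := congrArg res hmul
    rw [map_mul, hresι, map_one] at h4
    refine ⟨(r ⟨z⁻¹, ho⟩)⁻¹, ?_⟩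
    rw [map_inv₀]
    exact eq_inv_of_mul_eq_one_left h4

end Main2
end ConicBundleFormalization

namespace ConicBundleFormalization
open MvPolynomial

universe u
lemma exists_placeC {K : Type u} [Field K] {ι : Type*} (c : ι → K) (hc : AlgebraicIndependent ℤ c)
    (f : ι → ℤ) : ∃ (O : ValuationSubring K) (κ : Type u) (_ : Field κ) (_ : IsAlgClosed κ)
      (_ : CharP κ 2) (r : O →+* κ), (∀ a : O, r a = 0 ↔ O.valuation (a : K) < 1) ∧
      ∀ i, ∃ h : c i ∈ O, r ⟨c i, h⟩ = (f i : κ) := by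
  let φ : MvPolynomial ι ℤ →+* K := (aeval c : MvPolynomial ι ℤ →ₐ[ℤ] K)
  have hφ : Function.Injective φ := hc
  let A := φ.range
  let e : MvPolynomial ι ℤ ≃+* A := RingEquiv.ofBijective φ.rangeRestrict
    ⟨fun a b h => hφ (congrArg Subtype.val h), φ.rangeRestrict_surjective⟩
  let χ : MvPolynomial ι ℤ →+* ZMod 2 := (aeval (fun i => (f i : ZMod 2)) : MvPolynomial ι ℤ →ₐ[ℤ] ZMod 2)
  let χ' : A →+* ZMod 2 := χ.comp e.symm.toRingHom
  obtain ⟨O, hO, hI⟩ := Ideal.image_subset_nonunits_valuationSubring (RingHom.ker χ') (RingHom.ker_ne_top χ')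
  have hmem : ∀ P, φ P ∈ O := fun P => hO ⟨P, rfl⟩
  have hnon : ∀ P, χ P = 0 → φ P ∈ O.nonunits := by
    intro P hP
    apply hI
    refine ⟨e P, ?_, rfl⟩
    show χ (e.symm (e P)) = 0
    rw [RingEquiv.symm_apply_apply, hP]
  let k := IsLocalRing.ResidueField O
  let κ := AlgebraicClosure k
  let r : O →+* κ := (algebraMap k κ).comp (IsLocalRing.residue O)
  have hr : ∀ a : O, r a = 0 ↔ O.valuation (a : K) < 1 := by
    intro a
    rw [← ValuationSubring.valuation_lt_one_iff]
    show algebraMap k κ (IsLocalRing.residue O a) = 0 ↔ _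
    rw [map_eq_zero_iff _ (algebraMap k κ).injective, IsLocalRing.residue_eq_zero_iff]
  have hr0 : ∀ P, χ P = 0 → r ⟨φ P, hmem P⟩ = 0 := by
    intro P hP
    rw [hr]
    exact (ValuationSubring.mem_nonunits_iff _).1 (hnon P hP)
  have h2 : (2 : κ) = 0 := by
    have := hr0 (C 2) (by simp [χ]; rfl)
    have e2 : (⟨φ (C 2), hmem (C 2)⟩ : O) = 2 := by
      apply Subtype.ext
      simp [φ]; rfl
    rw [e2, map_ofNat] at this
    exact this
  refine ⟨O, κ, inferInstance, inferInstance, ?_, r, hr, ?_⟩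
  · exact CharTwo.of_one_ne_zero_of_two_eq_zero one_ne_zero h2
  · intro i
    have h1 : c i ∈ O := by
      have := hmem (X i)
      simpa [φ] using this
    refine ⟨h1, ?_⟩
    have := hr0 (X i - C (f i)) (by simp [χ])
    have e2 : (⟨φ (X i - C (f i)), hmem _⟩ : O) = ⟨c i, h1⟩ - (f i : O) := by
      apply Subtype.ext
      simp [φ]
    rw [e2, map_sub, map_intCast, sub_eq_zero] at this
    exact this

end ConicBundleFormalization

namespace ConicBundleFormalization
open MvPolynomial

section Fibre
variable {K : Type} [Field K] {n m : ℕ}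

noncomputable def TT (K : Type) [Field K] (n m : ℕ) : Cox K n m →ₐ[K] MvPolynomial (Fin m) (MvPolynomial (Fin n) K) :=
  (MvPolynomial.sumAlgEquiv K (Fin m) (Fin n) : _ →ₐ[K] _).comp (MvPolynomial.rename Sum.swap)

lemma TT_inl (p : MvPolynomial (Fin n) K) : TT K n m (rename Sum.inl p) = C p := by
  have : (TT K n m).comp (rename Sum.inl) = (Algebra.ofId (MvPolynomial (Fin n) K) (MvPolynomial (Fin m) (MvPolynomial (Fin n) K))).restrictScalars K := by
    ext i : 1
    simp [TT, Algebra.ofId_apply, MvPolynomial.algebraMap_eq]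
  exact DFunLike.congr_fun this p

lemma TT_X_inr (j : Fin m) : TT K n m (X (Sum.inr j)) = X j := by
  simp [TT]

lemma TT_X_inl (j : Fin n) : TT K n m (X (Sum.inl j)) = C (X j) := by
  simp [TT]

lemma TT_inj : Function.Injective (TT K n m) := by
  unfold TT
  intro a b h
  have := (MvPolynomial.sumAlgEquiv K (Fin m) (Fin n)).injective h
  exact rename_injective _ Sum.swap_leftInverse.injective this

lemma fibreCoeff_eq (g : Cox K n m) (e : Fin m →₀ ℕ) : fibreCoeff K g e = (TT K n m g).coeff e := rfl

lemma TT_monomial (s : Fin n ⊕ Fin m →₀ ℕ) (c : K) : TT K n m (monomial s c) =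
    monomial (s.comapDomain Sum.inr Sum.inr_injective.injOn) (monomial (s.comapDomain Sum.inl Sum.inl_injective.injOn) c) := by
  rw [monomial_eq, map_mul, Finsupp.prod_fintype _ _ (by simp), Fintype.prod_sum_type, map_mul,
    map_prod, map_prod]
  simp only [map_pow, TT_X_inl, TT_X_inr]
  rw [monomial_eq, monomial_eq, Finsupp.prod_fintype _ _ (by simp), Finsupp.prod_fintype _ _ (by simp),
    C_mul, map_prod]
  have : TT K n m (C c) = C (C c) := by
    rw [← TT_inl, rename_C]
  rw [this]
  simp [mul_assoc]

lemma coeff_fibreCoeff (g : Cox K n m) (e : Fin m →₀ ℕ) (e' : Fin n →₀ ℕ) :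
    (fibreCoeff K g e).coeff e' = g.coeff (Finsupp.sumElim e' e) := by
  classical
  rw [fibreCoeff_eq]
  induction g using MvPolynomial.induction_on' with
  | add p q hp hq => simp [hp, hq]
  | monomial s c =>
    rw [TT_monomial, coeff_monomial, coeff_monomial]
    have key : s = Finsupp.sumElim e' e ↔ (s.comapDomain Sum.inr Sum.inr_injective.injOn = e ∧
        s.comapDomain Sum.inl Sum.inl_injective.injOn = e') := by
      constructor
      · rintro rfl; constructor <;> ext <;> simp
      · rintro ⟨rfl, rfl⟩; ext (i | i) <;> simp
    by_cases h1 : s.comapDomain Sum.inr Sum.inr_injective.injOn = e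
    · rw [if_pos h1, coeff_monomial]
      by_cases h2 : s.comapDomain Sum.inl Sum.inl_injective.injOn = e'
      · rw [if_pos h2, if_pos (key.2 ⟨h1, h2⟩)]
      · rw [if_neg h2, if_neg (fun h => h2 (key.1 h).2)]
    · rw [if_neg h1, if_neg (fun h => h1 (key.1 h).1), coeff_zero]

end Fibre

section Quad
variable {K : Type} [Field K] {n : ℕ}

noncomputable def qq (g : Cox K n 3) (i j : Fin 3) : MvPolynomial (Fin n) K :=
  fibreCoeff K g (Finsupp.single i 1 + Finsupp.single j 1)

lemma qq_comm (g : Cox K n 3) (i j : Fin 3) : qq g i j = qq g j i := by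
  unfold qq; rw [add_comm]

lemma qq_self (g : Cox K n 3) (i : Fin 3) : qq g i i = fibreCoeff K g (Finsupp.single i 2) := by
  unfold qq; rw [← Finsupp.single_add]

variable {w : Fin 3 → ℤ} {d : ℤ} {g : Cox K n 3}

lemma qq_homog (hg : IsBihom K n 3 w (fun _ => 1) d 2 g) (i j : Fin 3) :
    IsHomogZ K n (d - w i - w j) (qq g i j) := by
  intro e he
  rw [mem_support_iff, qq, coeff_fibreCoeff] at he
  have := (hg _ (mem_support_iff.2 he)).1
  simp only [Finsupp.sumElim_inl, Finsupp.sumElim_inr, Finsupp.add_apply, Nat.cast_add, add_mul,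
    Finset.sum_add_distrib, Finsupp.single_apply, Nat.cast_ite, ite_mul, Nat.cast_one, Nat.cast_zero, one_mul, zero_mul,
    Finset.sum_ite_eq, Finset.mem_univ, if_true] at this
  linarith

lemma deg_two (e : Fin 3 →₀ ℕ) (he : e 0 + e 1 + e 2 = 2) {i j k : Fin 3} (hij : i ≠ j) (hik : i ≠ k) (hjk : j ≠ k) :
    e = Finsupp.single i 1 + Finsupp.single i 1 ∨ e = Finsupp.single j 1 + Finsupp.single j 1 ∨
    e = Finsupp.single k 1 + Finsupp.single k 1 ∨ e = Finsupp.single i 1 + Finsupp.single j 1 ∨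
    e = Finsupp.single i 1 + Finsupp.single k 1 ∨ e = Finsupp.single j 1 + Finsupp.single k 1 := by
  have hs : e i + e j + e k = 2 := by
    fin_cases i <;> fin_cases j <;> fin_cases k <;> simp at hij hik hjk ⊢ <;> omega
  have hall : ∀ l, l = i ∨ l = j ∨ l = k := by
    intro l
    fin_cases i <;> fin_cases j <;> fin_cases k <;> simp at hij hik hjk ⊢ <;> fin_cases l <;> simp
  have key : ∀ f : Fin 3 →₀ ℕ, f i = e i → f j = e j → f k = e k → e = f := by
    intro f h1 h2 h3
    ext l
    rcases hall l with rfl | rfl | rfl <;> simp [*]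
  have hc : (e i = 2 ∧ e j = 0 ∧ e k = 0) ∨ (e i = 0 ∧ e j = 2 ∧ e k = 0) ∨ (e i = 0 ∧ e j = 0 ∧ e k = 2) ∨
    (e i = 1 ∧ e j = 1 ∧ e k = 0) ∨ (e i = 1 ∧ e j = 0 ∧ e k = 1) ∨ (e i = 0 ∧ e j = 1 ∧ e k = 1) := by omega
  have s1 := hij.symm
  have s2 := hik.symm
  have s3 := hjk.symm
  rcases hc with h | h | h | h | h | h
  · exact Or.inl (key _ (by simp [*]) (by simp [*]) (by simp [*]))
  · exact Or.inr (Or.inl (key _ (by simp [*]) (by simp [*]) (by simp [*])))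
  · exact Or.inr (Or.inr (Or.inl (key _ (by simp [*]) (by simp [*]) (by simp [*]))))
  · exact Or.inr (Or.inr (Or.inr (Or.inl (key _ (by simp [*]) (by simp [*]) (by simp [*])))))
  · exact Or.inr (Or.inr (Or.inr (Or.inr (Or.inl (key _ (by simp [*]) (by simp [*]) (by simp [*]))))))
  · exact Or.inr (Or.inr (Or.inr (Or.inr (Or.inr (key _ (by simp [*]) (by simp [*]) (by simp [*]))))))

noncomputable abbrev bs (p : MvPolynomial (Fin n) K) : Cox K n 3 := rename Sum.inl p

lemma decomp (hg : IsBihom K n 3 w (fun _ => 1) d 2 g) {i j k : Fin 3} (hij : i ≠ j) (hik : i ≠ k) (hjk : j ≠ k) :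
    g = bs (qq g i i) * X (Sum.inr i) ^ 2 + bs (qq g j j) * X (Sum.inr j) ^ 2 + bs (qq g k k) * X (Sum.inr k) ^ 2
      + bs (qq g i j) * X (Sum.inr i) * X (Sum.inr j) + bs (qq g i k) * X (Sum.inr i) * X (Sum.inr k)
      + bs (qq g j k) * X (Sum.inr j) * X (Sum.inr k) := by
  classical
  apply TT_inj (K := K)
  simp only [map_add, map_mul, map_pow, TT_inl, TT_X_inr]
  have hX : ∀ a b : Fin 3, (X a * X b : MvPolynomial (Fin 3) (MvPolynomial (Fin n) K)) = monomial (Finsupp.single a 1 + Finsupp.single b 1) 1 := by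
    intro a b
    rw [X, X, monomial_mul, one_mul]
  simp only [mul_assoc, pow_two, hX]
  ext1 e
  simp only [coeff_add, coeff_C_mul, coeff_monomial]
  rw [← fibreCoeff_eq]
  have s1 := hij.symm
  have s2 := hik.symm
  have s3 := hjk.symm
  by_cases h2 : e 0 + e 1 + e 2 = 2
  · rcases deg_two e h2 hij hik hjk with rfl | rfl | rfl | rfl | rfl | rfl
    all_goals simp [qq, Finsupp.single_left_inj, Finsupp.single_add_single_eq_single_add_single, *]
  · have h0 : fibreCoeff K g e = 0 := by
      ext e'
      rw [coeff_fibreCoeff, coeff_zero]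
      by_contra h
      have := (hg _ (mem_support_iff.2 h)).2
      simp [Fin.sum_univ_three] at this
      exact h2 this
    have hne : ∀ a b : Fin 3, (Finsupp.single a 1 + Finsupp.single b 1 : Fin 3 →₀ ℕ) ≠ e := by
      rintro a b rfl
      apply h2
      fin_cases a <;> fin_cases b <;> simp
    simp [h0, hne]

end Quad
end ConicBundleFormalization

namespace ConicBundleFormalization
open Polynomial

section GQ
variable {A B : Type*} [CommRing A] [CommRing B] {m : ℕ}

noncomputable def gqc (q11 q12 q22 : MvPolynomial (Fin (m+1)) A) : RR m A :=
  MvPolynomial.rename Sum.inl q11 * MvPolynomial.X (Sum.inr 0) ^ 2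
    + MvPolynomial.rename Sum.inl q12 * MvPolynomial.X (Sum.inr 0) * MvPolynomial.X (Sum.inr 1)
    + MvPolynomial.rename Sum.inl q22 * MvPolynomial.X (Sum.inr 1) ^ 2

noncomputable def gql (q01 q02 : MvPolynomial (Fin (m+1)) A) : RR m A :=
  MvPolynomial.rename Sum.inl q01 * MvPolynomial.X (Sum.inr 0)
    + MvPolynomial.rename Sum.inl q02 * MvPolynomial.X (Sum.inr 1)

noncomputable def gq (q01 q02 q11 q12 q22 : MvPolynomial (Fin (m+1)) A) : (RR m A)[X] :=
  X ^ 2 + C (gql q01 q02) * X + C (gqc q11 q12 q22)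

variable (q01 q02 q11 q12 q22 : MvPolynomial (Fin (m+1)) A)

lemma gq_map (h : A →+* B) : (gq q01 q02 q11 q12 q22).map (MvPolynomial.map h) =
    gq (q01.map h) (q02.map h) (q11.map h) (q12.map h) (q22.map h) := by
  simp [gq, gql, gqc, MvPolynomial.map_rename]

lemma gq_monic : (gq q01 q02 q11 q12 q22).Monic := by
  unfold gq
  monicity!

lemma gq_deg [Nontrivial A] : (gq q01 q02 q11 q12 q22).natDegree = 2 := by
  unfold gq
  compute_degree!

lemma gev_gq (f : A →+* B) (u : Fin (m+1) → B) (x0 x1 x2 : B) : gev f (gq q01 q02 q11 q12 q22) u x0 x1 x2 =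
    x0 ^ 2 + (q01.eval₂ f u * x1 + q02.eval₂ f u * x2) * x0 + (q11.eval₂ f u * x1 ^ 2 + q12.eval₂ f u * x1 * x2
      + q22.eval₂ f u * x2 ^ 2) := by
  simp [gev, gq, gql, gqc, MvPolynomial.eval₂_rename, Function.comp_def, eval₂_pow]

lemma gq_special (a1 a2 N : ℕ) : gq 0 0 (QQ A m a1 1) (FF A m N) (QQ A m a2 2) = X ^ 2 + C (rho A m a1 a2 N) := by
  have : ∀ q : MvPolynomial (Fin (m+1)) A, MvPolynomial.aeval (fun j => (MvPolynomial.X (Sum.inl j) : RR m A)) q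
    = MvPolynomial.rename Sum.inl q := fun q => by
    rw [← MvPolynomial.aeval_X_left_apply (MvPolynomial.rename Sum.inl q), MvPolynomial.aeval_rename]; rfl
  simp only [gq, gql, gqc, rho, G0, this]
  simp

lemma QQ_map (h : A →+* B) (a t : ℕ) : (QQ A m a t).map h = QQ B m a t := by simp [QQ]
lemma FF_map (h : A →+* B) (N : ℕ) : (FF A m N).map h = FF B m N := by simp [FF]

lemma homog_eval₂ {τ : Type*} {q : MvPolynomial τ A} {k : ℕ} (hq : q.IsHomogeneous k) (f : A →+* B) (c : B) (u : τ → B) :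
    q.eval₂ f (fun j => c * u j) = c ^ k * q.eval₂ f u := by
  rw [MvPolynomial.eval₂_eq, MvPolynomial.eval₂_eq, Finset.mul_sum]
  refine Finset.sum_congr rfl fun e he => ?_
  have := hq (MvPolynomial.mem_support_iff.1 he)
  rw [Finsupp.weight_apply, Finsupp.sum] at this
  simp only [Pi.one_apply, smul_eq_mul, mul_one] at this
  simp only [mul_pow, Finset.prod_mul_distrib]
  rw [Finset.prod_pow_eq_pow_sum, this]
  ring

lemma QQ_homog (a t : ℕ) : (QQ A m a t).IsHomogeneous (2*a+2) := by
  unfold QQ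
  refine MvPolynomial.IsHomogeneous.sum _ _ _ fun i _ => ?_
  have := ((MvPolynomial.isHomogeneous_X A i).pow (2*a+1)).mul (MvPolynomial.isHomogeneous_X A (i + t • (1 : Fin (m+1))))
  convert this using 1
  ring

lemma FF_homog (N : ℕ) : (FF A m N).IsHomogeneous (m+1+N) := by
  unfold FF
  have h1 := MvPolynomial.IsHomogeneous.prod (R := A) Finset.univ (fun i : Fin (m+1) => MvPolynomial.X i) (fun _ => 1)
    (fun i _ => MvPolynomial.isHomogeneous_X A i)
  have := h1.mul ((MvPolynomial.isHomogeneous_X A (0 : Fin (m+1))).pow N)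
  simpa using this

lemma gev_gq_su {a1 a2 : ℕ} (h01 : q01.IsHomogeneous (a1+1)) (h02 : q02.IsHomogeneous (a2+1))
    (h11 : q11.IsHomogeneous (2*a1+2)) (h12 : q12.IsHomogeneous (a1+a2+2)) (h22 : q22.IsHomogeneous (2*a2+2))
    (f : A →+* B) (c : B) (u : Fin (m+1) → B) (x0 x1 x2 : B) :
    gev f (gq q01 q02 q11 q12 q22) (fun j => c * u j) x0 x1 x2 =
      gev f (gq q01 q02 q11 q12 q22) u x0 (c ^ (a1+1) * x1) (c ^ (a2+1) * x2) := by
  simp only [gev_gq, homog_eval₂ h01, homog_eval₂ h02, homog_eval₂ h11, homog_eval₂ h12, homog_eval₂ h22]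
  ring

lemma gev_gq_sx (f : A →+* B) (c : B) (u : Fin (m+1) → B) (x0 x1 x2 : B) :
    gev f (gq q01 q02 q11 q12 q22) u (c * x0) (c * x1) (c * x2) =
      c ^ 2 * gev f (gq q01 q02 q11 q12 q22) u x0 x1 x2 := by
  simp only [gev_gq]
  ring

end GQ

lemma lift_poly {K κ τ : Type*} [Field K] [Field κ] (O : ValuationSubring K) (r : O →+* κ) (q : MvPolynomial τ K)
    (tgt : MvPolynomial τ ℤ) (h : ∀ e, ∃ h : q.coeff e ∈ O, r ⟨q.coeff e, h⟩ = ((tgt.coeff e : ℤ) : κ)) :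
    ∃ qO : MvPolynomial τ O, qO.map O.subtype = q ∧ qO.map r = tgt.map (Int.castRingHom κ) := by
  have hm : q ∈ Set.range (MvPolynomial.map (σ := τ) O.subtype) := by
    have := (MvPolynomial.mem_range_map_iff_coeffs_subset (f := O.subtype) (x := q)).2 (by
      intro c hc
      rw [Finset.mem_coe, MvPolynomial.mem_coeffs_iff] at hc
      obtain ⟨e, he, rfl⟩ := hc
      exact ⟨⟨_, (h e).1⟩, rfl⟩)
    exact this
  obtain ⟨qO, rfl⟩ := hm
  refine ⟨qO, rfl, ?_⟩
  ext e
  obtain ⟨h1, h2⟩ := h e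
  rw [MvPolynomial.coeff_map, MvPolynomial.coeff_map, eq_intCast, ← h2]
  congr 1

end ConicBundleFormalization

namespace ConicBundleFormalization
open Polynomial

section Iso
variable {K : Type} [Field K] {m : ℕ}

noncomputable def Fi (K : Type) [Field K] (m : ℕ) (i0 i1 i2 : Fin 3) : (RR m K)[X] →ₐ[K] Cox K (m+1) 3 :=
  Polynomial.eval₂AlgHom (MvPolynomial.aeval (Sum.elim (fun j => MvPolynomial.X (Sum.inl j))
    ![MvPolynomial.X (Sum.inr i1), MvPolynomial.X (Sum.inr i2)])) (MvPolynomial.X (Sum.inr i0)) (fun _ => mul_comm _ _)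

noncomputable def Fj (K : Type) [Field K] (m : ℕ) (i0 i1 : Fin 3) : Cox K (m+1) 3 →ₐ[K] (RR m K)[X] :=
  MvPolynomial.aeval (Sum.elim (fun j => C (MvPolynomial.X (Sum.inl j)))
    (fun l => if l = i0 then X else if l = i1 then C (MvPolynomial.X (Sum.inr 0)) else C (MvPolynomial.X (Sum.inr 1))))

lemma Fi_X (i0 i1 i2 : Fin 3) : Fi K m i0 i1 i2 X = MvPolynomial.X (Sum.inr i0) := by simp [Fi]
lemma Fi_inl (i0 i1 i2 : Fin 3) (j : Fin (m+1)) : Fi K m i0 i1 i2 (C (MvPolynomial.X (Sum.inl j))) = MvPolynomial.X (Sum.inl j) := by simp [Fi]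
lemma Fi_inr0 (i0 i1 i2 : Fin 3) : Fi K m i0 i1 i2 (C (MvPolynomial.X (Sum.inr 0))) = MvPolynomial.X (Sum.inr i1) := by simp [Fi]
lemma Fi_inr1 (i0 i1 i2 : Fin 3) : Fi K m i0 i1 i2 (C (MvPolynomial.X (Sum.inr 1))) = MvPolynomial.X (Sum.inr i2) := by simp [Fi]
lemma Fi_base (i0 i1 i2 : Fin 3) (q : MvPolynomial (Fin (m+1)) K) :
    Fi K m i0 i1 i2 (C (MvPolynomial.rename Sum.inl q)) = bs q := by
  have : (Fi K m i0 i1 i2).comp ((Algebra.ofId (RR m K) (RR m K)[X]).restrictScalars K |>.comp (MvPolynomial.rename Sum.inl)) =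
    MvPolynomial.rename Sum.inl := by
    ext i : 1
    simp only [AlgHom.comp_apply, MvPolynomial.rename_X]
    exact Fi_inl i0 i1 i2 i
  exact DFunLike.congr_fun this q

variable {i0 i1 i2 : Fin 3}

lemma fin3_cases (h01 : i0 ≠ i1) (h02 : i0 ≠ i2) (h12 : i1 ≠ i2) (l : Fin 3) : l = i0 ∨ l = i1 ∨ l = i2 := by
  fin_cases i0 <;> fin_cases i1 <;> fin_cases i2 <;> simp at h01 h02 h12 ⊢ <;> fin_cases l <;> simp

lemma Fi_Fj (h01 : i0 ≠ i1) (h02 : i0 ≠ i2) (h12 : i1 ≠ i2) (x : Cox K (m+1) 3) : Fi K m i0 i1 i2 (Fj K m i0 i1 x) = x := by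
  have : (Fi K m i0 i1 i2).comp (Fj K m i0 i1) = AlgHom.id K _ := by
    ext (l | l) : 1
    · simp only [AlgHom.comp_apply, Fj, MvPolynomial.aeval_X, Sum.elim_inl, Fi_inl, AlgHom.id_apply]
    · simp only [AlgHom.comp_apply, Fj, MvPolynomial.aeval_X, Sum.elim_inr, AlgHom.id_apply]
      rcases fin3_cases h01 h02 h12 l with rfl | rfl | rfl
      · simp [Fi_X]
      · simp [h01.symm, Fi_inr0]
      · simp [h02.symm, h12.symm, Fi_inr1]
  exact DFunLike.congr_fun this x

lemma Fj_Fi (h01 : i0 ≠ i1) (h02 : i0 ≠ i2) (h12 : i1 ≠ i2) (x : (RR m K)[X]) : Fj K m i0 i1 (Fi K m i0 i1 i2 x) = x := by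
  have h1 : ∀ p : RR m K, Fj K m i0 i1 (Fi K m i0 i1 i2 (C p)) = C p := by
    intro p
    have : ((Fj K m i0 i1).comp (Fi K m i0 i1 i2)).comp ((Algebra.ofId (RR m K) (RR m K)[X]).restrictScalars K) =
        (Algebra.ofId (RR m K) (RR m K)[X]).restrictScalars K := by
      apply MvPolynomial.algHom_ext
      rintro (l | l)
      · change Fj K m i0 i1 (Fi K m i0 i1 i2 (C _)) = C _
        simp [Fi_inl, Fj]
      · change Fj K m i0 i1 (Fi K m i0 i1 i2 (C _)) = C _
        fin_cases l
        · simp [Fi_inr0, Fj, h01.symm]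
        · simp [Fi_inr1, Fj, h02.symm, h12.symm]
    exact DFunLike.congr_fun this p
  induction x using Polynomial.induction_on' with
  | add p q hp hq => rw [map_add, map_add, hp, hq]
  | monomial k a =>
    rw [← C_mul_X_pow_eq_monomial, map_mul, map_mul, h1, map_pow, map_pow, Fi_X]
    simp [Fj]

lemma homZ_iff {n k : ℕ} {p : MvPolynomial (Fin n) K} (h : IsHomogZ K n k p) : p.IsHomogeneous k := by
  intro e he
  have := h e (MvPolynomial.mem_support_iff.2 he)
  rw [Finsupp.weight_apply, Finsupp.sum_fintype _ _ (by simp)]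
  simp only [Pi.one_apply, smul_eq_mul, mul_one]
  exact_mod_cast this

end Iso
end ConicBundleFormalization

namespace ConicBundleFormalization
open Polynomial

section
variable {K : Type} [Field K] {m : ℕ}

def BD (n : ℕ) (w : Fin 3 → ℤ) (d : ℤ) (e : Fin n ⊕ Fin 3 →₀ ℕ) : Prop :=
  (∑ i, (e (Sum.inl i) : ℤ)) + ∑ j, (e (Sum.inr j) : ℤ) * w j = d ∧ ∑ j, e (Sum.inr j) * 1 = 2

noncomputable def tg (m a1 a2 N : ℕ) (i0 i1 i2 : Fin 3) (e : Fin 3 →₀ ℕ) : MvPolynomial (Fin (m+1)) ℤ :=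
  open Classical in
  if e = Finsupp.single i0 1 + Finsupp.single i0 1 then 1
  else if e = Finsupp.single i1 1 + Finsupp.single i1 1 then QQ ℤ m a1 1
  else if e = Finsupp.single i1 1 + Finsupp.single i2 1 then FF ℤ m N
  else if e = Finsupp.single i2 1 + Finsupp.single i2 1 then QQ ℤ m a2 2 else 0

noncomputable def tF {n : ℕ} (g : Cox K n 3) : Cox K n 3 →ₐ[K] FractionRing (coneRing K g) :=
  (IsScalarTower.toAlgHom K (coneRing K g) (FractionRing (coneRing K g))).comp (Ideal.Quotient.mkₐ K (Ideal.span {g}))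

lemma tF_zero {n : ℕ} (g p : Cox K n 3) : tF g p = 0 ↔ g ∣ p := by
  change algebraMap (coneRing K g) (FractionRing (coneRing K g)) (Ideal.Quotient.mk _ p) = 0 ↔ _
  rw [IsFractionRing.to_map_eq_zero_iff, Ideal.Quotient.eq_zero_iff_mem, Ideal.mem_span_singleton]

lemma tF_frac {n : ℕ} (g : Cox K n 3) [(Ideal.span {g}).IsPrime] (a : FractionRing (coneRing K g)) :
    ∃ p q, tF g q ≠ 0 ∧ a * tF g q = tF g p := by
  obtain ⟨x, y, hy, rfl⟩ := IsFractionRing.div_surjective (A := coneRing K g) a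
  obtain ⟨p, rfl⟩ := Ideal.Quotient.mk_surjective x
  obtain ⟨q, rfl⟩ := Ideal.Quotient.mk_surjective y
  have hq : tF g q ≠ 0 := IsFractionRing.to_map_ne_zero_of_mem_nonZeroDivisors (R := coneRing K g) hy
  exact ⟨p, q, hq, div_mul_cancel₀ _ hq⟩

lemma gev_Fi {B : Type*} [CommRing B] [Algebra K B] (p : (RR m K)[X]) (i0 i1 i2 : Fin 3) (U : Fin (m+1) → B) (Z : Fin 3 → B) :
    gev (algebraMap K B) p U (Z i0) (Z i1) (Z i2) = MvPolynomial.aeval (Sum.elim U Z) (Fi K m i0 i1 i2 p) := by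
  have h := hom_eval₂ p (MvPolynomial.aeval (R := K) (Sum.elim (fun j => (MvPolynomial.X (Sum.inl j) : Cox K (m+1) 3))
    ![MvPolynomial.X (Sum.inr i1), MvPolynomial.X (Sum.inr i2)])).toRingHom
    (MvPolynomial.aeval (R := K) (Sum.elim U Z)).toRingHom (MvPolynomial.X (Sum.inr i0))
  refine Eq.trans ?_ h.symm
  unfold gev
  have hX : (MvPolynomial.aeval (R := K) (Sum.elim U Z)).toRingHom (MvPolynomial.X (Sum.inr i0)) = Z i0 := by simp
  rw [hX]
  congr 1
  apply MvPolynomial.ringHom_ext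
  · intro c; simp
  · rintro (i | i)
    · simp
    · fin_cases i <;> simp

lemma BD_sumElim {n : ℕ} {w : Fin 3 → ℤ} {d : ℤ} (e' : Fin n →₀ ℕ) (i j : Fin 3) :
    BD n w d (Finsupp.sumElim e' (Finsupp.single i 1 + Finsupp.single j 1)) ↔ (∑ l, (e' l : ℤ)) + w i + w j = d := by
  unfold BD
  simp only [Finsupp.sumElim_inl, Finsupp.sumElim_inr, Finsupp.add_apply, Nat.cast_add, add_mul,
    Finset.sum_add_distrib, Finsupp.single_apply, Nat.cast_ite, ite_mul, Nat.cast_one, Nat.cast_zero, one_mul, zero_mul,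
    Finset.sum_ite_eq, Finset.mem_univ, if_true, add_assoc]
  simp

lemma homog_supp {n k : ℕ} {q : MvPolynomial (Fin n) ℤ} (hq : q.IsHomogeneous k) {e : Fin n →₀ ℕ} (he : q.coeff e ≠ 0) :
    (∑ l, (e l : ℤ)) = k := by
  have := hq he
  rw [Finsupp.weight_apply, Finsupp.sum_fintype _ _ (by simp)] at this
  simp only [Pi.one_apply, smul_eq_mul, mul_one] at this
  exact_mod_cast this

theorem main3 [IsAlgClosed K] (hm6 : 6 ≤ m) {w : Fin 3 → ℤ} {d : ℤ} {g : Cox K (m+1) 3}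
    (hg : IsBihom K (m+1) 3 w (fun _ => 1) d 2 g) {i0 i1 i2 : Fin 3} (h01 : i0 ≠ i1) (h02 : i0 ≠ i2) (h12 : i1 ≠ i2)
    {a1 a2 N : ℕ} (hd0 : d = 2 * w i0) (hw1 : w i0 - w i1 = a1 + 1) (hw2 : w i0 - w i2 = a2 + 1)
    (hN : m+1+N = a1+a2+2) [(Ideal.span {g}).IsPrime]
    (hind : AlgebraicIndependent ℤ (fun e : {e // BD (m+1) w d e} => g.coeff e.1))
    {σ : Type*} (U : Fin (m+1) → MvPolynomial σ K) (Z : Fin 3 → MvPolynomial σ K)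
    (hG : MvPolynomial.aeval (Sum.elim U Z) g = 0) (y : σ → FractionRing (coneRing K g))
    (t : FractionRing (coneRing K g)) (ht : t ≠ 0)
    (hPhi : ∀ p, Phi a1 a2 (fun j => MvPolynomial.aeval y (U j)) (MvPolynomial.aeval y (Z i1)) (MvPolynomial.aeval y (Z i2)) p =
      t * Phi a1 a2 (fun j => tF g (MvPolynomial.X (Sum.inl j))) (tF g (MvPolynomial.X (Sum.inr i1)))
        (tF g (MvPolynomial.X (Sum.inr i2))) p) : False := by
  classical
  obtain ⟨O, κ, _, _, _, r, hr, hc⟩ := exists_placeC (fun e : {e // BD (m+1) w d e} => g.coeff e.1) hind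
    (fun e => (tg m a1 a2 N i0 i1 i2 (e.1.comapDomain Sum.inr Sum.inr_injective.injOn)).coeff
      (e.1.comapDomain Sum.inl Sum.inl_injective.injOn))
  have s01 := h01.symm
  have s02 := h02.symm
  have s12 := h12.symm
  have t00 : tg m a1 a2 N i0 i1 i2 (Finsupp.single i0 1 + Finsupp.single i0 1) = 1 := by simp [tg]
  have t01 : tg m a1 a2 N i0 i1 i2 (Finsupp.single i0 1 + Finsupp.single i1 1) = 0 := by
    simp [tg, Finsupp.single_left_inj, Finsupp.single_add_single_eq_single_add_single, *]
  have t02 : tg m a1 a2 N i0 i1 i2 (Finsupp.single i0 1 + Finsupp.single i2 1) = 0 := by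
    simp [tg, Finsupp.single_left_inj, Finsupp.single_add_single_eq_single_add_single, *]
  have t11 : tg m a1 a2 N i0 i1 i2 (Finsupp.single i1 1 + Finsupp.single i1 1) = QQ ℤ m a1 1 := by
    simp [tg, Finsupp.single_left_inj, Finsupp.single_add_single_eq_single_add_single, *]
  have t12 : tg m a1 a2 N i0 i1 i2 (Finsupp.single i1 1 + Finsupp.single i2 1) = FF ℤ m N := by
    simp [tg, Finsupp.single_left_inj, Finsupp.single_add_single_eq_single_add_single, *]
  have t22 : tg m a1 a2 N i0 i1 i2 (Finsupp.single i2 1 + Finsupp.single i2 1) = QQ ℤ m a2 2 := by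
    simp [tg, Finsupp.single_left_inj, Finsupp.single_add_single_eq_single_add_single, *]

  have lift : ∀ (i j : Fin 3) (k : ℕ) (_ : (k : ℤ) = d - w i - w j) (T : MvPolynomial (Fin (m+1)) ℤ)
      (_ : tg m a1 a2 N i0 i1 i2 (Finsupp.single i 1 + Finsupp.single j 1) = T) (_ : T.IsHomogeneous k),
      ∃ qO : MvPolynomial (Fin (m+1)) O, qO.map O.subtype = qq g i j ∧ qO.map r = T.map (Int.castRingHom κ) := by
    intro i j k hk T hT hTh
    apply lift_poly
    intro e
    rw [qq, coeff_fibreCoeff]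
    by_cases hb : BD (m+1) w d (Finsupp.sumElim e (Finsupp.single i 1 + Finsupp.single j 1))
    · obtain ⟨h1, h2⟩ := hc ⟨_, hb⟩
      refine ⟨h1, h2.trans ?_⟩
      rw [← hT]
      have e1 : (Finsupp.sumElim e (Finsupp.single i 1 + Finsupp.single j 1)).comapDomain Sum.inr Sum.inr_injective.injOn
        = Finsupp.single i 1 + Finsupp.single j 1 := by ext; simp
      have e2 : (Finsupp.sumElim e (Finsupp.single i 1 + Finsupp.single j 1)).comapDomain Sum.inl Sum.inl_injective.injOn
        = e := by ext; simp
      simp only [e1, e2]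
    · have h0 : g.coeff (Finsupp.sumElim e (Finsupp.single i 1 + Finsupp.single j 1)) = 0 := by
        by_contra h
        exact hb (hg _ (MvPolynomial.mem_support_iff.2 h))
      have h1 : T.coeff e = 0 := by
        by_contra h
        have := homog_supp hTh h
        apply hb
        rw [BD_sumElim]
        linarith
      rw [h1]
      simp only [h0]
      exact ⟨O.zero_mem, (map_zero r).trans Int.cast_zero.symm⟩
  obtain ⟨O00, k00, r00⟩ := lift i0 i0 0 (by push_cast; linarith) 1 t00 (MvPolynomial.isHomogeneous_one _ _)
  obtain ⟨O01, k01, r01⟩ := lift i0 i1 (a1+1) (by push_cast; linarith) 0 t01 (MvPolynomial.isHomogeneous_zero _ _ _)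
  obtain ⟨O02, k02, r02⟩ := lift i0 i2 (a2+1) (by push_cast; linarith) 0 t02 (MvPolynomial.isHomogeneous_zero _ _ _)
  obtain ⟨O11, k11, r11⟩ := lift i1 i1 (2*a1+2) (by push_cast; linarith) _ t11 (QQ_homog _ _)
  obtain ⟨O12, k12, r12⟩ := lift i1 i2 (a1+a2+2) (by push_cast; linarith) _ t12 (hN ▸ FF_homog _)
  obtain ⟨O22, k22, r22⟩ := lift i2 i2 (2*a2+2) (by push_cast; linarith) _ t22 (QQ_homog _ _)
  have H00 : (qq g i0 i0).IsHomogeneous 0 := homZ_iff (by have := qq_homog hg i0 i0; convert this using 1; push_cast; linarith)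
  have H01 : (qq g i0 i1).IsHomogeneous (a1+1) := homZ_iff (by have := qq_homog hg i0 i1; convert this using 1; push_cast; linarith)
  have H02 : (qq g i0 i2).IsHomogeneous (a2+1) := homZ_iff (by have := qq_homog hg i0 i2; convert this using 1; push_cast; linarith)
  have H11 : (qq g i1 i1).IsHomogeneous (2*a1+2) := homZ_iff (by have := qq_homog hg i1 i1; convert this using 1; push_cast; linarith)
  have H12 : (qq g i1 i2).IsHomogeneous (a1+a2+2) := homZ_iff (by have := qq_homog hg i1 i2; convert this using 1; push_cast; linarith)
  have H22 : (qq g i2 i2).IsHomogeneous (2*a2+2) := homZ_iff (by have := qq_homog hg i2 i2; convert this using 1; push_cast; linarith)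
  set c : O := O00.coeff 0 with hcdef
  have hq00 : qq g i0 i0 = MvPolynomial.C (c : K) := by
    rw [MvPolynomial.totalDegree_eq_zero_iff_eq_C.1 (Nat.le_zero.1 (MvPolynomial.IsHomogeneous.totalDegree_le H00)), ← k00]
    simp [MvPolynomial.coeff_map, c]
  have hrc : r c = 1 := by
    have := congrArg (MvPolynomial.coeff 0) r00
    simpa [MvPolynomial.coeff_map] using this
  have hcv : O.valuation (c : K) = 1 := by
    have h1 : ¬ O.valuation (c : K) < 1 := fun h => by
      rw [← hr, hrc] at h
      exact one_ne_zero h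
    exact le_antisymm (O.valuation_le_one c) (not_lt.1 h1)
  have hc0 : (c : K) ≠ 0 := by
    intro h
    rw [h] at hcv
    simp at hcv
  have hvm : (c : K)⁻¹ ∈ O := by
    rw [← O.valuation_le_one_iff, map_inv₀, hcv, inv_one]
  set v : O := ⟨(c : K)⁻¹, hvm⟩ with hv
  have hrv : r v = 1 := by
    have : c * v = 1 := Subtype.ext (by simp [hv, hc0])
    have := congrArg r this
    rwa [map_mul, hrc, one_mul, map_one] at this
  let cv : MvPolynomial (Fin (m+1)) K := MvPolynomial.C (c : K)⁻¹
  let gO : (RR m O)[X] := gq (MvPolynomial.C v * O01) (MvPolynomial.C v * O02) (MvPolynomial.C v * O11)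
    (MvPolynomial.C v * O12) (MvPolynomial.C v * O22)
  let gK : (RR m K)[X] := gq (cv * qq g i0 i1) (cv * qq g i0 i2) (cv * qq g i1 i1) (cv * qq g i1 i2) (cv * qq g i2 i2)
  have hgK : gO.map (MvPolynomial.map O.subtype) = gK := by
    simp only [gO, gK, gq_map, map_mul, MvPolynomial.map_C, k01, k02, k11, k12, k22]
    rfl
  have hred : gO.map (MvPolynomial.map r) = X ^ 2 + C (rho κ m a1 a2 N) := by
    simp only [gO, gq_map, map_mul, MvPolynomial.map_C, r01, r02, r11, r12, r22, hrv, map_one, one_mul, map_zero,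
      QQ_map, FF_map, gq_special]
  have hcc : ∀ {B : Type _} [CommRing B] [Algebra K B], algebraMap K B (c : K) * algebraMap K B (c : K)⁻¹ = 1 := by
    intro B _ _
    rw [← map_mul, mul_inv_cancel₀ hc0, map_one]
  have hdec := decomp hg h01 h02 h12
  have hFg : g = MvPolynomial.C (c : K) * Fi K m i0 i1 i2 gK := by
    have h1 : (MvPolynomial.C (c : K) : Cox K (m+1) 3) * MvPolynomial.C (c : K)⁻¹ = 1 := hcc
    have h2 : Fi K m i0 i1 i2 gK = MvPolynomial.X (Sum.inr i0) ^ 2 + MvPolynomial.C (c : K)⁻¹ * (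
      bs (qq g i1 i1) * MvPolynomial.X (Sum.inr i1) ^ 2 + bs (qq g i2 i2) * MvPolynomial.X (Sum.inr i2) ^ 2
      + bs (qq g i0 i1) * MvPolynomial.X (Sum.inr i0) * MvPolynomial.X (Sum.inr i1)
      + bs (qq g i0 i2) * MvPolynomial.X (Sum.inr i0) * MvPolynomial.X (Sum.inr i2)
      + bs (qq g i1 i2) * MvPolynomial.X (Sum.inr i1) * MvPolynomial.X (Sum.inr i2)) := by
      simp only [gK, gq, gql, gqc, map_add, map_mul, map_pow, Fi_X, Fi_base, Fi_inr0, Fi_inr1, cv]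
      simp only [bs, MvPolynomial.rename_C, map_mul]
      ring
    rw [h2]
    rw [hq00] at hdec
    simp only [bs, MvPolynomial.rename_C] at hdec ⊢
    linear_combination hdec - (MvPolynomial.rename Sum.inl (qq g i1 i1) * MvPolynomial.X (Sum.inr i1) ^ 2
      + MvPolynomial.rename Sum.inl (qq g i2 i2) * MvPolynomial.X (Sum.inr i2) ^ 2
      + MvPolynomial.rename Sum.inl (qq g i0 i1) * MvPolynomial.X (Sum.inr i0) * MvPolynomial.X (Sum.inr i1)
      + MvPolynomial.rename Sum.inl (qq g i0 i2) * MvPolynomial.X (Sum.inr i0) * MvPolynomial.X (Sum.inr i2)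
      + MvPolynomial.rename Sum.inl (qq g i1 i2) * MvPolynomial.X (Sum.inr i1) * MvPolynomial.X (Sum.inr i2)) * h1
  have hcu : IsUnit (MvPolynomial.C (c : K) : Cox K (m+1) 3) := (hc0.isUnit).map MvPolynomial.C
  refine main2 O r hr hm6 hN gO (gq_monic _ _ _ _ _) (gq_deg _ _ _ _ _) hred gK hgK ((tF g).comp (Fi K m i0 i1 i2))
    (fun p => ?_) (fun a => ?_) (fun c' u x0 x1 x2 => gev_gq_su _ _ _ _ _ ?_ ?_ ?_ ?_ ?_ _ c' u x0 x1 x2)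
    (fun c' u x0 x1 x2 => gev_gq_sx _ _ _ _ _ _ c' u x0 x1 x2) U (Z i0) (Z i1) (Z i2) ?_ y t ht ?_
  · rw [AlgHom.comp_apply, tF_zero]
    have h1 : g ∣ Fi K m i0 i1 i2 p ↔ Fi K m i0 i1 i2 gK ∣ Fi K m i0 i1 i2 p := by
      conv_lhs => rw [hFg]
      exact hcu.mul_left_dvd
    rw [h1]
    refine ⟨fun h => ?_, fun h => map_dvd _ h⟩
    have := map_dvd (Fj K m i0 i1) h
    rwa [Fj_Fi h01 h02 h12, Fj_Fi h01 h02 h12] at this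
  · obtain ⟨p, q, hq, h⟩ := tF_frac g a
    refine ⟨Fj K m i0 i1 p, Fj K m i0 i1 q, ?_, ?_⟩
    · rwa [AlgHom.comp_apply, Fi_Fj h01 h02 h12]
    · rwa [AlgHom.comp_apply, AlgHom.comp_apply, Fi_Fj h01 h02 h12, Fi_Fj h01 h02 h12]
  · simpa using (MvPolynomial.isHomogeneous_C _ _).mul H01
  · simpa using (MvPolynomial.isHomogeneous_C _ _).mul H02
  · simpa using (MvPolynomial.isHomogeneous_C _ _).mul H11
  · simpa using (MvPolynomial.isHomogeneous_C _ _).mul H12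
  · simpa using (MvPolynomial.isHomogeneous_C _ _).mul H22
  · have h1 := gev_Fi gK i0 i1 i2 U Z
    refine h1.trans ?_
    rw [hFg, map_mul] at hG
    exact (((hc0.isUnit).map MvPolynomial.C).map (MvPolynomial.aeval (R := K) (Sum.elim U Z))).mul_right_eq_zero.1 hG
  · intro p
    simp only [AlgHom.comp_apply, Fi_inl, Fi_inr0, Fi_inr1]
    exact hPhi p

end
end ConicBundleFormalization

namespace ConicBundleFormalization
open MvPolynomial

lemma clear_den {K R : Type} [Field K] [CommRing R] [Algebra K R] {s : ℕ} (P : Fin s → R) (Q : R) (U : MvPolynomial (Fin s) K) :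
    ∃ (k : ℕ) (N : R), ∀ (L : Type) [Field L] [Algebra K L] (f : R →ₐ[K] L), f Q ≠ 0 →
      aeval (fun i => f (P i) / f Q) U * f Q ^ k = f N := by
  induction U using MvPolynomial.induction_on with
  | C a => exact ⟨0, algebraMap K R a, fun L _ _ f _ => by simp⟩
  | add p q hp hq =>
    obtain ⟨k1, N1, h1⟩ := hp
    obtain ⟨k2, N2, h2⟩ := hq
    refine ⟨k1 + k2, N1 * Q ^ k2 + N2 * Q ^ k1, fun L _ _ f hQ => ?_⟩
    simp only [map_add, map_mul, map_pow]
    rw [← h1 L f hQ, ← h2 L f hQ]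
    ring
  | mul_X p i hp =>
    obtain ⟨k1, N1, h1⟩ := hp
    refine ⟨k1 + 1, N1 * P i, fun L _ _ f hQ => ?_⟩
    simp only [map_mul, aeval_X]
    rw [← h1 L f hQ]
    field_simp
    ring

theorem stab_data {K A M : Type} [Field K] [CommRing A] [IsDomain A] [Algebra K A] [Field M] [Algebra K M] [Infinite M]
    (ι : A →ₐ[K] M) (hι : Function.Injective ι) {r s : ℕ}
    (φ : FractionRing (MvPolynomial (Fin r) A) ≃ₐ[K] FractionRing (MvPolynomial (Fin s) K)) {τ : Type} [Fintype τ] (x : τ → A) :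
    ∃ (ψ : A →ₐ[K] FractionRing (MvPolynomial (Fin s) K)) (H : MvPolynomial (Fin s) K) (Y : τ → MvPolynomial (Fin s) K)
      (y : Fin s → M), H ≠ 0 ∧ (∀ j, ψ (x j) * algebraMap _ _ H = algebraMap _ _ (Y j)) ∧ aeval y H ≠ 0 ∧
        ∀ j, aeval y (Y j) = aeval y H * ι (x j) := by
  classical
  let R := MvPolynomial (Fin r) A
  let S := MvPolynomial (Fin s) K
  let f1 : R →ₐ[K] FractionRing R := IsScalarTower.toAlgHom K R (FractionRing R)
  have f1inj : Function.Injective f1 := IsFractionRing.injective R (FractionRing R)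
  let cA : A →ₐ[K] R := IsScalarTower.toAlgHom K A R
  let e1 : S →ₐ[K] FractionRing S := IsScalarTower.toAlgHom K S (FractionRing S)
  have e1inj : Function.Injective e1 := IsFractionRing.injective S (FractionRing S)
  let ψ : A →ₐ[K] FractionRing S := (φ : _ →ₐ[K] _).comp (f1.comp cA)
  obtain ⟨⟨H, hH⟩, hHx⟩ := IsLocalization.exist_integer_multiples (nonZeroDivisors S) Finset.univ (fun j => ψ (x j))
  have hH0 : H ≠ 0 := nonZeroDivisors.ne_zero hH
  choose Y hY using fun j => hHx j (Finset.mem_univ _)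
  have hY' : ∀ j, ψ (x j) * e1 H = e1 (Y j) := by
    intro j
    have := hY j
    rw [Algebra.smul_def] at this
    rw [mul_comm]
    exact this.symm
  obtain ⟨⟨Q, hQ⟩, hQx⟩ := IsLocalization.exist_integer_multiples (nonZeroDivisors R) Finset.univ
    (fun i => φ.symm (e1 (X i)))
  have hQ0 : Q ≠ 0 := nonZeroDivisors.ne_zero hQ
  choose P hP using fun j => hQx j (Finset.mem_univ _)
  have hf1Q : f1 Q ≠ 0 := fun h => hQ0 (f1inj (by rw [h, map_zero]))
  have hP' : ∀ i, φ.symm (e1 (X i)) = f1 (P i) / f1 Q := by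
    intro i
    have := hP i
    rw [Algebra.smul_def] at this
    rw [eq_div_iff hf1Q, mul_comm]
    exact this.symm
  have hev : ∀ U : S, aeval (fun i => f1 (P i) / f1 Q) U = φ.symm (e1 U) := by
    intro U
    have : (aeval (fun i => f1 (P i) / f1 Q) : S →ₐ[K] _) = (φ.symm : _ →ₐ[K] _).comp e1 := by
      ext i
      simp only [aeval_X, AlgHom.comp_apply]
      exact (hP' i).symm
    exact DFunLike.congr_fun this U
  obtain ⟨kH, NH, hNH⟩ := clear_den P Q H
  have hNH0 : NH ≠ 0 := by
    rintro rfl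
    have := hNH _ f1 hf1Q
    rw [map_zero, hev] at this
    have h1 : φ.symm (e1 H) ≠ 0 := by
      rw [Ne, EmbeddingLike.map_eq_zero_iff]
      exact fun h => hH0 (e1inj (by rw [h, map_zero]))
    exact mul_ne_zero h1 (pow_ne_zero _ hf1Q) this
  obtain ⟨t0, ht0⟩ : ∃ t0 : Fin r → M, eval t0 (MvPolynomial.map (ι : A →+* M) (NH * Q)) ≠ 0 := by
    by_contra h
    push Not at h
    have : MvPolynomial.map (ι : A →+* M) (NH * Q) = 0 := MvPolynomial.funext fun t => by rw [h t, map_zero]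
    have := MvPolynomial.map_injective (ι : A →+* M) hι (this.trans (map_zero _).symm)
    exact mul_ne_zero hNH0 hQ0 this
  let f2 : R →ₐ[K] M := { eval₂Hom (ι : A →+* M) t0 with
    commutes' := fun a => by
      change eval₂Hom (ι : A →+* M) t0 (algebraMap K R a) = _
      rw [IsScalarTower.algebraMap_apply K A R, MvPolynomial.algebraMap_eq, eval₂Hom_C]
      exact ι.commutes a }
  have hf2 : ∀ p : R, f2 p = eval t0 (MvPolynomial.map (ι : A →+* M) p) := fun p => (eval_map _ _ _).symm
  have hf2c : ∀ a, f2 (cA a) = ι a := fun a => eval₂Hom_C _ _ _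
  rw [← hf2, map_mul] at ht0
  have hf2Q := right_ne_zero_of_mul ht0
  refine ⟨ψ, H, Y, fun i => f2 (P i) / f2 Q, hH0, hY', ?_, ?_⟩
  · intro h
    have := hNH _ f2 hf2Q
    rw [h, zero_mul] at this
    exact left_ne_zero_of_mul ht0 this.symm
  · intro j
    obtain ⟨kY, NY, hNY⟩ := clear_den P Q (Y j)
    have h1 := hNY _ f1 hf1Q
    have h2 := hNH _ f1 hf1Q
    rw [hev] at h1 h2
    have h3 : φ.symm (e1 (Y j)) = f1 (cA (x j)) * φ.symm (e1 H) := by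
      rw [← hY', map_mul]
      congr 1
      exact φ.symm_apply_apply _
    have h4 : NY * Q ^ kH = cA (x j) * NH * Q ^ kY := by
      apply f1inj
      simp only [map_mul, map_pow]
      rw [← h1, ← h2, h3]
      ring
    have h5 := congrArg f2 h4
    simp only [map_mul, map_pow, hf2c] at h5
    rw [← hNY _ f2 hf2Q, ← hNH _ f2 hf2Q] at h5
    have hk := pow_ne_zero kH hf2Q
    have hk' := pow_ne_zero kY hf2Q
    apply mul_right_cancel₀ (mul_ne_zero hk hk')
    linear_combination h5

end ConicBundleFormalization

namespace ConicBundleFormalization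
open MvPolynomial

section Bihom
variable {K : Type} [Field K] {n : ℕ} {w : Fin 3 → ℤ}

abbrev BH (w : Fin 3 → ℤ) (α : ℤ) (β : ℕ) (p : Cox K n 3) : Prop := IsBihom K n 3 w (fun _ => 1) α β p

lemma BH.mul {α α' : ℤ} {β β' : ℕ} {p q : Cox K n 3} (hp : BH w α β p) (hq : BH w α' β' q) : BH w (α + α') (β + β') (p * q) := by
  classical
  intro e he
  obtain ⟨a, ha, b, hb, rfl⟩ := Finset.mem_add.1 (support_mul p q he)
  obtain ⟨h1, h2⟩ := hp a ha
  obtain ⟨h3, h4⟩ := hq b hb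
  simp only [Finsupp.add_apply, Nat.cast_add, Finset.sum_add_distrib, add_mul] at *
  exact ⟨by linarith, by omega⟩

lemma BH.add {α : ℤ} {β : ℕ} {p q : Cox K n 3} (hp : BH w α β p) (hq : BH w α β q) : BH w α β (p + q) := by
  classical
  intro e he
  rcases Finset.mem_union.1 (support_add he) with h | h
  exacts [hp e h, hq e h]

lemma BH_monomial (e : Fin n ⊕ Fin 3 →₀ ℕ) (c : K) {α : ℤ} {β : ℕ}
    (h : (∑ i, (e (Sum.inl i) : ℤ)) + ∑ j, (e (Sum.inr j) : ℤ) * w j = α) (h2 : ∑ j, e (Sum.inr j) * 1 = β) : BH w α β (monomial e c) := by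
  intro e' he'
  have := support_monomial_subset he'
  rw [Finset.mem_singleton] at this
  subst this
  exact ⟨h, h2⟩

lemma BH_bs {α : ℤ} {p : MvPolynomial (Fin n) K} (hp : IsHomogZ K n α p) : BH w α 0 (bs p) := by
  classical
  intro e he
  rw [support_rename_of_injective Sum.inl_injective, Finset.mem_image] at he
  obtain ⟨e', he', rfl⟩ := he
  have := hp e' he'
  have h0 : ∀ j : Fin 3, Finsupp.mapDomain (Sum.inl : Fin n → Fin n ⊕ Fin 3) e' (Sum.inr j) = 0 := fun j =>
    Finsupp.mapDomain_of_notMem_range _ _ (by simp)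
  have h1 : ∀ j : Fin n, Finsupp.mapDomain (Sum.inl : Fin n → Fin n ⊕ Fin 3) e' (Sum.inl j) = e' j := fun j =>
    Finsupp.mapDomain_apply Sum.inl_injective _ _
  simp only [h0, h1]
  simpa using this

lemma BH_inl (j : Fin n) : BH w 1 0 (X (Sum.inl j) : Cox K n 3) := by
  refine BH_monomial _ _ ?_ ?_ <;> simp [Finsupp.single_apply]

lemma BH_inr (j : Fin 3) : BH w (w j) 1 (X (Sum.inr j) : Cox K n 3) := by
  refine BH_monomial _ _ ?_ ?_ <;> simp [Finsupp.single_apply]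

lemma BH_one : BH w 0 0 (1 : Cox K n 3) := by
  refine BH_monomial _ _ ?_ ?_ <;> simp

lemma BH.pow {α : ℤ} {β : ℕ} {p : Cox K n 3} (hp : BH w α β p) (k : ℕ) : BH w (k * α) (k * β) (p ^ k) := by
  induction k with
  | zero => simpa using BH_one
  | succ k ih =>
    have := ih.mul hp
    rw [pow_succ]
    convert this using 1 <;> push_cast <;> ring

lemma bihom_scale {L : Type*} [Field L] [Algebra K L] {α : ℤ} {β : ℕ} {p : Cox K n 3} (hp : BH w α β p) {c e : L} (hc : c ≠ 0)
    (u : Fin n → L) (x : Fin 3 → L) :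
    aeval (Sum.elim (fun j => c * u j) (fun j => c ^ (w j) * e * x j)) p = c ^ α * e ^ β * aeval (Sum.elim u x) p := by
  rw [aeval_def, eval₂_eq', aeval_def, eval₂_eq', Finset.mul_sum]
  refine Finset.sum_congr rfl fun s hs => ?_
  obtain ⟨h1, h2⟩ := hp s hs
  simp only [Fintype.prod_sum_type, Sum.elim_inl, Sum.elim_inr, mul_pow, Finset.prod_mul_distrib]
  have e1 : ∏ i, c ^ s (Sum.inl i) = c ^ (∑ i, (s (Sum.inl i) : ℤ)) := by
    rw [Finset.prod_pow_eq_pow_sum, ← zpow_natCast]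
    push_cast
    rfl
  have e2 : ∏ i, (c ^ w i) ^ s (Sum.inr i) = c ^ (∑ j, (s (Sum.inr j) : ℤ) * w j) := by
    rw [Fin.sum_univ_three, Fin.prod_univ_three, zpow_add₀ hc, zpow_add₀ hc]
    simp only [← zpow_natCast, ← zpow_mul, mul_comm]
  have e3 : ∏ i : Fin 3, e ^ s (Sum.inr i) = e ^ β := by
    rw [Finset.prod_pow_eq_pow_sum, ← h2]
    simp
  rw [e1, e2, e3, ← h1, zpow_add₀ hc]
  ring

variable {d : ℤ} {g : Cox K n 3}

lemma not_dvd_X (hg : BH w d 2 g) (v : Fin n ⊕ Fin 3) : ¬ g ∣ X v := by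
  rintro ⟨h, hh⟩
  have hdec := decomp hg (i := 0) (j := 1) (k := 2) (by decide) (by decide) (by decide)
  have h0 : eval (fun _ => (0:K)) g = 0 := by rw [hdec]; simp
  have h1 : eval (fun _ => (0:K)) (pderiv v g) = 0 := by
    rw [hdec]; simp [Derivation.leibniz, Derivation.leibniz_pow]
  have := congrArg (fun p => eval (fun _ => (0:K)) (pderiv v p)) hh
  simp only [Derivation.leibniz, smul_eq_mul, map_add, map_mul, h0, h1] at this
  simp at this

end Bihom

lemma phi_aux {F : Type*} [Field F] {u0 x0 : F} (h0 : u0 ≠ 0) (hx : x0 ≠ 0) (h up uq xj : F) (a b : ℕ) :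
    (h * (up / u0)) * (h * (uq / u0)) ^ a * (h ^ b * (h * (xj * u0 ^ (a+1) / x0))) =
      h ^ (a + 1 + b + 1) / x0 * (up * uq ^ a * xj) := by
  rw [mul_pow, div_pow]
  field_simp
  ring

theorem main4 {K : Type} [Field K] [IsAlgClosed K] {m : ℕ} (hm6 : 6 ≤ m) {w : Fin 3 → ℤ} {d : ℤ} {g : Cox K (m+1) 3}
    (hg : BH w d 2 g) {i0 i1 i2 : Fin 3} (h01 : i0 ≠ i1) (h02 : i0 ≠ i2) (h12 : i1 ≠ i2)
    {a1 a2 N : ℕ} (hd0 : d = 2 * w i0) (hw1 : w i0 - w i1 = a1 + 1) (hw2 : w i0 - w i2 = a2 + 1)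
    (hN : m+1+N = a1+a2+2) (hprime : (Ideal.span {g}).IsPrime)
    (hind : AlgebraicIndependent ℤ (fun e : {e // BD (m+1) w d e} => g.coeff e.1))
    (hst : IsStablyRationalModel K w (fun _ => 1) g) : False := by
  classical
  obtain ⟨r, s, ⟨φ⟩⟩ := hst
  let M := FractionRing (coneRing K g)
  have : IsDomain (FracCone K g) := inferInstanceAs (IsDomain M)
  have : Infinite K := inferInstance
  have : Infinite M := Infinite.of_injective _ (algebraMap K M).injective
  let A := functionFieldModel K w (fun _ => 1) g
  let ι : A →ₐ[K] M := A.val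
  have hι : Function.Injective ι := Subtype.val_injective
  have htX : ∀ v, tF g (X v) ≠ 0 := fun v h => not_dvd_X hg v ((tF_zero _ _).1 h)
  let u : Fin (m+1) → M := fun j => tF g (X (Sum.inl j))
  let x : Fin 3 → M := fun j => tF g (X (Sum.inr j))
  have hu : ∀ j, u j ≠ 0 := fun j => htX _
  have hx : ∀ j, x j ≠ 0 := fun j => htX _
  have hmem : ∀ (α : ℤ) (β : ℕ) (p q : Cox K (m+1) 3) (_ : BH w α β p) (_ : BH w α β q) (_ : tF g q ≠ 0),
      (tF g p / tF g q : M) ∈ A := fun α β p q hp hq h => Algebra.subset_adjoin ⟨α, β, p, q, hp, hq, h, div_mul_cancel₀ (G₀ := M) _ h⟩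
  obtain ⟨al, hal⟩ : ∃ al : Fin 3 → ℕ, ∀ j, (al j : ℤ) = w i0 - w j := by
    refine ⟨fun j => (w i0 - w j).toNat, fun j => Int.toNat_of_nonneg ?_⟩
    rcases fin3_cases h01 h02 h12 j with rfl | rfl | rfl <;> omega
  have hξ : ∀ j, x j * u 0 ^ al j / x i0 ∈ A := by
    intro j
    have h1 : BH w (w i0) 1 (X (Sum.inr j) * X (Sum.inl 0) ^ al j : Cox K (m+1) 3) := by
      have := (BH_inr (K := K) (n := m+1) (w := w) j).mul ((BH_inl (w := w) (0 : Fin (m+1))).pow (al j))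
      have h := hal j
      convert this using 1 <;> linarith
    have := hmem _ _ _ _ h1 (BH_inr i0) (htX _)
    simpa only [map_mul, map_pow] using this
  let xx : Fin (m+1) ⊕ Fin 3 → A := Sum.elim (fun j => ⟨u j / u 0, hmem _ _ _ _ (BH_inl j) (BH_inl 0) (htX _)⟩)
    (fun j => ⟨x j * u 0 ^ al j / x i0, hξ j⟩)
  obtain ⟨ψ, H, Y, y, hH0, hHY, hyH, hyY⟩ := stab_data ι hι φ xx

  have hgxx : aeval xx g = 0 := by
    apply hι
    rw [map_zero, comp_aeval_apply]
    have h1 : aeval (Sum.elim u x) g = 0 := by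
      have : (aeval (Sum.elim u x) : Cox K (m+1) 3 →ₐ[K] M) = tF g := by
        ext (j | j) <;> simp [u, x]
      rw [this, tF_zero]
    have h2 := bihom_scale hg (c := (u 0)⁻¹) (e := u 0 ^ (w i0) / x i0) (inv_ne_zero (hu 0)) u x
    rw [h1, mul_zero] at h2
    rw [← h2]
    congr 2
    ext (j | j)
    · change u j / u 0 = (u 0)⁻¹ * u j
      rw [div_eq_inv_mul]
    · change x j * u 0 ^ al j / x i0 = (u 0)⁻¹ ^ w j * (u 0 ^ (w i0) / x i0) * x j
      have : u 0 ^ al j = u 0 ^ w i0 * (u 0)⁻¹ ^ w j := by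
        rw [← zpow_natCast, hal, zpow_sub₀ (hu 0), inv_zpow, div_eq_mul_inv]
      rw [this]
      ring
  let E := al 0 + al 1 + al 2
  have hE : ∀ j, al j ≤ E := by
    intro j
    fin_cases j <;> simp [E] <;> omega
  let Z : Fin 3 → MvPolynomial (Fin s) K := fun j => H ^ (E - al j) * Y (Sum.inr j)
  let L := FractionRing (MvPolynomial (Fin s) K)
  have hinj : Function.Injective (algebraMap (MvPolynomial (Fin s) K) L) := IsFractionRing.injective _ _
  have hHL : algebraMap (MvPolynomial (Fin s) K) L H ≠ 0 := fun h => hH0 (hinj (by rw [h, map_zero]))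
  refine main3 hm6 hg h01 h02 h12 hd0 hw1 hw2 hN hind (fun j => Y (Sum.inl j)) Z ?_ y (aeval y H ^ (E + 1) / x i0)
    (div_ne_zero (pow_ne_zero _ hyH) (hx _)) ?_
  · apply hinj
    have h1 : aeval (fun v => ψ (xx v)) g = 0 := by
      rw [← comp_aeval_apply, hgxx, map_zero]
    have h2 := bihom_scale hg (c := algebraMap _ L H) (e := algebraMap _ L H ^ ((E : ℤ) + 1 - w i0)) hHL
      (fun j => ψ (xx (Sum.inl j))) (fun j => ψ (xx (Sum.inr j)))
    have h3 : (Sum.elim (fun j => ψ (xx (Sum.inl j))) (fun j => ψ (xx (Sum.inr j)))) = fun v => ψ (xx v) := by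
      ext (j | j) <;> rfl
    rw [h3, h1, mul_zero] at h2
    rw [map_zero, ← h2]
    have h4 := comp_aeval_apply (f := Sum.elim (fun j => Y (Sum.inl j)) Z)
      (IsScalarTower.toAlgHom K (MvPolynomial (Fin s) K) L) g
    refine h4.trans ?_
    congr 2
    ext (j | j)
    · change algebraMap _ L (Y (Sum.inl j)) = algebraMap _ L H * ψ (xx (Sum.inl j))
      rw [← hHY, mul_comm]
    · change algebraMap _ L (H ^ (E - al j) * Y (Sum.inr j)) = _
      rw [map_mul, ← hHY, map_pow]
      change _ = algebraMap _ L H ^ w j * _ * _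
      rw [← zpow_add₀ hHL]
      have : w j + ((E : ℤ) + 1 - w i0) = (E - al j : ℕ) + 1 := by
        have := hal j
        have := hE j
        push_cast [this]
        linarith
      rw [this, zpow_add_one₀ hHL, zpow_natCast]
      ring
  · have hYl : ∀ j, aeval y (Y (Sum.inl j)) = aeval y H * (u j / u 0) := fun j => hyY _
    have hYr : ∀ j, aeval y (Y (Sum.inr j)) = aeval y H * (x j * u 0 ^ al j / x i0) := fun j => hyY _
    have key : ∀ (j : Fin 3) (a : ℕ) (_ : al j = a + 1) (p q : Fin (m+1)),
        aeval y (Y (Sum.inl p)) * aeval y (Y (Sum.inl q)) ^ a * aeval y (Z j) = aeval y H ^ (E + 1) / x i0 * (u p * u q ^ a * x j) := by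
      intro j a ha p q
      simp only [Z, map_mul, map_pow, hYl, hYr]
      obtain ⟨b, hb⟩ := Nat.exists_eq_add_of_le (hE j)
      have h1 : E - al j = b := by omega
      rw [h1, hb, ha]
      exact phi_aux (hu 0) (hx i0) _ _ _ _ a b
    have e1 := key i1 a1 (by have := hal i1; omega)
    have e2 := key i2 a2 (by have := hal i2; omega)
    intro p
    unfold Phi
    split_ifs
    · exact e1 _ _
    · exact e2 _ _

end ConicBundleFormalization

namespace ConicBundleFormalization
open MvPolynomial

theorem very_general_indep (n : ℕ) (w : Fin 3 → ℤ) (d : ℤ) :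
    ∃ D : ℕ → MvPolynomial ((Fin n ⊕ Fin 3) →₀ ℕ) ℂ,
      (∀ i, ∃ p₀, IsBihom ℂ n 3 w (fun _ => 1) d 2 p₀ ∧ evalCoeff ℂ p₀ (D i) ≠ 0) ∧
      ∀ p, (∀ i, evalCoeff ℂ p (D i) ≠ 0) →
        AlgebraicIndependent ℤ (fun e : {e // BD n w d e} => p.coeff e.1) := by
  classical
  let S : Set (MvPolynomial ((Fin n ⊕ Fin 3) →₀ ℕ) ℤ) := {P | ∃ p₀, IsBihom ℂ n 3 w (fun _ => 1) d 2 p₀ ∧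
    evalCoeff ℂ p₀ (map (Int.castRingHom ℂ) P) ≠ 0}
  have hc : Countable (MvPolynomial ((Fin n ⊕ Fin 3) →₀ ℕ) ℤ) := by
    rw [← Cardinal.mk_le_aleph0_iff]
    refine MvPolynomial.cardinalMk_le_max.trans ?_
    simp
  have hne : S.Nonempty := ⟨1, 0, by intro e he; simp at he, by simp [evalCoeff]⟩
  obtain ⟨f, hf⟩ := S.to_countable.exists_eq_range hne
  refine ⟨fun i => map (Int.castRingHom ℂ) (f i), fun i => ?_, fun p hp => ?_⟩
  · have : f i ∈ S := hf ▸ ⟨i, rfl⟩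
    exact this
  · rw [algebraicIndependent_iff]
    intro P hP
    by_contra hP0
    have hPS : rename Subtype.val P ∈ S := by
      have h1 : map (Int.castRingHom ℂ) P ≠ 0 := fun h =>
        hP0 (map_injective (Int.castRingHom ℂ) Int.cast_injective (h.trans (map_zero _).symm))
      obtain ⟨z, hz⟩ : ∃ z, eval z (map (Int.castRingHom ℂ) P) ≠ 0 := by
        by_contra h
        push Not at h
        exact h1 (MvPolynomial.funext fun t => by rw [h t, map_zero])
      refine ⟨∑ e ∈ P.vars, monomial e.1 (z e), ?_, ?_⟩
      · intro e he
        obtain ⟨e', he', h2⟩ := Finset.mem_biUnion.1 (MvPolynomial.support_sum he)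
        have := support_monomial_subset h2
        rw [Finset.mem_singleton] at this
        subst this
        exact e'.2
      · have h3 : ∀ e ∈ P.vars, coeff e.1 (∑ e ∈ P.vars, monomial e.1 (z e)) = z e := by
          intro e he
          rw [coeff_sum, Finset.sum_eq_single_of_mem e he]
          · simp
          · intro b _ hb
            rw [coeff_monomial, if_neg (fun h => hb (Subtype.ext h))]
        unfold evalCoeff
        rw [map_rename, eval_rename, eval_map]
        rw [eval_map] at hz
        convert hz using 1
        exact eval₂Hom_congr' rfl (fun i hi _ => h3 i hi) rfl
    obtain ⟨i, hi⟩ : rename Subtype.val P ∈ Set.range f := hf ▸ hPS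
    apply hp i
    unfold evalCoeff
    beta_reduce
    rw [hi, map_rename, eval_rename, eval_map]
    exact hP

end ConicBundleFormalization

namespace ConicBundleFormalization
open MvPolynomial

theorem height_chain {K : Type} [Field K] (n : ℕ) (k : ℕ) (hk : k ≤ n) :
    (k : ℕ∞) ≤ (RingHom.ker (aeval (fun i : Fin n => if i.1 < k then 0 else X i) :
      MvPolynomial (Fin n) K →ₐ[K] MvPolynomial (Fin n) K)).height := by
  induction k with
  | zero => simp
  | succ k ih =>
    have h1 := ih (by omega)
    have hlt : RingHom.ker (aeval (fun i : Fin n => if i.1 < k then 0 else X i) :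
        MvPolynomial (Fin n) K →ₐ[K] MvPolynomial (Fin n) K) <
        RingHom.ker (aeval (fun i : Fin n => if i.1 < k + 1 then 0 else X i) :
        MvPolynomial (Fin n) K →ₐ[K] MvPolynomial (Fin n) K) := by
      refine lt_of_le_of_ne ?_ ?_
      · intro p hp
        rw [RingHom.mem_ker] at hp ⊢
        have hc : (aeval (fun i : Fin n => if i.1 < k + 1 then 0 else X i) :
            MvPolynomial (Fin n) K →ₐ[K] MvPolynomial (Fin n) K) =
            (aeval (fun i : Fin n => if i.1 < k + 1 then 0 else X i)).comp
            (aeval (fun i : Fin n => if i.1 < k then 0 else X i)) := by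
          ext1 i
          by_cases h : i.1 < k
          · simp [h, h.le]
          · simp [h]
        rw [hc, AlgHom.comp_apply, hp, map_zero]
      · intro h
        have hx : (X ⟨k, by omega⟩ : MvPolynomial (Fin n) K) ∈
            RingHom.ker (aeval (fun i : Fin n => if i.1 < k + 1 then 0 else X i) :
            MvPolynomial (Fin n) K →ₐ[K] MvPolynomial (Fin n) K) := by
          simp [RingHom.mem_ker]
        rw [← h, RingHom.mem_ker] at hx
        simp at hx
    have hp1 := RingHom.ker_isPrime (aeval (fun i : Fin n => if i.1 < k then 0 else X i) :
      MvPolynomial (Fin n) K →ₐ[K] MvPolynomial (Fin n) K)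
    have hp2 := RingHom.ker_isPrime (aeval (fun i : Fin n => if i.1 < k + 1 then 0 else X i) :
      MvPolynomial (Fin n) K →ₐ[K] MvPolynomial (Fin n) K)
    have := Ideal.height_add_one_le_of_lt_of_isPrime hlt
    refine le_trans ?_ this
    push_cast
    gcongr

theorem exists_common_zero {K : Type} [Field K] [IsAlgClosed K] {n N : ℕ} (hN : N < n)
    (f : Fin N → MvPolynomial (Fin n) K) (hf : ∀ i, eval 0 (f i) = 0) :
    ∃ u : Fin n → K, u ≠ 0 ∧ ∀ i, eval u (f i) = 0 := by
  classical
  by_contra hcon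
  push Not at hcon
  set m0 : Ideal (MvPolynomial (Fin n) K) :=
    RingHom.ker (aeval (fun i : Fin n => if i.1 < n then 0 else X i) :
      MvPolynomial (Fin n) K →ₐ[K] MvPolynomial (Fin n) K) with hm0
  have hz : ∀ p : MvPolynomial (Fin n) K, p ∈ m0 ↔ eval 0 p = 0 := by
    intro p
    rw [hm0, RingHom.mem_ker]
    have : (aeval (fun i : Fin n => if i.1 < n then 0 else X i) :
      MvPolynomial (Fin n) K →ₐ[K] MvPolynomial (Fin n) K) =
      (Algebra.ofId K (MvPolynomial (Fin n) K)).comp (aeval (0 : Fin n → K)) := by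
      ext1 i; simp
    rw [this, AlgHom.comp_apply]
    change C (aeval (0 : Fin n → K) p) = 0 ↔ _
    rw [map_eq_zero, MvPolynomial.aeval_eq_eval]
  have hprime : m0.IsPrime := RingHom.ker_isPrime _
  have hmin : m0 ∈ (Ideal.span ((Finset.univ.image f : Finset _) : Set (MvPolynomial (Fin n) K))).minimalPrimes := by
    refine ⟨⟨hprime, ?_⟩, ?_⟩
    · rw [Ideal.span_le]
      intro p hp
      simp only [Finset.coe_image, Finset.coe_univ, Set.image_univ, Set.mem_range] at hp
      obtain ⟨i, rfl⟩ := hp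
      exact (hz _).2 (hf i)
    · rintro q ⟨hq, hIq⟩ - p hp
      have h1 : p ∈ (Ideal.span ((Finset.univ.image f : Finset _) : Set (MvPolynomial (Fin n) K))).radical := by
        rw [← MvPolynomial.vanishingIdeal_zeroLocus_eq_radical (K := K), mem_vanishingIdeal_iff]
        intro u hu
        rw [mem_zeroLocus_iff] at hu
        have hu0 : u = 0 := by
          by_contra h0
          obtain ⟨i, hi⟩ := hcon u h0
          exact hi (hu (f i) (Ideal.subset_span (by simp)))
        rw [hu0]
        exact (hz p).1 hp
      exact (hq.radical_le_iff.2 hIq) h1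
  have h1 := Ideal.height_le_card_of_mem_minimalPrimes_span_finset hmin
  have h2 := height_chain (K := K) n n le_rfl
  have h3 := h2.trans h1
  have h4 : (Finset.univ.image f).card ≤ N := by simpa using Finset.card_image_le (s := Finset.univ) (f := f)
  have : n ≤ (Finset.univ.image f).card := by exact_mod_cast h3
  omega

end ConicBundleFormalization

namespace ConicBundleFormalization
open MvPolynomial

section BihomPrime
variable {K : Type} [Field K] {n : ℕ} {w : Fin 3 → ℤ}

def LW (n : ℕ) (w : Fin 3 → ℤ) : Fin n ⊕ Fin 3 → ℤ ×ₗ ℕ :=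
  Sum.elim (fun _ => toLex (1, 0)) (fun j => toLex (w j, 1))

lemma LW_weight (e : Fin n ⊕ Fin 3 →₀ ℕ) : Finsupp.weight (LW n w) e =
    toLex ((∑ i, (e (Sum.inl i) : ℤ)) + ∑ j, (e (Sum.inr j) : ℤ) * w j, ∑ j, e (Sum.inr j) * 1) := by
  rw [Finsupp.weight_apply, Finsupp.sum_fintype _ _ (by simp), Fintype.sum_sum_type]
  simp only [LW, Sum.elim_inl, Sum.elim_inr]
  apply ofLex.injective
  have h : ∀ (ι : Type) (s : Finset ι) (f : ι → ℤ ×ₗ ℕ), ofLex (∑ i ∈ s, f i) = ∑ i ∈ s, ofLex (f i) := by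
    intro ι s f
    classical
    induction s using Finset.induction_on with
    | empty => simp
    | insert a s ha ih => rw [Finset.sum_insert ha, Finset.sum_insert ha, ← ih]; rfl
  rw [ofLex_add, h, h]
  simp only [ofLex_smul, ofLex_toLex]
  ext
  · simp [Prod.fst_sum]
  · simp [Prod.snd_sum]

lemma BH_iff_LW {α : ℤ} {β : ℕ} {p : Cox K n 3} : BH w α β p ↔ IsWeightedHomogeneous (LW n w) p (toLex (α, β)) := by
  constructor
  · intro h e he
    obtain ⟨h1, h2⟩ := h e (mem_support_iff.2 he)
    rw [LW_weight, h1, h2]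
  · intro h e he
    have := h (mem_support_iff.1 he)
    rw [LW_weight, toLex_inj, Prod.mk.injEq] at this
    exact this

attribute [local instance] MvPolynomial.weightedGradedAlgebra

theorem minprime_bihom {g f : Cox K n 3} {α α' : ℤ} {β β' : ℕ} (hg : BH w α β g) (hf : BH w α' β' f)
    {Q : Ideal (Cox K n 3)} (hQ : Q ∈ (Ideal.span {g, f}).minimalPrimes) : IsBihomIdeal K w (fun _ => 1) Q := by
  have hc : (Q.homogeneousCore (weightedHomogeneousSubmodule K (LW n w))).toIdeal.IsPrime := hQ.1.1.homogeneousCore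
  have hle : Ideal.span {g, f} ≤ (Q.homogeneousCore (weightedHomogeneousSubmodule K (LW n w))).toIdeal := by
    rw [Ideal.span_le]
    rintro x (rfl | rfl)
    · exact Ideal.mem_homogeneousCore_of_homogeneous_of_mem ⟨_, BH_iff_LW.1 hg⟩ (hQ.1.2 (Ideal.subset_span (by simp)))
    · exact Ideal.mem_homogeneousCore_of_homogeneous_of_mem ⟨_, BH_iff_LW.1 hf⟩ (hQ.1.2 (Ideal.subset_span (by simp)))
  have h := hQ.2 ⟨hc, hle⟩ (Ideal.toIdeal_homogeneousCore_le _ _)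
  refine le_trans h ?_
  change Ideal.homogeneousCore' _ _ ≤ _
  refine Ideal.span_mono ?_
  rintro _ ⟨⟨x, ⟨i, hi⟩⟩, hx, rfl⟩
  exact ⟨hx, (ofLex i).1, (ofLex i).2, BH_iff_LW.2 hi⟩

end BihomPrime
end ConicBundleFormalization

namespace ConicBundleFormalization
open MvPolynomial

theorem height_two {R : Type*} [CommRing R] [IsDomain R] [IsNoetherianRing R] {a b : R} (ha : a ≠ 0) (hpa : (Ideal.span {a}).IsPrime)
    (hb : b ∉ Ideal.span {a}) {Q : Ideal R} (hQ : Q ∈ (Ideal.span {a, b}).minimalPrimes) : Q.height = 2 := by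
  classical
  have hQp := hQ.1.1
  refine le_antisymm ?_ ?_
  · have h1 : Q.height ≤ (({a, b} : Finset R).card : ℕ∞) :=
      Ideal.height_le_card_of_mem_minimalPrimes_span_finset (by simpa using hQ)
    refine h1.trans ?_
    exact_mod_cast Finset.card_le_two
  · have hp0 : (⊥ : Ideal R).IsPrime := Ideal.isPrime_bot
    have h1 := Ideal.height_add_one_le_of_lt_of_isPrime (I := (⊥ : Ideal R)) (J := Ideal.span {a})
      (bot_lt_iff_ne_bot.2 (by simpa using ha))
    have h2 := Ideal.height_add_one_le_of_lt_of_isPrime (I := Ideal.span {a}) (J := Q) (by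
      refine lt_of_le_of_ne ?_ ?_
      · exact le_trans (Ideal.span_mono (by simp)) hQ.1.2
      · rintro rfl
        exact hb (hQ.1.2 (Ideal.subset_span (by simp))))
    calc (2 : ℕ∞) = 0 + 1 + 1 := by norm_num
      _ ≤ (⊥ : Ideal R).height + 1 + 1 := by gcongr; simp
      _ ≤ (Ideal.span {a}).height + 1 := by gcongr
      _ ≤ _ := h2

section Picard
variable {K : Type} [Field K] {n : ℕ} {w : Fin 3 → ℤ}

lemma prime_bs {p : MvPolynomial (Fin n) K} (hp : Prime p) : Prime (bs p) := by
  let E : Cox K n 3 ≃ₐ[K] _ := (renameEquiv K (Equiv.sumComm (Fin n) (Fin 3))).trans (sumAlgEquiv K (Fin 3) (Fin n))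
  have hE : ∀ x, E x = TT K n 3 x := fun x => rfl
  rw [← MulEquiv.prime_iff E.toMulEquiv]
  change Prime (E (bs p))
  rw [hE, TT_inl]
  exact (MvPolynomial.prime_C_iff _).2 hp

noncomputable def rbs (K : Type) [Field K] (n : ℕ) (c : Fin 3 → K) : Cox K n 3 →ₐ[K] MvPolynomial (Fin n) K :=
  aeval (Sum.elim X (fun j => C (c j)))

lemma rbs_bs (c : Fin 3 → K) (p : MvPolynomial (Fin n) K) : rbs K n c (bs p) = p := by
  have : (rbs K n c).comp (rename Sum.inl) = AlgHom.id K _ := by ext1; simp [rbs]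
  exact DFunLike.congr_fun this p

lemma rbs_inr (c : Fin 3 → K) (j : Fin 3) : rbs K n c (X (Sum.inr j)) = C (c j) := by simp [rbs]

lemma bs_inj {p : MvPolynomial (Fin n) K} (h : p ≠ 0) : (bs p : Cox K n 3) ≠ 0 := fun h0 => h (by
  rw [← rbs_bs 0 p, h0, map_zero])

lemma BH_zero_bs {α : ℤ} {f : Cox K n 3} (hf : BH w α 0 f) : ∃ f0, f = bs f0 := by
  classical
  obtain ⟨q, hq⟩ := exists_rename_eq_of_vars_subset_range f (Sum.inl : Fin n → Fin n ⊕ Fin 3) Sum.inl_injective (by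
    intro v hv
    obtain ⟨e, he, hve⟩ := (mem_vars_iff_mem_support v).1 (Finset.mem_coe.1 hv)
    rcases v with v | v
    · exact ⟨v, rfl⟩
    · exfalso
      have := (hf e he).2
      rw [Finset.sum_eq_zero_iff] at this
      have := this v (Finset.mem_univ _)
      simp at this
      exact (Finsupp.mem_support_iff.1 hve) this)
  exact ⟨q, hq.symm⟩

structure LinData (w : Fin 3 → ℤ) (k : Fin 3) (l : Cox K n 3) (φ : Cox K n 3 →ₐ[K] Cox K n 3) : Prop where
  bh : ∃ α, BH w α 1 l
  ker : φ l = 0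
  base : ∀ p, φ (bs p) = bs p
  fixk : φ (X (Sum.inr k)) = X (Sum.inr k)
  sub : ∀ p, p - φ p ∈ Ideal.span {l}
  ne : l ≠ 0

variable {k : Fin 3} {l : Cox K n 3} {φ : Cox K n 3 →ₐ[K] Cox K n 3}

noncomputable def PP (φ : Cox K n 3 →ₐ[K] Cox K n 3) (c : MvPolynomial (Fin n) K) : Ideal (Cox K n 3) :=
  Ideal.comap φ (Ideal.span {bs c})

lemma mem_PP {c : MvPolynomial (Fin n) K} {p : Cox K n 3} : p ∈ PP φ c ↔ bs c ∣ φ p := by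
  rw [PP, Ideal.mem_comap, Ideal.mem_span_singleton]

lemma PP_prime {c : MvPolynomial (Fin n) K} (hc : Prime c) : (PP φ c).IsPrime := by
  have : (Ideal.span {(bs c : Cox K n 3)}).IsPrime :=
    (Ideal.span_singleton_prime (bs_inj hc.ne_zero)).2 (prime_bs hc)
  exact Ideal.comap_isPrime φ _

lemma LinData.span_eq (h : LinData w k l φ) : Ideal.span {l} = RingHom.ker φ := by
  apply le_antisymm
  · rw [Ideal.span_le]; rintro x rfl; exact h.ker
  · intro p hp
    have := h.sub p
    rw [RingHom.mem_ker] at hp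
    rwa [hp, sub_zero] at this

lemma LinData.prime (h : LinData w k l φ) : (Ideal.span {l}).IsPrime := by
  rw [h.span_eq]; exact RingHom.ker_isPrime _

lemma LinData.PP_eq (h : LinData w k l φ) (c : MvPolynomial (Fin n) K) : PP φ c = Ideal.span {l, bs c} := by
  apply le_antisymm
  · intro p hp
    rw [mem_PP] at hp
    rw [← sub_add_cancel p (φ p)]
    refine Ideal.add_mem _ (Ideal.span_mono (by simp) (h.sub p)) ?_
    exact Ideal.mem_of_dvd _ hp (Ideal.subset_span (by simp))
  · rw [Ideal.span_le]
    rintro x (rfl | rfl)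
    · rw [SetLike.mem_coe, mem_PP, h.ker]; exact dvd_zero _
    · rw [SetLike.mem_coe, mem_PP, h.base]

lemma LinData.bs_notMem (h : LinData w k l φ) {c : MvPolynomial (Fin n) K} (hc : c ≠ 0) : bs c ∉ Ideal.span {l} := by
  rw [h.span_eq, RingHom.mem_ker, h.base]
  exact bs_inj hc

lemma LinData.divisor (hn : 2 ≤ n) (h : LinData w k l φ) {g l' : Cox K n 3} {c c1 : MvPolynomial (Fin n) K}
    (hdec : g = l * l' + bs c * X (Sum.inr k) ^ 2) {γ : ℤ} (hc : IsHomogZ K n γ c) (hc0 : c ≠ 0) (hc1 : Prime c1) (hcc : c1 ∣ c) :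
    IsPrimeDivisorOn K w (fun _ => 1) g ⟨PP φ c1, PP_prime hc1⟩ := by
  have hP := PP_prime (φ := φ) hc1
  have hbd : (bs c1 : Cox K n 3) ∣ bs c := map_dvd (rename Sum.inl) hcc
  have hht : (PP φ c1).height = 2 := by
    refine height_two h.ne h.prime (h.bs_notMem hc1.ne_zero) ?_
    rw [← h.PP_eq, Ideal.minimalPrimes_eq_subsingleton_self]
    rfl
  have hcP : bs c ∈ PP φ c1 := by rw [mem_PP, h.base]; exact hbd
  have hlP : l ∈ PP φ c1 := by rw [mem_PP, h.ker]; exact dvd_zero _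
  refine ⟨?_, ⟨?_, ⟨k, ?_⟩⟩, ?_, ?_⟩
  · change g ∈ PP φ c1
    rw [hdec]
    exact Ideal.add_mem _ (Ideal.mul_mem_right _ _ hlP) (Ideal.mul_mem_right _ _ hcP)
  · by_contra hcon
    push Not at hcon
    have hX : ∀ i : Fin n, c1 ∣ X i := by
      intro i
      have h1 := mem_PP.1 (hcon i)
      have e : (X (Sum.inl i) : Cox K n 3) = bs (X i) := by simp
      rw [e, h.base] at h1
      have := map_dvd (rbs K n 0) h1
      rwa [rbs_bs, rbs_bs] at this
    have a0 := hc1.irreducible.associated_of_dvd (MvPolynomial.X_prime (i := (⟨0, by omega⟩ : Fin n))).irreducible (hX _)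
    have := a0.symm.dvd.trans (hX ⟨1, by omega⟩)
    rw [MvPolynomial.X_dvd_X] at this
    simp at this
  · intro h1
    have h1 := mem_PP.1 h1
    rw [h.fixk] at h1
    have := map_dvd (rbs K n (fun _ => 1)) h1
    rw [rbs_bs, rbs_inr, C_1] at this
    exact hc1.not_isUnit (isUnit_of_dvd_one this)
  · obtain ⟨α, hα⟩ := h.bh
    refine minprime_bihom hα (BH_bs hc) ⟨⟨hP, ?_⟩, ?_⟩
    · rw [Ideal.span_le]; rintro x (rfl | rfl); exacts [hlP, hcP]
    · rintro q ⟨hq, hle⟩ hqP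
      by_contra hcon
      have hlt : q < PP φ c1 := lt_of_le_not_ge hqP hcon
      have h1 := Ideal.height_add_one_le_of_lt_of_isPrime hlt
      obtain ⟨q', hq', hqq⟩ := Ideal.exists_minimalPrimes_le hle
      have h2 := height_two h.ne h.prime (h.bs_notMem hc0) hq'
      have h3 := Ideal.height_mono hqq
      rw [h2] at h3
      rw [hht] at h1
      have : (2:ℕ∞) + 1 ≤ 2 := le_trans (by gcongr) h1
      exact absurd this (by decide)
  · rw [IsLocalization.AtPrime.ringKrullDim_eq_height (PP φ c1)]
    rw [hht]; rfl

end Picard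
end ConicBundleFormalization

namespace ConicBundleFormalization
open MvPolynomial

section Picard
variable {K : Type} [Field K] {n : ℕ} {w : Fin 3 → ℤ}

lemma lin_not_unit {l : Cox K n 3} {α : ℤ} (h : BH w α 1 l) : ¬ IsUnit l := by
  intro hu
  have h1 := bihom_scale h (c := (1:K)) (e := 0) one_ne_zero 0 0
  simp at h1
  have := hu.map (constantCoeff (R := K) (σ := Fin n ⊕ Fin 3))
  rw [h1] at this
  exact not_isUnit_zero this

theorem picard_contra [IsAlgClosed K] (hn : 2 ≤ n) {g l l' : Cox K n 3} {d : ℤ} (hg : BH w d 2 g)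
    (hprime : (Ideal.span {g}).IsPrime) (hcl : ClassGroupSpannedByFD K w (fun _ => 1) g)
    {k : Fin 3} {φ φ' : Cox K n 3 →ₐ[K] Cox K n 3} (h : LinData w k l φ) (h' : LinData w k l' φ')
    {c : MvPolynomial (Fin n) K} (hdec : g = l * l' + bs c * X (Sum.inr k) ^ 2) {γ : ℕ}
    (hc : IsHomogZ K n (γ + 1 : ℕ) c) (cc : Fin 3 → K) (hu : IsUnit (rbs K n cc (φ' l))) : False := by
  classical
  have hg0 : g ≠ 0 := by
    intro h0
    rw [hdec] at h0
    have h1 := congrArg φ h0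
    rw [map_add, map_mul, h.ker, zero_mul, zero_add, map_mul, h.base, map_pow, h.fixk, map_zero,
      mul_eq_zero] at h1
    rcases h1 with h1 | h1
    · rw [h1] at h0
      simp only [zero_mul, add_zero, mul_eq_zero] at h0
      rcases h0 with h0 | h0
      exacts [h.ne h0, h'.ne h0]
    · exact pow_ne_zero 2 (X_ne_zero _) h1
  have hgp : Prime g := (Ideal.span_singleton_prime hg0).1 hprime
  have hc0 : c ≠ 0 := by
    rintro rfl
    simp only [map_zero, zero_mul, add_zero] at hdec
    have hirr := hgp.irreducible
    obtain ⟨α, hα⟩ := h.bh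
    obtain ⟨α', hα'⟩ := h'.bh
    rcases hirr.isUnit_or_isUnit hdec with h1 | h1
    exacts [lin_not_unit hα h1, lin_not_unit hα' h1]
  have hcu : ¬ IsUnit c := by
    intro hcu
    have h1 := homZ_iff hc
    have := hcu.map (eval (0 : Fin n → K))
    have h2 : eval (0 : Fin n → K) c = 0 := by
      have : constantCoeff c = 0 := by
        by_contra h3
        have := h1 h3
        simp at this
      rwa [← MvPolynomial.eval_zero] at this
    rw [h2] at this
    exact not_isUnit_zero this
  obtain ⟨c1, hc1', hcc⟩ := WfDvdMonoid.exists_irreducible_factor hcu hc0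
  have hc1 : Prime c1 := hc1'.prime
  have hdiv := h.divisor hn hdec hc hc0 hc1 hcc
  have hdiv' := h'.divisor hn (l' := l) (hdec.trans (by ring)) hc hc0 hc1 hcc
  obtain ⟨α, β, f, hfg, hf, hfP, hfQ⟩ := hcl _ hdiv
  rcases Nat.eq_zero_or_pos β with rfl | hβ
  · obtain ⟨f0, rfl⟩ := BH_zero_bs hf
    have h1 := mem_PP.1 hfP
    rw [h.base] at h1
    refine hfQ _ hdiv' ?_ ?_
    · intro heq
      have h2 : PP φ' c1 = PP φ c1 := congrArg PrimeSpectrum.asIdeal heq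
      have h3 : l ∈ PP φ' c1 := by rw [h2, mem_PP, h.ker]; exact dvd_zero _
      rw [mem_PP] at h3
      have h4 := map_dvd (rbs K n cc) h3
      rw [rbs_bs] at h4
      exact hc1.not_isUnit (isUnit_of_dvd_unit h4 hu)
    · change bs f0 ∈ PP φ' c1
      rw [mem_PP, h'.base]; exact h1
  · let i0 : Fin n := ⟨0, by omega⟩
    obtain ⟨u, hu1⟩ : ∃ u : Fin n → K, eval u (c1 * X i0) ≠ 0 := by
      by_contra hcon
      push Not at hcon
      have : c1 * X i0 = (0 : MvPolynomial (Fin n) K) := MvPolynomial.funext (by intro u; rw [hcon u, map_zero])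
      rcases mul_eq_zero.1 this with h1 | h1
      exacts [hc1.ne_zero h1, X_ne_zero _ h1]
    rw [map_mul, mul_ne_zero_iff, eval_X] at hu1
    have hsub : ∀ (p : Cox K n 3) (v : Fin 3 → K), eval v (aeval (Sum.elim (fun i => C (u i)) X) p : MvPolynomial (Fin 3) K) = eval (Sum.elim u v) p := by
      intro p v
      rw [← MvPolynomial.aeval_eq_eval, ← MvPolynomial.aeval_eq_eval, ← AlgHom.comp_apply]
      congr 1
      ext1 i
      rcases i with i | i <;> simp
    have hz : ∀ (p : Cox K n 3) (α : ℤ) (β : ℕ), 0 < β → BH w α β p → eval (Sum.elim u 0) p = 0 := by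
      intro p α β hβ hp
      have h1 := bihom_scale hp (c := (1:K)) (e := 0) one_ne_zero u 0
      simp [hβ.ne'] at h1
      rw [← MvPolynomial.aeval_eq_eval]
      exact h1
    obtain ⟨v, hv0, hv⟩ := exists_common_zero (K := K) (n := 3) (N := 2) (by norm_num)
      ![aeval (Sum.elim (fun i => C (u i)) X) g, aeval (Sum.elim (fun i => C (u i)) X) f] (by
        intro i
        fin_cases i
        · exact (hsub g 0).trans (hz g _ _ (by norm_num) hg)
        · exact (hsub f 0).trans (hz f _ _ hβ hf))
    have hvg : eval (Sum.elim u v) g = 0 := (hsub g v).symm.trans (hv 0)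
    have hvf : eval (Sum.elim u v) f = 0 := (hsub f v).symm.trans (hv 1)
    have hmp : (RingHom.ker (eval (Sum.elim u v) : Cox K n 3 →+* K)).IsPrime := RingHom.ker_isPrime _
    obtain ⟨Q, hQ, hQm⟩ := Ideal.exists_minimalPrimes_le (I := Ideal.span {g, f})
      (J := RingHom.ker (eval (Sum.elim u v) : Cox K n 3 →+* K)) (by
        rw [Ideal.span_le]; rintro x (rfl | rfl)
        exacts [hvg, hvf])
    have hQp := hQ.1.1
    refine hfQ ⟨Q, hQp⟩ ⟨hQ.1.2 (Ideal.subset_span (by simp)), ⟨⟨i0, fun hx => ?_⟩, ?_⟩,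
      minprime_bihom hg hf hQ, ?_⟩ ?_ (hQ.1.2 (Ideal.subset_span (by simp)))
    · have := hQm hx
      rw [RingHom.mem_ker, eval_X] at this
      exact hu1.2 this
    · by_contra hcon
      push Not at hcon
      apply hv0
      funext j
      have := hQm (hcon j)
      rwa [RingHom.mem_ker, eval_X] at this
    · rw [IsLocalization.AtPrime.ringKrullDim_eq_height Q, height_two hg0 hprime hfg hQ]
      rfl
    · intro heq
      have h2 : Q = PP φ c1 := congrArg PrimeSpectrum.asIdeal heq
      have h3 : bs c1 ∈ Q := by rw [h2, mem_PP, h.base]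
      have := hQm h3
      rw [RingHom.mem_ker, eval_rename] at this
      exact hu1.1 (by simpa using this)

end Picard
end ConicBundleFormalization

namespace ConicBundleFormalization
open MvPolynomial

section Picard2
variable {K : Type} [Field K] {n : ℕ} {w : Fin 3 → ℤ}

lemma HZ_mul {a b c : ℤ} {p q : MvPolynomial (Fin n) K} (hp : IsHomogZ K n a p) (hq : IsHomogZ K n b q) (h : a + b = c) :
    IsHomogZ K n c (p * q) := by
  classical
  intro e he
  obtain ⟨x, hx, y, hy, rfl⟩ := Finset.mem_add.1 (support_mul p q he)
  have h1 := hp x hx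
  have h2 := hq y hy
  simp only [Finsupp.add_apply, Nat.cast_add, Finset.sum_add_distrib]
  omega

lemma HZ_add {a : ℤ} {p q : MvPolynomial (Fin n) K} (hp : IsHomogZ K n a p) (hq : IsHomogZ K n a q) :
    IsHomogZ K n a (p + q) := by
  classical
  intro e he
  rcases Finset.mem_union.1 (support_add he) with h | h
  exacts [hp e h, hq e h]

lemma HZ_neg {a : ℤ} {p : MvPolynomial (Fin n) K} (hp : IsHomogZ K n a p) : IsHomogZ K n a (-p) := by
  intro e he
  rw [support_neg] at he
  exact hp e he

lemma HZ_sub {a : ℤ} {p q : MvPolynomial (Fin n) K} (hp : IsHomogZ K n a p) (hq : IsHomogZ K n a q) :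
    IsHomogZ K n a (p - q) := by
  rw [sub_eq_add_neg]; exact HZ_add hp (HZ_neg hq)

lemma HZ_C (c : K) : IsHomogZ K n 0 (C c) := by
  classical
  intro e he
  rw [mem_support_iff, coeff_C] at he
  have : e = 0 := by by_contra h; exact he (if_neg (Ne.symm h))
  simp [this]

lemma HZ_Cmul {a : ℤ} (c : K) {p : MvPolynomial (Fin n) K} (hp : IsHomogZ K n a p) : IsHomogZ K n a (C c * p) :=
  HZ_mul (HZ_C c) hp (zero_add a)

lemma HZ_zero (a : ℤ) : IsHomogZ K n a (0 : MvPolynomial (Fin n) K) := by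
  intro e he; simp at he

noncomputable def sbs (i : Fin 3) (y : Cox K n 3) : Cox K n 3 →ₐ[K] Cox K n 3 :=
  aeval (Function.update X (Sum.inr i) y)

lemma sbs_bs (i : Fin 3) (y : Cox K n 3) (p : MvPolynomial (Fin n) K) : sbs i y (bs p) = bs p := by
  have : (sbs i y).comp (rename Sum.inl) = rename Sum.inl := by ext1; simp [sbs]
  exact DFunLike.congr_fun this p

lemma sbs_self (i : Fin 3) (y : Cox K n 3) : sbs i y (X (Sum.inr i)) = y := by simp [sbs]

lemma sbs_ne {i j : Fin 3} (h : j ≠ i) (y : Cox K n 3) : sbs i y (X (Sum.inr j)) = X (Sum.inr j) := by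
  simp [sbs, h]

lemma sbs_sub (i : Fin 3) (y p : Cox K n 3) : p - sbs i y p ∈ Ideal.span {X (Sum.inr i) - y} := by
  rw [← Ideal.Quotient.eq]
  have : (Ideal.Quotient.mkₐ K (Ideal.span {X (Sum.inr i) - y})) =
      (Ideal.Quotient.mkₐ K (Ideal.span {X (Sum.inr i) - y})).comp (sbs i y) := by
    ext1 v
    by_cases hv : v = Sum.inr i
    · subst hv
      rw [AlgHom.comp_apply, sbs_self]
      exact (Ideal.Quotient.eq).2 (Ideal.subset_span rfl)
    · simp [sbs, hv]
  exact DFunLike.congr_fun this p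

lemma mkLin {i j k : Fin 3} (hij : i ≠ j) (hik : i ≠ k) {a : K} (ha : a ≠ 0) {p q : MvPolynomial (Fin n) K}
    (hp : IsHomogZ K n (w i - w j) p) (hq : IsHomogZ K n (w i - w k) q) :
    LinData w k (C a * (X (Sum.inr i) - (bs p * X (Sum.inr j) + bs q * X (Sum.inr k))))
      (sbs i (bs p * X (Sum.inr j) + bs q * X (Sum.inr k))) := by
  have hy : sbs i (bs p * X (Sum.inr j) + bs q * X (Sum.inr k)) (bs p * X (Sum.inr j) + bs q * X (Sum.inr k)) =
      bs p * X (Sum.inr j) + bs q * X (Sum.inr k) := by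
    rw [map_add, map_mul, map_mul, sbs_bs, sbs_bs, sbs_ne hij.symm, sbs_ne hik.symm]
  have hC : ∀ y : Cox K n 3, Ideal.span {C a * y} = Ideal.span {y} := fun y =>
    Ideal.span_singleton_mul_left_unit ((ha.isUnit).map C) y
  refine ⟨⟨w i, ?_⟩, ?_, sbs_bs _ _, sbs_ne hik.symm _, ?_, ?_⟩
  · have h1 : BH w (w i) 1 (X (Sum.inr i) + (bs (-p) * X (Sum.inr j) + bs (-q) * X (Sum.inr k)) : Cox K n 3) := by
      refine BH.add (BH_inr i) (BH.add ?_ ?_)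
      · have := (BH_bs (w := w) (HZ_neg hp)).mul (BH_inr j); rwa [sub_add_cancel, zero_add] at this
      · have := (BH_bs (w := w) (HZ_neg hq)).mul (BH_inr k); rwa [sub_add_cancel, zero_add] at this
    have h2 : BH w 0 0 (C a : Cox K n 3) := BH_monomial _ _ (by simp) (by simp)
    have h3 := h2.mul h1
    rw [zero_add, zero_add] at h3
    convert h3 using 2
    simp only [map_neg]; ring
  · rw [map_mul, map_sub, sbs_self, hy, sub_self, mul_zero]
  · intro r
    rw [hC]; exact sbs_sub _ _ _
  · refine mul_ne_zero (by simpa using ha) ?_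
    intro h0
    have := congrArg (rbs K n (Pi.single i 1)) h0
    simp [rbs_inr, rbs_bs, Pi.single_eq_of_ne hij.symm, Pi.single_eq_of_ne hik.symm] at this

theorem picard_case1 [IsAlgClosed K] (hn : 2 ≤ n) {g : Cox K n 3} {d : ℤ} (hg : BH w d 2 g)
    (hprime : (Ideal.span {g}).IsPrime) (hcl : ClassGroupSpannedByFD K w (fun _ => 1) g)
    {i j k : Fin 3} (hij : i ≠ j) (hik : i ≠ k) (hjk : j ≠ k) (hd : d = w i + w j) (hdk : 0 < d - 2 * w k)
    (h0 : qq g i i = 0) {b : K} (hb : b ≠ 0) (hq : qq g i j = C b) : False := by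
  obtain ⟨γ, hγ⟩ : ∃ γ : ℕ, d - 2 * w k = (γ + 1 : ℕ) := ⟨(d - 2 * w k - 1).toNat, by omega⟩
  have e1 := qq_homog hg i k
  have e2 := qq_homog hg j j
  have e3 := qq_homog hg j k
  have e4 := qq_homog hg k k
  have hdec := decomp hg hij hik hjk
  rw [h0, hq] at hdec
  have hr : IsHomogZ K n (w j - w k) (-(C b⁻¹ * qq g i k)) := HZ_neg (HZ_Cmul _ (by convert e1 using 1; omega))
  have hs : IsHomogZ K n (d - w j - w k) (qq g j k - C b⁻¹ * (qq g j j * qq g i k)) :=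
    HZ_sub e3 (HZ_Cmul _ (HZ_mul e2 e1 (by omega)))
  have L1 := mkLin (w := w) (K := K) (n := n) hij.symm hjk one_ne_zero (HZ_zero (w j - w i)) hr
  have L2 := mkLin (w := w) (K := K) (n := n) hij hik hb (p := -(C b⁻¹ * qq g j j))
    (q := -(C b⁻¹ * (qq g j k - C b⁻¹ * (qq g j j * qq g i k))))
    (HZ_neg (HZ_Cmul _ (by convert e2 using 1; omega))) (HZ_neg (HZ_Cmul _ (by convert hs using 1; omega)))
  have hB : (C b * C b⁻¹ : Cox K n 3) = 1 := by rw [← C_mul, mul_inv_cancel₀ hb, C_1]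
  refine picard_contra hn hg hprime hcl L1 L2
    (c := qq g k k - C b⁻¹ * (qq g i k * (qq g j k - C b⁻¹ * (qq g j j * qq g i k)))) ?_ (γ := γ) ?_ (Pi.single j 1) ?_
  · conv_lhs => rw [hdec]
    simp only [map_neg, map_sub, map_mul, map_zero, rename_C, C_1]
    linear_combination (-(X (Sum.inr j) + C b⁻¹ * bs (qq g i k) * X (Sum.inr k)) * (bs (qq g j j) * X (Sum.inr j)
      + (bs (qq g j k) - C b⁻¹ * (bs (qq g j j) * bs (qq g i k))) * X (Sum.inr k))
      - bs (qq g i k) * X (Sum.inr i) * X (Sum.inr k)) * hB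
  · rw [← hγ]
    exact HZ_sub (by convert e4 using 1; omega) (HZ_Cmul _ (HZ_mul e1 hs (by omega)))
  · simp only [map_mul, map_sub, map_add, sbs_bs, sbs_ne hij.symm, sbs_ne hik.symm, rbs_inr, rbs_bs, map_zero, zero_mul]
    simp [hjk.symm]

theorem picard_case2 [IsAlgClosed K] (hn : 2 ≤ n) {g : Cox K n 3} {d : ℤ} (hg : BH w d 2 g)
    (hprime : (Ideal.span {g}).IsPrime) (hcl : ClassGroupSpannedByFD K w (fun _ => 1) g)
    {i j k : Fin 3} (hij : i ≠ j) (hik : i ≠ k) (hjk : j ≠ k) (hi : d = 2 * w i) (hj : d = 2 * w j) (hdk : 0 < d - 2 * w k)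
    {a r1 r2 : K} (ha : a ≠ 0) (hr : r1 ≠ r2) (h1 : qq g i i = C a) (h2 : qq g i j = C (-a * (r1 + r2)))
    (h3 : qq g j j = C (a * (r1 * r2))) : False := by
  obtain ⟨γ, hγ⟩ : ∃ γ : ℕ, d - 2 * w k = (γ + 1 : ℕ) := ⟨(d - 2 * w k - 1).toNat, by omega⟩
  have e1 := qq_homog hg i k
  have e3 := qq_homog hg j k
  have e4 := qq_homog hg k k
  have hdec := decomp hg hij hik hjk
  rw [h1, h2, h3] at hdec
  have hr' : r2 - r1 ≠ 0 := sub_ne_zero.2 hr.symm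
  have e1' : IsHomogZ K n (w i - w k) (C a⁻¹ * qq g i k) := HZ_Cmul _ (by convert e1 using 1; omega)
  have e3' : IsHomogZ K n (w i - w k) (C a⁻¹ * qq g j k) := HZ_Cmul _ (by convert e3 using 1; omega)

  have hs : IsHomogZ K n (w i - w k) (C (r2 - r1)⁻¹ * (C a⁻¹ * qq g j k + C r1 * (C a⁻¹ * qq g i k))) :=
    HZ_Cmul _ (HZ_add e3' (HZ_Cmul _ e1'))
  have hs' : IsHomogZ K n (w i - w k) (-(C (r2 - r1)⁻¹ * (C a⁻¹ * qq g j k + C r2 * (C a⁻¹ * qq g i k)))) :=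
    HZ_neg (HZ_Cmul _ (HZ_add e3' (HZ_Cmul _ e1')))
  have hC0 : ∀ c : K, IsHomogZ K n (w i - w j) (C c) := fun c => by
    have : w i - w j = 0 := by omega
    rw [this]; exact HZ_C c
  have L1 := mkLin (w := w) hij hik one_ne_zero (hC0 r1) hs
  have L2 := mkLin (w := w) hij hik ha (hC0 r2) hs'
  have hA : (C a * C a⁻¹ : Cox K n 3) = 1 := by rw [← C_mul, mul_inv_cancel₀ ha, C_1]
  have hR : ((C r2 - C r1) * C (r2 - r1)⁻¹ : Cox K n 3) = 1 := by rw [← C_sub, ← C_mul, mul_inv_cancel₀ hr', C_1]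
  generalize hsd : C (r2 - r1)⁻¹ * (C a⁻¹ * qq g j k + C r1 * (C a⁻¹ * qq g i k)) = s at *
  generalize hsd' : -(C (r2 - r1)⁻¹ * (C a⁻¹ * qq g j k + C r2 * (C a⁻¹ * qq g i k))) = s' at *
  have E1 : -(C a * (bs s + bs s')) = (bs (qq g i k) : Cox K n 3) := by
    rw [← hsd, ← hsd']
    simp only [map_add, map_mul, rename_C, map_neg]
    linear_combination (C a * C a⁻¹ * bs (qq g i k)) * hR + bs (qq g i k) * hA
  have E2 : C a * (C r2 * bs s + C r1 * bs s') = (bs (qq g j k) : Cox K n 3) := by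
    rw [← hsd, ← hsd']
    simp only [map_add, map_mul, rename_C, map_neg]
    linear_combination (C a * C a⁻¹ * bs (qq g j k)) * hR + bs (qq g j k) * hA
  refine picard_contra hn hg hprime hcl L1 L2 (c := qq g k k - C a * (s * s')) ?_ (γ := γ) ?_ (Pi.single j 1) ?_
  · conv_lhs => rw [hdec]
    rw [← E1, ← E2]
    simp only [map_neg, map_sub, map_mul, map_add, map_zero, rename_C, C_1]
    ring
  · rw [← hγ]
    exact HZ_sub (by convert e4 using 1; omega) (HZ_Cmul _ (HZ_mul hs hs' (by omega)))
  · simp only [map_mul, map_sub, map_add, sbs_self, sbs_bs, sbs_ne hij.symm, sbs_ne hik.symm, rbs_inr, rbs_bs, map_one, one_mul]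
    simp only [Pi.single_eq_same, Pi.single_eq_of_ne hjk.symm, map_zero, mul_zero, add_zero, map_one, mul_one, ← C_sub]
    exact hr'.isUnit.map C

end Picard2
end ConicBundleFormalization

namespace ConicBundleFormalization
open MvPolynomial

section Cases
variable {K : Type} [Field K] {n : ℕ} {w : Fin 3 → ℤ}

lemma HZ_const {p : MvPolynomial (Fin n) K} (h : IsHomogZ K n 0 p) : p = C (constantCoeff p) := by
  have h1 : p.IsHomogeneous 0 := homZ_iff (k := 0) (by simpa using h)
  have := (MvPolynomial.totalDegree_eq_zero_iff_eq_C).1 (Nat.le_zero.1 h1.totalDegree_le)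
  exact this

lemma HZ_eval0 {a : ℤ} {p : MvPolynomial (Fin n) K} (h : IsHomogZ K n a p) (h0 : eval 0 p ≠ 0) : a = 0 := by
  rw [MvPolynomial.eval_zero] at h0
  have := h 0 (mem_support_iff.2 h0)
  simpa using this.symm

lemma HZ_neg_zero {a : ℤ} {p : MvPolynomial (Fin n) K} (h : IsHomogZ K n a p) (ha : a < 0) : p = 0 := by
  rw [← support_eq_empty, Finset.eq_empty_iff_forall_notMem]
  intro e he
  have h1 := h e he
  have : (0:ℤ) ≤ ∑ i, (e i : ℤ) := Finset.sum_nonneg fun _ _ => by positivity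
  omega

lemma HZ_nonneg {a : ℤ} {p : MvPolynomial (Fin n) K} (h : IsHomogZ K n a p) (hp : p ≠ 0) : 0 ≤ a := by
  by_contra ha
  exact hp (HZ_neg_zero h (by omega))

lemma HZ_deg {a : ℤ} {p : MvPolynomial (Fin n) K} (h : IsHomogZ K n a p) (hp : p ≠ 0) : (p.totalDegree : ℤ) = a := by
  lift a to ℕ using HZ_nonneg h hp
  rw [(homZ_iff h).totalDegree hp]

lemma qmat_homog {g : Cox K n 3} {d : ℤ} (hg : BH w d 2 g) (i j : Fin 3) :
    IsHomogZ K n (d - w i - w j) (quadraticMatrix K g i j) := by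
  unfold quadraticMatrix
  split_ifs with h
  · subst h
    rw [← qq_self]; exact qq_homog hg i i
  · exact HZ_Cmul _ (qq_homog hg i j)

lemma disc_homog {g : Cox K n 3} {d : ℤ} (hg : BH w d 2 g) :
    IsHomogZ K n (3 * d - 2 * (w 0 + w 1 + w 2)) (discriminantPoly K g) := by
  unfold discriminantPoly
  rw [Matrix.det_fin_three]
  have h := qmat_homog hg
  have h3 : ∀ a b c a' b' c' : Fin 3, (w a + w b + w c + w a' + w b' + w c' = 2 * (w 0 + w 1 + w 2)) →
      IsHomogZ K n (3 * d - 2 * (w 0 + w 1 + w 2)) (quadraticMatrix K g a a' * quadraticMatrix K g b b' * quadraticMatrix K g c c') :=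
    fun a b c a' b' c' e => HZ_mul (HZ_mul (h _ _) (h _ _) rfl) (h _ _) (by omega)
  refine HZ_sub (HZ_add (HZ_add (HZ_sub (HZ_sub ?_ ?_) ?_) ?_) ?_) ?_ <;> exact h3 _ _ _ _ _ _ (by ring)

lemma singular_pt {g : Cox K n 3} {d : ℤ} (hg : BH w d 2 g) {i j k : Fin 3} (hij : i ≠ j) (hik : i ≠ k) (hjk : j ≠ k)
    (h0 : qq g i i = 0) (u : Fin n → K) (h1 : eval u (qq g i j) = 0) (h2 : eval u (qq g i k) = 0) :
    evalPt K (u, Pi.single i 1) g = 0 ∧ ∀ v, evalPt K (u, Pi.single i 1) (pderiv v g) = 0 := by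
  have hdec := decomp hg hij hik hjk
  rw [h0] at hdec
  have hb : ∀ q : MvPolynomial (Fin n) K, eval (Sum.elim u (Pi.single i 1 : Fin 3 → K)) (bs q) = eval u q := by
    intro q; rw [eval_rename, Sum.elim_comp_inl]
  have hj : (Pi.single i 1 : Fin 3 → K) j = 0 := Pi.single_eq_of_ne hij.symm _
  have hk : (Pi.single i 1 : Fin 3 → K) k = 0 := Pi.single_eq_of_ne hik.symm _
  unfold evalPt
  constructor
  · rw [hdec]; simp [hj, hk]
  · intro v
    rw [hdec]
    simp only [map_add, map_zero, zero_mul, Derivation.leibniz, Derivation.leibniz_pow, smul_eq_mul, map_mul, hb, eval_X, Sum.elim_inr, hj, hk, h1, h2]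
    simp [hj, hk]

lemma case2_roots [IsAlgClosed K] [CharZero K] {a b c : K} (ha : a ≠ 0) (hd : b ^ 2 - 4 * a * c ≠ 0) :
    ∃ r1 r2 : K, r1 ≠ r2 ∧ b = -a * (r1 + r2) ∧ c = a * (r1 * r2) := by
  obtain ⟨δ, hδ⟩ := IsAlgClosed.exists_pow_nat_eq (b ^ 2 - 4 * a * c) (n := 2) (by norm_num)
  have hδ0 : δ ≠ 0 := by rintro rfl; simp at hδ; exact hd hδ.symm
  refine ⟨(-b + δ) / (2 * a), (-b - δ) / (2 * a), ?_, ?_, ?_⟩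
  · intro h
    field_simp at h
    have : (2:K) * δ = 0 := by linear_combination h
    simp [hδ0] at this
  · field_simp; ring
  · field_simp
    linear_combination hδ

end Cases
end ConicBundleFormalization

namespace ConicBundleFormalization
open MvPolynomial

section Fin
variable {K : Type} [Field K] {n : ℕ} {w : Fin 3 → ℤ} {d : ℤ} {g : Cox K n 3}

lemma qq_const (hg : BH w d 2 g) {i j : Fin 3} (h : d = w i + w j) :
    qq g i j = C (g.coeff (Finsupp.sumElim 0 (Finsupp.single i 1 + Finsupp.single j 1))) := by
  have h1 := qq_homog hg i j
  rw [show d - w i - w j = 0 by omega] at h1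
  rw [HZ_const h1]
  congr 1
  rw [constantCoeff_eq, qq, coeff_fibreCoeff]

lemma fin_case1 [IsAlgClosed K] (hn : 3 ≤ n) (hg : BH w d 2 g) (hprime : (Ideal.span {g}).IsPrime)
    (hcl : ClassGroupSpannedByFD K w (fun _ => 1) g) (hsm : IsSmoothModel K g)
    {i j k : Fin 3} (hij : i ≠ j) (hik : i ≠ k) (hjk : j ≠ k)
    (hneg : d - 2 * w i < 0) (hD : 0 < 3 * d - 2 * (w i + w j + w k)) : False := by
  have hi0 : qq g i i = 0 := HZ_neg_zero (qq_homog hg i i) (by omega)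
  have key : ∀ j k : Fin 3, i ≠ j → i ≠ k → j ≠ k → 0 < 3 * d - 2 * (w i + w j + w k) → eval 0 (qq g i j) = 0 := by
    intro j k hij hik hjk hD
    by_contra h
    have h1 := HZ_eval0 (qq_homog hg i j) h
    have hq := qq_const hg (i := i) (j := j) (by omega)
    refine picard_case1 (by omega) hg hprime hcl hij hik hjk (by omega) (by omega) hi0 ?_ hq
    intro hb
    rw [hb] at hq
    rw [hq] at h
    simp at h
  obtain ⟨u, hu, hz⟩ := exists_common_zero (N := 2) (n := n) (by omega) ![qq g i j, qq g i k] (by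
    intro l
    fin_cases l
    · exact key j k hij hik hjk hD
    · exact key k j hik hij hjk.symm (by omega))
  obtain ⟨h1, h2⟩ := singular_pt hg hij hik hjk hi0 u (by simpa using hz 0) (by simpa using hz 1)
  obtain ⟨v, hv⟩ := hsm (u, Pi.single i 1) ⟨hu, by simp⟩ h1
  exact hv (h2 v)

lemma fin_case2 [IsAlgClosed K] [CharZero K] (hn : 3 ≤ n) (hg : BH w d 2 g) (hprime : (Ideal.span {g}).IsPrime)
    (hcl : ClassGroupSpannedByFD K w (fun _ => 1) g)
    (hind : AlgebraicIndependent ℤ (fun e : {e // BD n w d e} => g.coeff e.1))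
    {i j k : Fin 3} (hij : i ≠ j) (hik : i ≠ k) (hjk : j ≠ k)
    (hi : d = 2 * w i) (hj : d = 2 * w j) (hD : 0 < 3 * d - 2 * (w i + w j + w k)) : False := by
  classical
  have mk : ∀ a b : Fin 3, d = w a + w b → BD n w d (Finsupp.sumElim 0 (Finsupp.single a 1 + Finsupp.single b 1)) := by
    intro a b h
    rw [BD_sumElim]; simp; omega
  let e1 : {e // BD n w d e} := ⟨_, mk i i (by omega)⟩
  let e2 : {e // BD n w d e} := ⟨_, mk i j (by omega)⟩
  let e3 : {e // BD n w d e} := ⟨_, mk j j (by omega)⟩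
  have h12 : e1 ≠ e2 := by
    intro h
    have := DFunLike.congr_fun (congrArg Subtype.val h) (Sum.inr j)
    simp [e1, e2, hij] at this
  have h32 : e3 ≠ e2 := by
    intro h
    have := DFunLike.congr_fun (congrArg Subtype.val h) (Sum.inr i)
    simp [e3, e2, hij.symm] at this
  have ha : g.coeff e1.1 ≠ 0 := hind.ne_zero e1
  have hdisc : g.coeff e2.1 ^ 2 - 4 * g.coeff e1.1 * g.coeff e3.1 ≠ 0 := by
    intro h
    have h0 : (X e2 ^ 2 - 4 * X e1 * X e3 : MvPolynomial {e // BD n w d e} ℤ) = 0 := by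
      apply hind
      simp only [map_sub, map_mul, map_pow, aeval_X, map_zero, map_ofNat]
      exact h
    have h1 := congrArg (eval (fun e => if e = e2 then (1:ℤ) else 0)) h0
    simp [h12, h32] at h1
  obtain ⟨r1, r2, hr, hb, hc⟩ := case2_roots ha hdisc
  refine picard_case2 (by omega) hg hprime hcl hij hik hjk hi hj (by omega) ha hr (qq_const hg (by omega)) ?_ ?_
  · rw [← hb]; exact qq_const hg (by omega)
  · rw [← hc]; exact qq_const hg (by omega)

lemma fin_flat [IsAlgClosed K] (hn : 7 ≤ n) (hg : BH w d 2 g) (hfl : ProjectionIsFlat K g) :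
    ∃ i j : Fin 3, d = w i + w j := by
  by_contra! hne
  have h0 : ∀ i j, eval 0 (qq g i j) = 0 := by
    intro i j
    by_contra h
    have := HZ_eval0 (qq_homog hg i j) h
    exact hne i j (by omega)
  obtain ⟨u, hu, hz⟩ := exists_common_zero (N := 6) (n := n) (by omega)
    ![qq g 0 0, qq g 1 1, qq g 2 2, qq g 0 1, qq g 0 2, qq g 1 2] (by
    intro l
    fin_cases l <;> exact h0 _ _)
  obtain ⟨v, hv⟩ := hfl u hu
  apply hv
  have hdec := decomp hg (i := 0) (j := 1) (k := 2) (by decide) (by decide) (by decide)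
  have hb : ∀ q : MvPolynomial (Fin n) K, eval (Sum.elim u v) (bs q) = eval u q := by
    intro q; rw [eval_rename, Sum.elim_comp_inl]
  have z0 : eval u (qq g 0 0) = 0 := hz 0
  have z1 : eval u (qq g 1 1) = 0 := hz 1
  have z2 : eval u (qq g 2 2) = 0 := hz 2
  have z3 : eval u (qq g 0 1) = 0 := hz 3
  have z4 : eval u (qq g 0 2) = 0 := hz 4
  have z5 : eval u (qq g 1 2) = 0 := hz 5
  unfold evalPt
  rw [hdec]
  simp only [map_add, map_mul, hb, z0, z1, z2, z3, z4, z5, zero_mul, add_zero]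

lemma fin_main [IsAlgClosed K] [CharZero K] (hn : 7 ≤ n) (hg : BH w d 2 g) (hprime : (Ideal.span {g}).IsPrime)
    (hcl : ClassGroupSpannedByFD K w (fun _ => 1) g) (hsm : IsSmoothModel K g) (hfl : ProjectionIsFlat K g)
    (hind : AlgebraicIndependent ℤ (fun e : {e // BD n w d e} => g.coeff e.1))
    (hK : KMultipleplusDiscriminantEffective K g 2) (hst : IsStablyRationalModel K w (fun _ => 1) g) : False := by
  obtain ⟨hd0, h, hh, hhom⟩ := hK
  have hdeg := HZ_deg (disc_homog hg) hd0
  have hD2 := HZ_nonneg hhom hh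
  rw [hdeg] at hD2
  push_cast at hD2
  have hperm : ∀ i j k : Fin 3, i ≠ j → i ≠ k → j ≠ k → w i + w j + w k = w 0 + w 1 + w 2 := by
    intro i j k hij hik hjk
    fin_cases i <;> fin_cases j <;> fin_cases k <;> simp at hij hik hjk ⊢ <;> ring
  have hex : ∀ i : Fin 3, ∃ j k : Fin 3, i ≠ j ∧ i ≠ k ∧ j ≠ k := by decide
  have hex2 : ∀ i j : Fin 3, i ≠ j → ∃ k : Fin 3, i ≠ k ∧ j ≠ k := by decide
  have hnn : ∀ i, 0 ≤ d - 2 * w i := by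
    intro i
    by_contra hneg
    obtain ⟨j, k, hij, hik, hjk⟩ := hex i
    have := hperm i j k hij hik hjk
    exact fin_case1 (by omega) hg hprime hcl hsm hij hik hjk (by omega) (by omega)
  have hnz : ∀ i j, i ≠ j → d = 2 * w i → d = 2 * w j → False := by
    intro i j hij hi hj
    obtain ⟨k, hik, hjk⟩ := hex2 i j hij
    have := hperm i j k hij hik hjk
    exact fin_case2 (by omega) hg hprime hcl hind hij hik hjk hi hj (by omega)
  obtain ⟨i, j, hdij⟩ := fin_flat hn hg hfl
  have hij : i = j := by
    by_contra hij
    have h1 := hnn i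
    have h2 := hnn j
    exact hnz i j hij (by omega) (by omega)
  subst hij
  obtain ⟨j, k, hij, hik, hjk⟩ := hex i
  have hp := hperm i j k hij hik hjk
  have h1 := hnn j
  have h2 := hnn k
  have h3 : d ≠ 2 * w j := fun h => hnz i j hij (by omega) h
  have h4 : d ≠ 2 * w k := fun h => hnz i k hik (by omega) h
  obtain ⟨m, rfl⟩ : ∃ m, n = m + 1 := ⟨n - 1, by omega⟩
  obtain ⟨a1, ha1⟩ : ∃ a1 : ℕ, w i - w j = a1 + 1 := ⟨(w i - w j - 1).toNat, by omega⟩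
  obtain ⟨a2, ha2⟩ : ∃ a2 : ℕ, w i - w k = a2 + 1 := ⟨(w i - w k - 1).toNat, by omega⟩
  push_cast at hD2
  have hle : m + 1 ≤ a1 + a2 + 2 := by omega
  exact main4 (N := a1 + a2 + 2 - (m + 1)) (by omega) hg hij hik hjk (by omega) ha1 ha2 (by omega) hprime hind hst

end Fin
end ConicBundleFormalization

namespace ConicBundleFormalization

open MvPolynomial

theorem cor_discriminant_2K_standard
    (n : ℕ) (hn : 7 ≤ n) (d : ℤ) (w : Fin 3 → ℤ) :
    VeryGenerallyHolds ℂ n 3 w (fun _ => 1) d 2 (fun g =>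
      IsConicBundleModel ℂ n w d g →
      IsSmoothModel ℂ g →
      ProjectionIsFlat ℂ g →
      KMultipleplusDiscriminantEffective ℂ g 2 →
      ¬ IsStablyRationalModel ℂ w (fun _ => 1) g) := by
  obtain ⟨D, hD1, hD2⟩ := very_general_indep n w d
  refine ⟨D, hD1, ?_⟩
  intro p hp hD hcb hsm hfl hK hst
  exact fin_main hn hp hcb.integral hcb.picardRankTwo hsm hfl (hD2 p hD) hK hst

end ConicBundleFormalization
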